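/- arXiv:2003.11993 — 3 statements merged into one kernel-verified Lean document; each statement's English description precedes it below -/
import Mathlib

section
/- For all positive integers a1 ≤ a2 ≤ a3 with a2 ≥ 2, the hyperbolicity constant of C_{a1,a2,a3} is δ(C_{a1,a2,a3}) = (a3 + min{a2, 3·a1})/4. -/
open SimpleGraph Set

/-- Auxiliary distance on representations of points of the metric graph:
a point is represented by `(u, v, t)` with `u, v` adjacent and `t ∈ [0,1]`,
meaning the point on the edge `[u,v]` at distance `t` from `u`. -/
noncomputable def mgDistAux {V : Type} [Fintype V] [DecidableEq V] (G : SimpleGraph V)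
    (p q : V × V × ℝ) : ℝ :=
  min
    (min (if p.1 = q.1 ∧ p.2.1 = q.2.1 then |p.2.2 - q.2.2| else (Fintype.card V : ℝ) + 1)
         (if p.1 = q.2.1 ∧ p.2.1 = q.1 then |p.2.2 - (1 - q.2.2)| else (Fintype.card V : ℝ) + 1))
    (min (min (p.2.2 + (G.dist p.1 q.1 : ℝ) + q.2.2)
              (p.2.2 + (G.dist p.1 q.2.1 : ℝ) + (1 - q.2.2)))
         (min ((1 - p.2.2) + (G.dist p.2.1 q.1 : ℝ) + q.2.2)
              ((1 - p.2.2) + (G.dist p.2.1 q.2.1 : ℝ) + (1 - q.2.2))))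

/-- The points of the metric graph associated to a simple graph `G`:
the vertices together with the interior points of the edges. -/
def MGPoint {V : Type} (G : SimpleGraph V) : Type :=
  {p : V × V × ℝ // G.Adj p.1 p.2.1 ∧ p.2.2 ∈ Set.Icc (0 : ℝ) 1}

/-- The shortest-path distance on the metric graph associated to `G`
(every edge has length 1). -/
noncomputable def mgDist {V : Type} [Fintype V] [DecidableEq V] (G : SimpleGraph V)
    (p q : MGPoint G) : ℝ := mgDistAux G p.1 q.1

/-- Distance from a vertex `v` to a point of the metric graph. -/
noncomputable def mgVDist {V : Type} [Fintype V] [DecidableEq V] (G : SimpleGraph V)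
    (v : V) (x : MGPoint G) : ℝ :=
  min ((G.dist v x.1.1 : ℝ) + x.1.2.2) ((G.dist v x.1.2.1 : ℝ) + (1 - x.1.2.2))

/-- `γ` restricted to `[a,b]` is a geodesic in the metric graph of `G`
(an arc-length parametrization realizing distances). -/
def IsMGGeodesic {V : Type} [Fintype V] [DecidableEq V] (G : SimpleGraph V)
    (a b : ℝ) (γ : ℝ → MGPoint G) : Prop :=
  a ≤ b ∧ ∀ s ∈ Set.Icc a b, ∀ t ∈ Set.Icc a b, mgDist G (γ s) (γ t) = |s - t|

/-- A geodesic triangle in the metric graph of `G`: three geodesic sides whose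
endpoints match cyclically (distance `0` means equality of points). -/
structure MGTriangle {V : Type} [Fintype V] [DecidableEq V] (G : SimpleGraph V) where
  a1 : ℝ
  b1 : ℝ
  a2 : ℝ
  b2 : ℝ
  a3 : ℝ
  b3 : ℝ
  g1 : ℝ → MGPoint G
  g2 : ℝ → MGPoint G
  g3 : ℝ → MGPoint G
  h1 : IsMGGeodesic G a1 b1 g1
  h2 : IsMGGeodesic G a2 b2 g2
  h3 : IsMGGeodesic G a3 b3 g3
  glue1 : mgDist G (g1 b1) (g2 a2) = 0
  glue2 : mgDist G (g2 b2) (g3 a3) = 0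
  glue3 : mgDist G (g3 b3) (g1 a1) = 0

/-- The sharp thin constant `δ(T)` of a geodesic triangle: the infimum of the
`d ≥ 0` such that each side is contained in the `d`-neighborhood of the union of
the other two sides. -/
noncomputable def triangleDelta {V : Type} [Fintype V] [DecidableEq V] {G : SimpleGraph V}
    (T : MGTriangle G) : ℝ :=
  sInf {d : ℝ | 0 ≤ d ∧
    (∀ s ∈ Set.Icc T.a1 T.b1,
      (∃ t ∈ Set.Icc T.a2 T.b2, mgDist G (T.g1 s) (T.g2 t) ≤ d) ∨
      (∃ t ∈ Set.Icc T.a3 T.b3, mgDist G (T.g1 s) (T.g3 t) ≤ d)) ∧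
    (∀ s ∈ Set.Icc T.a2 T.b2,
      (∃ t ∈ Set.Icc T.a1 T.b1, mgDist G (T.g2 s) (T.g1 t) ≤ d) ∨
      (∃ t ∈ Set.Icc T.a3 T.b3, mgDist G (T.g2 s) (T.g3 t) ≤ d)) ∧
    (∀ s ∈ Set.Icc T.a3 T.b3,
      (∃ t ∈ Set.Icc T.a1 T.b1, mgDist G (T.g3 s) (T.g1 t) ≤ d) ∨
      (∃ t ∈ Set.Icc T.a2 T.b2, mgDist G (T.g3 s) (T.g2 t) ≤ d))}

/-- The hyperbolicity constant `δ(G)`: the supremum of `δ(T)` over all geodesic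
triangles `T` in the metric graph of `G`. -/
noncomputable def hypDelta {V : Type} [Fintype V] [DecidableEq V] (G : SimpleGraph V) : ℝ :=
  sSup {d : ℝ | ∃ T : MGTriangle G, d = triangleDelta T}

/-- The circumference of `G`: the length of a longest cycle. -/
noncomputable def circumference {V : Type} (G : SimpleGraph V) : ℕ :=
  sSup {n : ℕ | ∃ (a : V) (w : G.Walk a a), w.IsCycle ∧ w.length = n}

/-- `G` belongs to the class `𝒢(g,c,n)` of (connected) graphs with girth `g`,
circumference `c` and `n` vertices (vertex set `Fin n`). -/
def memGclass (g c : ℕ) {n : ℕ} (G : SimpleGraph (Fin n)) : Prop :=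
  G.Connected ∧ G.girth = g ∧ circumference G = c

/-- `A(g,c,n) = min {δ(G) : G ∈ 𝒢(g,c,n)}`. -/
noncomputable def Agcn (g c n : ℕ) : ℝ :=
  sInf {d : ℝ | ∃ G : SimpleGraph (Fin n), memGclass g c G ∧ d = hypDelta G}

/-- `B(g,c,n) = max {δ(G) : G ∈ 𝒢(g,c,n)}`. -/
noncomputable def Bgcn (g c n : ℕ) : ℝ :=
  sSup {d : ℝ | ∃ G : SimpleGraph (Fin n), memGclass g c G ∧ d = hypDelta G}

/-- `G` belongs to the class `ℋ(g,c,m)` of (connected) graphs with girth `g`,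
circumference `c` and `m` edges. -/
def memHclass (g c m : ℕ) {k : ℕ} (G : SimpleGraph (Fin k)) : Prop :=
  G.Connected ∧ G.girth = g ∧ circumference G = c ∧ G.edgeSet.ncard = m

/-- `α(g,c,m) = min {δ(G) : G ∈ ℋ(g,c,m)}`. -/
noncomputable def alphagcm (g c m : ℕ) : ℝ :=
  sInf {d : ℝ | ∃ (k : ℕ) (G : SimpleGraph (Fin k)), memHclass g c m G ∧ d = hypDelta G}

/-- `β(g,c,m) = max {δ(G) : G ∈ ℋ(g,c,m)}`. -/
noncomputable def betagcm (g c m : ℕ) : ℝ :=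
  sSup {d : ℝ | ∃ (k : ℕ) (G : SimpleGraph (Fin k)), memHclass g c m G ∧ d = hypDelta G}

/-- Model distance on the theta graph. -/
noncomputable def thD (A : Fin 3 → ℝ) (x y : Fin 3 × ℝ) : ℝ :=
  min (if x.1 = y.1 then |x.2 - y.2| else x.2 + y.2)
    (min (min (x.2 + y.2) (A x.1 - x.2 + (A y.1 - y.2)))
      (min (x.2 + A 0 + (A y.1 - y.2)) (A x.1 - x.2 + A 0 + y.2)))

def thValid (A : Fin 3 → ℝ) (x : Fin 3 × ℝ) : Prop := 0 ≤ x.2 ∧ x.2 ≤ A x.1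

lemma thD_cases (A : Fin 3 → ℝ) (x y : Fin 3 × ℝ) :
    (x.1 = y.1 ∧ thD A x y = |x.2 - y.2|) ∨ thD A x y = x.2 + y.2 ∨
    thD A x y = A x.1 - x.2 + (A y.1 - y.2) ∨ thD A x y = x.2 + A 0 + (A y.1 - y.2) ∨
    thD A x y = A x.1 - x.2 + A 0 + y.2 := by
  unfold thD
  split_ifs <;> grind

lemma thD_loc (A : Fin 3 → ℝ) (x y : Fin 3 × ℝ) (h : x.1 = y.1) : thD A x y ≤ |x.2 - y.2| := by
  unfold thD
  rw [if_pos h]; exact min_le_left _ _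

lemma thD_uu (A : Fin 3 → ℝ) (x y : Fin 3 × ℝ) : thD A x y ≤ x.2 + y.2 := by
  unfold thD
  exact (min_le_right _ _).trans ((min_le_left _ _).trans (min_le_left _ _))

lemma thD_ww (A : Fin 3 → ℝ) (x y : Fin 3 × ℝ) :
    thD A x y ≤ A x.1 - x.2 + (A y.1 - y.2) := by
  unfold thD
  exact (min_le_right _ _).trans ((min_le_left _ _).trans (min_le_right _ _))

lemma thD_uw (A : Fin 3 → ℝ) (x y : Fin 3 × ℝ) :
    thD A x y ≤ x.2 + A 0 + (A y.1 - y.2) := by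
  unfold thD
  exact (min_le_right _ _).trans ((min_le_right _ _).trans (min_le_left _ _))

lemma thD_wu (A : Fin 3 → ℝ) (x y : Fin 3 × ℝ) :
    thD A x y ≤ A x.1 - x.2 + A 0 + y.2 := by
  unfold thD
  exact (min_le_right _ _).trans ((min_le_right _ _).trans (min_le_right _ _))

lemma thD_comm (A : Fin 3 → ℝ) (x y : Fin 3 × ℝ) : thD A x y = thD A y x := by
  have key : ∀ x y, thD A x y ≤ thD A y x := by
    intro x y
    have h1 := thD_uu A x y
    have h2 := thD_ww A x y
    have h3 := thD_uw A x y
    have h4 := thD_wu A x y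
    rcases thD_cases A y x with ⟨e, h⟩ | h | h | h | h
    · rw [h, abs_sub_comm]; exact thD_loc A x y e.symm
    all_goals linarith
  exact le_antisymm (key x y) (key y x)

lemma thD_self (A : Fin 3 → ℝ) (x : Fin 3 × ℝ) (hx : thValid A x) (h0 : 0 ≤ A 0) :
    thD A x x = 0 := by
  obtain ⟨h1, h2⟩ := hx
  have := thD_loc A x x rfl
  simp at this
  rcases thD_cases A x x with ⟨e, h⟩ | h | h | h | h
  · simpa using h
  all_goals linarith

lemma thD_nonneg (A : Fin 3 → ℝ) (x y : Fin 3 × ℝ) (hx : thValid A x) (hy : thValid A y)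
    (h0 : 0 ≤ A 0) : 0 ≤ thD A x y := by
  obtain ⟨h1, h2⟩ := hx
  obtain ⟨h3, h4⟩ := hy
  rcases thD_cases A x y with ⟨e, h⟩ | h | h | h | h
  · rw [h]; exact abs_nonneg _
  all_goals linarith

lemma thD_triangle (A : Fin 3 → ℝ) (x y z : Fin 3 × ℝ) (hx : thValid A x) (hy : thValid A y)
    (hz : thValid A z) (h0 : 0 ≤ A 0) (hA : ∀ i, A 0 ≤ A i) :
    thD A x z ≤ thD A x y + thD A y z := by
  obtain ⟨h1, h2⟩ := hx
  obtain ⟨h3, h4⟩ := hy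
  obtain ⟨h5, h6⟩ := hz
  have k1 := thD_uu A x z
  have k2 := thD_ww A x z
  have k3 := thD_uw A x z
  have k4 := thD_wu A x z
  have k5 := thD_loc A x z
  have hy0 := hA y.1
  rcases thD_cases A x y with ⟨e, h⟩ | h | h | h | h <;>
  rcases thD_cases A y z with ⟨e', h'⟩ | h' | h' | h' | h' <;> rw [h, h']
  · exact (k5 (e.trans e')).trans (abs_sub_le _ _ _)
  all_goals
    try rw [← e] at *
    try rw [e'] at *
    try have a1 := le_abs_self (x.2 - y.2)
    try have a2 := neg_abs_le (x.2 - y.2)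
    try have a3 := le_abs_self (y.2 - z.2)
    try have a4 := neg_abs_le (y.2 - z.2)
    linarith

lemma thD_le_diam (A : Fin 3 → ℝ) (x y : Fin 3 × ℝ) (hx : thValid A x) (hy : thValid A y)
    (h01 : A 0 ≤ A 1) (h12 : A 1 ≤ A 2) (h0 : 0 ≤ A 0) :
    thD A x y ≤ (A 1 + A 2) / 2 := by
  obtain ⟨i, s⟩ := x
  obtain ⟨j, t⟩ := y
  obtain ⟨h1, h2⟩ := hx
  obtain ⟨h3, h4⟩ := hy
  have k1 := thD_uu A (i, s) (j, t)
  have k2 := thD_ww A (i, s) (j, t)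
  have k3 := thD_uw A (i, s) (j, t)
  have k4 := thD_wu A (i, s) (j, t)
  have k5 := thD_loc A (i, s) (j, t)
  simp only at *
  by_cases hij : i = j
  · subst hij
    have k5 := k5 rfl
    have : A i ≤ A 2 := by fin_cases i <;> simp <;> linarith
    rcases abs_cases (s - t) with h | h <;> linarith
  · have : A i + A j ≤ A 1 + A 2 := by fin_cases i <;> fin_cases j <;> simp at * <;> linarith
    linarith

lemma thD_key (A : Fin 3 → ℝ) (x y p : Fin 3 × ℝ) (hx : thValid A x) (hy : thValid A y)
    (hp : thValid A p)
    (h01 : A 0 ≤ A 1) (h12 : A 1 ≤ A 2) (h0 : 0 ≤ A 0)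
    (hg : thD A x p + thD A p y = thD A x y) (N : ℝ)
    (hN : N = (A 2 + min (A 1) (3 * A 0)) / 4) :
    thD A p x ≤ N ∨ thD A p y ≤ N ∨
      (x.1 ≠ y.1 ∧ thD A p (0, 0) ≤ N ∧ thD A p (0, A 0) ≤ N) := by
  by_contra! hcon
  obtain ⟨c1, c2, c3⟩ := hcon
  rw [thD_comm] at c1
  have hd := thD_le_diam A x y hx hy h01 h12 h0
  rcases min_cases (A 1) (3 * A 0) with ⟨hm, hm'⟩ | ⟨hm, hm'⟩ <;> rw [hm] at hN
  · linarith
  obtain ⟨i, s⟩ := x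
  obtain ⟨j, t⟩ := y
  obtain ⟨l, r⟩ := p
  obtain ⟨h1, h2⟩ := hx
  obtain ⟨h3, h4⟩ := hy
  obtain ⟨h5, h6⟩ := hp
  have k1 := thD_uu A (i, s) (j, t)
  have k2 := thD_ww A (i, s) (j, t)
  have k3 := thD_uw A (i, s) (j, t)
  have k4 := thD_wu A (i, s) (j, t)
  have k5 := thD_loc A (i, s) (j, t)
  have m1 := thD_uu A (l, r) (0, 0)
  have m2 := thD_wu A (l, r) (0, 0)
  have m3 := thD_ww A (l, r) (0, A 0)
  have m4 := thD_uw A (l, r) (0, A 0)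
  have m5 := thD_loc A (l, r) (0, 0)
  have m6 := thD_loc A (l, r) (0, A 0)
  simp only at *
  by_cases hij : i = j
  · subst hij
    have k5 := k5 rfl
    have : A i ≤ A 2 := by fin_cases i <;> simp <;> linarith
    rcases abs_cases (s - t) with h | h <;> linarith
  have c3 := c3 hij
  have hl : l ≠ 0 := by
    rintro rfl
    rcases le_or_gt (thD A (0, r) (0, 0)) N with h | h
    · have := c3 h
      linarith
    · linarith
  by_cases hi : i = 0
  · have : A i + A j ≤ A 0 + A 2 := by subst hi; fin_cases j <;> simp at * <;> linarith
    linarith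
  by_cases hj : j = 0
  · have : A i + A j ≤ A 0 + A 2 := by subst hj; fin_cases i <;> simp at * <;> linarith
    linarith
  have hi2 : A i ≤ A 2 := by fin_cases i <;> simp at * <;> linarith
  have hj2 : A j ≤ A 2 := by fin_cases j <;> simp at * <;> linarith
  have hl2 : A l ≤ A 2 := by fin_cases l <;> simp at * <;> linarith
  have hlij : l = i ∨ l = j := by omega
  have c4 : N < r ∧ N < A l - r + A 0 ∨ N < A l - r ∧ N < r + A 0 := by
    rcases le_or_gt (thD A (l, r) (0, 0)) N with h | h
    · have := c3 h
      right; constructor <;> linarith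
    · left; constructor <;> linarith
  rcases hlij with rfl | rfl
  · rcases thD_cases A (l, s) (l, r) with ⟨e, h⟩ | h | h | h | h <;>
    rcases thD_cases A (l, r) (j, t) with ⟨e', h'⟩ | h' | h' | h' | h' <;>
    simp only at h h' <;> try exact absurd e' hij
    all_goals
      try rcases abs_cases (s - r) with ⟨ha, _⟩ | ⟨ha, _⟩ <;> rw [ha] at h
    all_goals rcases c4 with c4 | c4 <;> linarith
  · rcases thD_cases A (i, s) (l, r) with ⟨e, h⟩ | h | h | h | h <;>
    rcases thD_cases A (l, r) (l, t) with ⟨e', h'⟩ | h' | h' | h' | h' <;>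
    simp only at h h' <;> try exact absurd e hij
    all_goals
      try rcases abs_cases (r - t) with ⟨ha, _⟩ | ⟨ha, _⟩ <;> rw [ha] at h'
    all_goals rcases c4 with c4 | c4 <;> linarith

lemma thD_near (A : Fin 3 → ℝ) (x y : Fin 3 × ℝ) (hx : thValid A x) (hy : thValid A y)
    (hA : ∀ i, A 0 ≤ A i) (h0 : 0 ≤ A 0) (hne : x.1 ≠ y.1) :
    thD A x (0, 0) ≤ thD A x y ∨ thD A x (0, A 0) ≤ thD A x y := by
  obtain ⟨h1, h2⟩ := hx
  obtain ⟨h3, h4⟩ := hy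
  have m1 := thD_uu A x (0, 0)
  have m3 := thD_ww A x (0, A 0)
  simp only at *
  rcases thD_cases A x y with ⟨e, h⟩ | h | h | h | h
  · exact absurd e hne
  · left; linarith
  · right; linarith
  · left; linarith
  · right; linarith

lemma th_edges_getVert {V : Type} {G : SimpleGraph V} {a b : V} (p : G.Walk a b) (v v' : V)
    (h : s(v, v') ∈ p.edges) : ∃ k, k + 1 ≤ p.length ∧ ((p.getVert k = v ∧ p.getVert (k + 1) = v') ∨
      (p.getVert k = v' ∧ p.getVert (k + 1) = v)) := by
  induction p with
  | nil => simp at h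
  | cons hadj q ih =>
    rw [Walk.edges_cons, List.mem_cons] at h
    rcases h with h | h
    · refine ⟨0, by simp, ?_⟩
      rw [Sym2.eq_iff] at h
      rcases h with ⟨rfl, rfl⟩ | ⟨rfl, rfl⟩
      · left; simp
      · right; simp
    · obtain ⟨k, hk, hor⟩ := ih h
      refine ⟨k + 1, by simpa using hk, ?_⟩
      simpa using hor

structure ThetaData {V : Type} [Fintype V] [DecidableEq V] (G : SimpleGraph V) (u w : V)
    (P : Fin 3 → G.Walk u w) (A : Fin 3 → ℝ) : Prop where
  conn : G.Connected
  path : ∀ i, (P i).IsPath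
  len : ∀ i, A i = ((P i).length : ℝ)
  disj : ∀ i j, i ≠ j → ∀ v, v ∈ (P i).support → v ∈ (P j).support → v = u ∨ v = w
  cov : ∀ e ∈ G.edgeSet, ∃ i, e ∈ (P i).edges
  one : ∀ i j, i ≠ j → 2 ≤ (P i).length ∨ 2 ≤ (P j).length
  pos : ∀ i, 1 ≤ (P i).length
  h01 : A 0 ≤ A 1
  h12 : A 1 ≤ A 2

namespace ThetaData

variable {V : Type} [Fintype V] [DecidableEq V] {G : SimpleGraph V} {u w : V}
    {P : Fin 3 → G.Walk u w} {A : Fin 3 → ℝ}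

lemma pos' (h : ThetaData G u w P A) (i) : 1 ≤ A i := by
  rw [h.len]; exact_mod_cast h.pos i

lemma zero (h : ThetaData G u w P A) : 0 ≤ A 0 := by linarith [h.pos' 0]

lemma hA (h : ThetaData G u w P A) : ∀ i, A 0 ≤ A i := by
  have := h.h01
  have := h.h12
  intro i
  fin_cases i <;> simp <;> linarith

lemma inj (h : ThetaData G u w P A) (i) (k l : ℕ) (hk : k ≤ (P i).length)
    (hl : l ≤ (P i).length) (e : (P i).getVert k = (P i).getVert l) : k = l :=
  (h.path i).getVert_injOn hk hl e

lemma eq_iff (h : ThetaData G u w P A) (i j) (hij : i ≠ j) (k l : ℕ) (hk : k ≤ (P i).length)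
    (hl : l ≤ (P j).length) (e : (P i).getVert k = (P j).getVert l) :
    (k = 0 ∧ l = 0) ∨ (k = (P i).length ∧ l = (P j).length) := by
  have h1 := h.disj i j hij _ ((P i).getVert_mem_support k) (e ▸ (P j).getVert_mem_support l)
  rcases h1 with h1 | h1
  · left
    constructor
    · exact h.inj i k 0 hk (Nat.zero_le _) (by simpa using h1)
    · exact h.inj j l 0 hl (Nat.zero_le _) (by rw [← e]; simpa using h1)
  · right
    constructor
    · exact h.inj i k _ hk le_rfl (by simpa using h1)
    · exact h.inj j l _ hl le_rfl (by rw [← e]; simpa using h1)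

lemma edge_eq (h : ThetaData G u w P A) (i j) (k l : ℕ) (hk : k + 1 ≤ (P i).length)
    (hl : l + 1 ≤ (P j).length) (e : (P i).getVert k = (P j).getVert l)
    (e' : (P i).getVert (k + 1) = (P j).getVert (l + 1)) : i = j ∧ k = l := by
  by_cases hij : i = j
  · subst hij
    exact ⟨rfl, h.inj i k l (by omega) (by omega) e⟩
  · exfalso
    have h1 := h.eq_iff i j hij k l (by omega) (by omega) e
    have h2 := h.eq_iff i j hij _ _ hk hl e'
    have := h.one i j hij
    omega

lemma edge_cross (h : ThetaData G u w P A) (i j) (k l : ℕ) (hk : k + 1 ≤ (P i).length)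
    (hl : l + 1 ≤ (P j).length) (e : (P i).getVert k = (P j).getVert (l + 1))
    (e' : (P i).getVert (k + 1) = (P j).getVert l) : False := by
  by_cases hij : i = j
  · subst hij
    have h1 := h.inj i _ _ (by omega) (by omega) e
    have h2 := h.inj i _ _ (by omega) (by omega) e'
    omega
  · have h1 := h.eq_iff i j hij _ _ (by omega) (by omega) e
    have h2 := h.eq_iff i j hij _ _ (by omega) (by omega) e'
    omega

lemma valid (h : ThetaData G u w P A) (i) (k : ℕ) (hk : k ≤ (P i).length) :
    thValid A (i, (k : ℝ)) := by
  refine ⟨Nat.cast_nonneg _, ?_⟩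
  rw [h.len]
  simp only
  exact_mod_cast hk

lemma edge_rep (h : ThetaData G u w P A) {v v' : V} (hv : G.Adj v v') :
    ∃ i k, k + 1 ≤ (P i).length ∧ (((P i).getVert k = v ∧ (P i).getVert (k + 1) = v') ∨
      ((P i).getVert k = v' ∧ (P i).getVert (k + 1) = v)) := by
  obtain ⟨i, hi⟩ := h.cov s(v, v') hv
  obtain ⟨k, hk, hor⟩ := th_edges_getVert (P i) v v' hi
  exact ⟨i, k, hk, hor⟩

lemma same_vertex (h : ThetaData G u w P A) (i j) (k l : ℕ) (hk : k ≤ (P i).length)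
    (hl : l ≤ (P j).length) (e : (P i).getVert k = (P j).getVert l) :
    thD A (i, (k : ℝ)) (j, (l : ℝ)) ≤ 0 := by
  by_cases hij : i = j
  · subst hij
    have := h.inj i k l hk hl e
    subst this
    simpa using thD_loc A (i, (k : ℝ)) (i, (k : ℝ)) rfl
  · rcases h.eq_iff i j hij k l hk hl e with ⟨rfl, rfl⟩ | ⟨rfl, rfl⟩
    · simpa using thD_uu A (i, ((0 : ℕ) : ℝ)) (j, ((0 : ℕ) : ℝ))
    · simpa [h.len] using thD_ww A (i, ((P i).length : ℝ)) (j, ((P j).length : ℝ))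

lemma walk_le (h : ThetaData G u w P A) {v v' : V} (q : G.Walk v v') :
    ∀ i j k l, k ≤ (P i).length → l ≤ (P j).length → (P i).getVert k = v →
      (P j).getVert l = v' → thD A (i, (k : ℝ)) (j, (l : ℝ)) ≤ q.length := by
  induction q with
  | nil =>
    intro i j k l hk hl e e'
    simpa using h.same_vertex i j k l hk hl (e.trans e'.symm)
  | cons hadj q ih =>
    intro i j k l hk hl e e'
    obtain ⟨i', k', hk', hor⟩ := h.edge_rep hadj
    have step : ∀ m m' : ℕ, m ≤ (P i').length → m' ≤ (P i').length → |(m : ℝ) - m'| ≤ 1 →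
        (P i').getVert m = (P i).getVert k → 
        thD A (i', (m' : ℝ)) (j, (l : ℝ)) ≤ q.length →
        thD A (i, (k : ℝ)) (j, (l : ℝ)) ≤ q.length + 1 := by
      intro m m' hm hm' hab e1 h2
      have h1 := h.same_vertex i i' k m hk hm e1.symm
      have h3 := thD_loc A (i', (m : ℝ)) (i', (m' : ℝ)) rfl
      have h4 := thD_triangle A (i, (k : ℝ)) (i', (m : ℝ)) (j, (l : ℝ)) (h.valid _ _ hk)
        (h.valid _ _ hm) (h.valid _ _ hl) h.zero h.hA
      have h5 := thD_triangle A (i', (m : ℝ)) (i', (m' : ℝ)) (j, (l : ℝ)) (h.valid _ _ hm)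
        (h.valid _ _ hm') (h.valid _ _ hl) h.zero h.hA
      simp only at h3
      linarith
    rw [Walk.length_cons]
    push_cast
    rcases hor with ⟨e1, e2⟩ | ⟨e1, e2⟩
    · exact step k' (k' + 1) (by omega) hk' (by simp) (e1.trans e.symm)
        (ih _ _ _ _ hk' hl e2 e')
    · exact step (k' + 1) k' hk' (by omega) (by simp) (e2.trans e.symm)
        (ih _ _ _ _ (by omega) hl e1 e')

lemma le_dist (h : ThetaData G u w P A) (i j) (k l : ℕ) (hk : k ≤ (P i).length)
    (hl : l ≤ (P j).length) :
    thD A (i, (k : ℝ)) (j, (l : ℝ)) ≤ G.dist ((P i).getVert k) ((P j).getVert l) := by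
  obtain ⟨q, hq⟩ := h.conn.exists_walk_length_eq_dist ((P i).getVert k) ((P j).getVert l)
  rw [← hq]
  exact h.walk_le q _ _ _ _ hk hl rfl rfl

lemma dist_loc (h : ThetaData G u w P A) (i) (k l : ℕ) (hkl : k ≤ l) (hl : l ≤ (P i).length) :
    G.dist ((P i).getVert k) ((P i).getVert l) ≤ l - k := by
  obtain ⟨m, rfl⟩ := Nat.exists_eq_add_of_le hkl
  simp only [Nat.add_sub_cancel_left]
  clear hkl
  induction m with
  | zero => simp
  | succ m ih =>
    have h1 := ih (by omega)
    have h2 : G.dist ((P i).getVert (k + m)) ((P i).getVert (k + m + 1)) = 1 :=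
      SimpleGraph.dist_eq_one_iff_adj.2 ((P i).adj_getVert_succ (by omega))
    have h3 := h.conn.dist_triangle (u := (P i).getVert k) (v := (P i).getVert (k + m))
      (w := (P i).getVert (k + m + 1))
    rw [← Nat.add_assoc]
    omega

lemma dist_u (h : ThetaData G u w P A) (i) (k : ℕ) (hk : k ≤ (P i).length) :
    (G.dist u ((P i).getVert k) : ℝ) ≤ k := by
  have := h.dist_loc i 0 k (Nat.zero_le _) hk
  simp at this
  exact_mod_cast this

lemma dist_w (h : ThetaData G u w P A) (i) (k : ℕ) (hk : k ≤ (P i).length) :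
    (G.dist w ((P i).getVert k) : ℝ) ≤ A i - k := by
  have := h.dist_loc i k _ hk le_rfl
  simp at this
  rw [h.len, SimpleGraph.dist_comm]
  have : (G.dist ((P i).getVert k) w : ℝ) ≤ (((P i).length - k : ℕ) : ℝ) := by exact_mod_cast this
  rwa [Nat.cast_sub hk] at this

lemma dist_uw (h : ThetaData G u w P A) : (G.dist u w : ℝ) ≤ A 0 := by
  have := h.dist_u 0 _ le_rfl
  rw [h.len]
  simpa using this

lemma dist_tri (h : ThetaData G u w P A) (a b c : V) :
    (G.dist a c : ℝ) ≤ G.dist a b + G.dist b c := by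
  exact_mod_cast h.conn.dist_triangle

lemma dA_flip_left (G : SimpleGraph V) (a b : V) (s : ℝ) (q : V × V × ℝ) :
    mgDistAux G (a, b, s) q = mgDistAux G (b, a, 1 - s) q := by
  obtain ⟨c, d, t⟩ := q
  unfold mgDistAux
  have e1 : |1 - s - t| = |s - (1 - t)| := by rw [← abs_neg]; congr 1; ring
  have e2 : |1 - s - (1 - t)| = |s - t| := by rw [← abs_neg]; congr 1; ring
  have e3 : 1 - (1 - s) = s := by ring
  simp only [e1, e2, e3]
  congr 1
  · rw [min_comm]
    simp only [and_comm (a := a = c), and_comm (a := a = d)]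
  · rw [min_comm]

lemma dA_comm (G : SimpleGraph V) (p q : V × V × ℝ) :
    mgDistAux G p q = mgDistAux G q p := by
  obtain ⟨a, b, s⟩ := p
  obtain ⟨c, d, t⟩ := q
  unfold mgDistAux
  have e1 : |t - (1 - s)| = |s - (1 - t)| := by congr 1; ring
  simp only [e1, abs_sub_comm t s, G.dist_comm (u := c), G.dist_comm (u := d)]
  congr 1
  · simp only [eq_comm (a := c), eq_comm (a := d), and_comm (a := b = c)]
  · rw [min_min_min_comm]
    congr 1 <;> congr 1 <;> ring

lemma dist_main (h : ThetaData G u w P A) (i j) (k l : ℕ) (hk : k + 1 ≤ (P i).length)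
    (hl : l + 1 ≤ (P j).length) (s t : ℝ) (hs : s ∈ Icc (0:ℝ) 1) (ht : t ∈ Icc (0:ℝ) 1) :
    mgDistAux G ((P i).getVert k, (P i).getVert (k + 1), s)
      ((P j).getVert l, (P j).getVert (l + 1), t) = thD A (i, k + s) (j, l + t) := by
  obtain ⟨hs0, hs1⟩ := hs
  obtain ⟨ht0, ht1⟩ := ht
  have hkR : (k : ℝ) + 1 ≤ A i := by rw [h.len]; exact_mod_cast hk
  have hlR : (l : ℝ) + 1 ≤ A j := by rw [h.len]; exact_mod_cast hl
  have hk0 : (0 : ℝ) ≤ k := Nat.cast_nonneg _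
  have hl0 : (0 : ℝ) ≤ l := Nat.cast_nonneg _
  have vx : thValid A (i, k + s) := ⟨by simp; linarith, by simp; linarith⟩
  have vy : thValid A (j, l + t) := ⟨by simp; linarith, by simp; linarith⟩
  have hcard : A 2 ≤ Fintype.card V := by
    rw [h.len]; exact_mod_cast (h.path 2).length_lt.le
  have hdiam := thD_le_diam A _ _ vx vy h.h01 h.h12 h.zero
  have h12 := h.h12
  unfold mgDistAux
  simp only
  apply le_antisymm
  · -- upper bound
    generalize hM : (min (min (if (P i).getVert k = (P j).getVert l ∧
        (P i).getVert (k + 1) = (P j).getVert (l + 1) then |s - t| else _) _) _ : ℝ) = M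
    have b1 : M ≤ s + G.dist ((P i).getVert k) ((P j).getVert l) + t :=
      hM ▸ (min_le_right _ _).trans ((min_le_left _ _).trans (min_le_left _ _))
    have b2 : M ≤ s + G.dist ((P i).getVert k) ((P j).getVert (l+1)) + (1 - t) :=
      hM ▸ (min_le_right _ _).trans ((min_le_left _ _).trans (min_le_right _ _))
    have b3 : M ≤ (1 - s) + G.dist ((P i).getVert (k+1)) ((P j).getVert l) + t :=
      hM ▸ (min_le_right _ _).trans ((min_le_right _ _).trans (min_le_left _ _))
    have b4 : M ≤ (1 - s) + G.dist ((P i).getVert (k+1)) ((P j).getVert (l+1)) + (1 - t) :=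
      hM ▸ (min_le_right _ _).trans ((min_le_right _ _).trans (min_le_right _ _))
    have b5 : ((P i).getVert k = (P j).getVert l ∧ (P i).getVert (k+1) = (P j).getVert (l+1)) →
        M ≤ |s - t| := by
      intro hc
      rw [← hM, if_pos hc]
      exact (min_le_left _ _).trans (min_le_left _ _)
    clear hM
    have u1 := h.dist_u i k (by omega)
    have u2 := h.dist_u j l (by omega)
    have w1 := h.dist_w i (k+1) (by omega)
    have w2 := h.dist_w j (l+1) (by omega)
    have uw := h.dist_uw
    push_cast at w1 w2
    rcases thD_cases A (i, k + s) (j, l + t) with ⟨e, h'⟩ | h' | h' | h' | h' <;> rw [h'] <;>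
      simp only at *
    · subst e
      rcases lt_trichotomy k l with hkl | hkl | hkl
      · have := h.dist_loc i (k+1) l hkl (by omega)
        have : (G.dist ((P i).getVert (k+1)) ((P i).getVert l) : ℝ) ≤ ((l - (k+1) : ℕ) : ℝ) := by
          exact_mod_cast this
        rw [Nat.cast_sub hkl] at this
        push_cast at this
        have := neg_abs_le (k + s - (l + t))
        linarith
      · subst hkl
        have := b5 ⟨rfl, rfl⟩
        have e : (k : ℝ) + s - (k + t) = s - t := by ring
        rw [e]; exact this
      · have := h.dist_loc i (l+1) k hkl (by omega)
        have : (G.dist ((P i).getVert (l+1)) ((P i).getVert k) : ℝ) ≤ ((k - (l+1) : ℕ) : ℝ) := by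
          exact_mod_cast this
        rw [Nat.cast_sub hkl, SimpleGraph.dist_comm] at this
        push_cast at this
        have := le_abs_self (k + s - (l + t))
        linarith
    · have := h.dist_tri ((P i).getVert k) u ((P j).getVert l)
      rw [G.dist_comm (v := u)] at this
      linarith
    · have := h.dist_tri ((P i).getVert (k+1)) w ((P j).getVert (l+1))
      rw [G.dist_comm (v := w)] at this
      linarith
    · have := h.dist_tri ((P i).getVert k) u ((P j).getVert (l+1))
      have := h.dist_tri u w ((P j).getVert (l+1))
      rw [G.dist_comm (u := (P i).getVert k) (v := u)] at *
      linarith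
    · have := h.dist_tri ((P i).getVert (k+1)) w ((P j).getVert l)
      have := h.dist_tri w u ((P j).getVert l)
      rw [G.dist_comm (u := (P i).getVert (k+1)) (v := w), G.dist_comm (u := w) (v := u)] at *
      linarith
  · have key : ∀ k' l' : ℕ, k' ≤ (P i).length → l' ≤ (P j).length →
        thD A (i, k + s) (j, l + t) ≤ |k + s - k'| +
          G.dist ((P i).getVert k') ((P j).getVert l') + |l' - (l + t)| := by
      intro k' l' hk' hl'
      have a1 := h.le_dist i j k' l' hk' hl'
      have a2 := thD_loc A (i, k + s) (i, (k' : ℝ)) rfl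
      have a3 := thD_loc A (j, (l' : ℝ)) (j, l + t) rfl
      have a4 := thD_triangle A _ _ _ vx (h.valid i k' hk') (h.valid j l' hl') h.zero h.hA
      have a5 := thD_triangle A _ _ _ vx (h.valid j l' hl') vy h.zero h.hA
      simp only at *
      linarith
    have e1 : |(k:ℝ) + s - k| = s := by rw [abs_of_nonneg] <;> linarith
    have e2 : |(k:ℝ) + s - (k + 1 : ℕ)| = 1 - s := by
      push_cast; rw [abs_of_nonpos] <;> linarith
    have e3 : |(l:ℝ) - (l + t)| = t := by rw [abs_of_nonpos] <;> linarith
    have e4 : |((l + 1 : ℕ):ℝ) - (l + t)| = 1 - t := by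
      push_cast; rw [abs_of_nonneg] <;> linarith
    refine le_min (le_min ?_ ?_) (le_min (le_min ?_ ?_) (le_min ?_ ?_))
    · split_ifs with hc
      · obtain ⟨rfl, rfl⟩ := h.edge_eq i j k l hk hl hc.1 hc.2
        refine (thD_loc A (i, k + s) (i, k + t) rfl).trans (le_of_eq ?_)
        simp
      · linarith
    · split_ifs with hc
      · exact (h.edge_cross i j k l hk hl hc.1 hc.2).elim
      · linarith
    · have := key k l (by omega) (by omega)
      rwa [e1, e3] at this
    · have := key k (l+1) (by omega) (by omega)
      rwa [e1, e4] at this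
    · have := key (k+1) l (by omega) (by omega)
      rwa [e2, e3] at this
    · have := key (k+1) (l+1) (by omega) (by omega)
      rwa [e2, e4] at this

/-- `x` is a coordinate of the point `p`. -/
def Rep (P : Fin 3 → G.Walk u w) (p : MGPoint G) (x : Fin 3 × ℝ) : Prop :=
  ∃ i k s, k + 1 ≤ (P i).length ∧ s ∈ Icc (0:ℝ) 1 ∧ x = (i, k + s) ∧
    (p.1 = ((P i).getVert k, (P i).getVert (k+1), s) ∨
     p.1 = ((P i).getVert (k+1), (P i).getVert k, 1 - s))

lemma rep_dist (h : ThetaData G u w P A) {p q : MGPoint G} {x y} (hp : Rep P p x)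
    (hq : Rep P q y) : mgDist G p q = thD A x y := by
  obtain ⟨i, k, s, hk, hs, rfl, hp⟩ := hp
  obtain ⟨j, l, t, hl, ht, rfl, hq⟩ := hq
  rw [← h.dist_main i j k l hk hl s t hs ht]
  unfold mgDist
  rcases hp with hp | hp <;> rcases hq with hq | hq <;> rw [hp, hq]
  · rw [dA_comm, ← dA_flip_left, dA_comm]
  · rw [← dA_flip_left]
  · rw [← dA_flip_left, dA_comm, ← dA_flip_left, dA_comm]

lemma rep_valid (h : ThetaData G u w P A) {p : MGPoint G} {x} (hp : Rep P p x) :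
    thValid A x := by
  obtain ⟨i, k, s, hk, ⟨h0, h1⟩, rfl, -⟩ := hp
  have hkR : (k : ℝ) + 1 ≤ A i := by rw [h.len]; exact_mod_cast hk
  constructor
  · simp; positivity
  · simp; linarith

lemma rep_exists (h : ThetaData G u w P A) (p : MGPoint G) : ∃ x, Rep P p x := by
  obtain ⟨⟨a, b, s⟩, hab, h0, h1⟩ := p
  obtain ⟨i, k, hk, ⟨e1, e2⟩ | ⟨e1, e2⟩⟩ := h.edge_rep hab
  · exact ⟨_, i, k, s, hk, ⟨h0, h1⟩, rfl, Or.inl (by simp [e1, e2])⟩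
  · exact ⟨_, i, k, 1 - s, hk, ⟨by simpa using h1, by simpa using h0⟩, rfl,
      Or.inr (by simp [e1, e2])⟩

lemma rep_surj (h : ThetaData G u w P A) (x : Fin 3 × ℝ) (hx : thValid A x) :
    ∃ p, Rep P p x := by
  obtain ⟨i, r⟩ := x
  obtain ⟨h0, h1⟩ := hx
  simp only at h0 h1
  have hpos := h.pos i
  have hl := h.len i
  obtain ⟨k, s, hk, hs, e⟩ : ∃ (k : ℕ) (s : ℝ), k + 1 ≤ (P i).length ∧ s ∈ Icc (0:ℝ) 1 ∧
      r = k + s := by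
    rcases lt_or_eq_of_le h1 with h1 | h1
    · refine ⟨⌊r⌋₊, r - ⌊r⌋₊, ?_, ⟨?_, ?_⟩, by ring⟩
      · rw [hl] at h1
        exact (Nat.floor_lt h0).2 h1
      · linarith [Nat.floor_le h0]
      · linarith [Nat.lt_floor_add_one r]
    · refine ⟨(P i).length - 1, 1, by omega, ⟨by norm_num, le_rfl⟩, ?_⟩
      rw [Nat.cast_sub hpos, h1, hl]; simp
  exact ⟨⟨((P i).getVert k, (P i).getVert (k+1), s), (P i).adj_getVert_succ (by omega), hs⟩,
    i, k, s, hk, hs, by rw [e], Or.inl rfl⟩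

end ThetaData

namespace ThetaData

variable {V : Type} [Fintype V] [DecidableEq V] {G : SimpleGraph V} {u w : V}
    {P : Fin 3 → G.Walk u w} {A : Fin 3 → ℝ}

lemma mg_comm (p q : MGPoint G) : mgDist G p q = mgDist G q p := dA_comm G _ _

lemma mg_tri (h : ThetaData G u w P A) (p q r : MGPoint G) :
    mgDist G p r ≤ mgDist G p q + mgDist G q r := by
  obtain ⟨x, hx⟩ := h.rep_exists p
  obtain ⟨y, hy⟩ := h.rep_exists q
  obtain ⟨z, hz⟩ := h.rep_exists r
  rw [h.rep_dist hx hz, h.rep_dist hx hy, h.rep_dist hy hz]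
  exact thD_triangle A x y z (h.rep_valid hx) (h.rep_valid hy) (h.rep_valid hz) h.zero h.hA

/-- Consecutive different values in a finite sequence. -/
lemma exists_change (f : ℕ → Fin 3) (n : ℕ) (hf : f 0 ≠ f n) : ∃ k < n, f k ≠ f (k + 1) := by
  by_contra! hcon
  apply hf
  have : ∀ m ≤ n, f 0 = f m := by
    intro m
    induction m with
    | zero => simp
    | succ m ih => intro hm; rw [ih (by omega), hcon m (by omega)]
  exact this n le_rfl

lemma geo_near (h : ThetaData G u w P A) (c : MGPoint G → Fin 3 × ℝ)
    (hc : ∀ p, Rep P p (c p)) (a b : ℝ) (g : ℝ → MGPoint G) (hg : IsMGGeodesic G a b g)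
    (hne : (c (g a)).1 ≠ (c (g b)).1) (ε : ℝ) (hε : 0 < ε) :
    ∃ t ∈ Icc a b, thD A (c (g t)) (0, 0) ≤ ε ∨ thD A (c (g t)) (0, A 0) ≤ ε := by
  obtain ⟨hab, hg⟩ := hg
  obtain ⟨n, hn⟩ := exists_nat_gt ((b - a) / ε)
  have hn0 : (0 : ℝ) < n := lt_of_le_of_lt (div_nonneg (by linarith) hε.le) hn
  have hmem : ∀ k : ℕ, k ≤ n → a + k * ((b - a) / n) ∈ Icc a b := by
    intro k hk
    have hk' : (k : ℝ) ≤ n := by exact_mod_cast hk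
    have h1 : 0 ≤ (b - a) / n := div_nonneg (by linarith) hn0.le
    have h2 : (n : ℝ) * ((b - a) / n) = b - a := by field_simp
    have h3 := mul_le_mul_of_nonneg_right hk' h1
    constructor
    · have : 0 ≤ (k : ℝ) * ((b - a) / n) := by positivity
      linarith
    · linarith
  obtain ⟨k, hk, hkk⟩ := exists_change (fun k => (c (g (a + k * ((b - a) / n)))).1) n (by
    have h2 : (n : ℝ) * ((b - a) / n) = b - a := by field_simp
    simp only [h2]
    simpa using hne)
  refine ⟨_, hmem k hk.le, ?_⟩
  have hd := hg _ (hmem k hk.le) _ (hmem (k + 1) hk)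
  rw [h.rep_dist (hc _) (hc _)] at hd
  have hle : thD A (c (g (a + k * ((b - a) / n)))) (c (g (a + (k + 1 : ℕ) * ((b - a) / n)))) ≤ ε := by
    rw [hd]
    have : a + k * ((b - a) / n) - (a + (k + 1 : ℕ) * ((b - a) / n)) = - ((b - a) / n) := by
      push_cast; ring
    rw [this, abs_neg, abs_of_nonneg (div_nonneg (by linarith) hn0.le)]
    rw [div_lt_iff₀ hε] at hn
    rw [div_le_iff₀ hn0]
    linarith
  rcases thD_near A _ _ (h.rep_valid (hc _)) (h.rep_valid (hc _)) h.hA h.zero hkk with h1 | h1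
  · left; linarith
  · right; linarith

lemma side (h : ThetaData G u w P A) (a1 b1 a2 b2 a3 b3 : ℝ) (g1 g2 g3 : ℝ → MGPoint G)
    (h1 : IsMGGeodesic G a1 b1 g1) (h2 : IsMGGeodesic G a2 b2 g2) (h3 : IsMGGeodesic G a3 b3 g3)
    (e1 : mgDist G (g1 b1) (g2 a2) = 0) (e2 : mgDist G (g2 b2) (g3 a3) = 0)
    (e3 : mgDist G (g3 b3) (g1 a1) = 0) (N : ℝ)
    (hN : N = (A 2 + min (A 1) (3 * A 0)) / 4) (ε : ℝ) (hε : 0 < ε) (s : ℝ)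
    (hs : s ∈ Icc a1 b1) :
      (∃ t ∈ Set.Icc a2 b2, mgDist G (g1 s) (g2 t) ≤ N + ε) ∨
      (∃ t ∈ Set.Icc a3 b3, mgDist G (g1 s) (g3 t) ≤ N + ε) := by
  choose c hc using h.rep_exists
  have hv : ∀ p, thValid A (c p) := fun p => h.rep_valid (hc p)
  have hD : ∀ p q, mgDist G p q = thD A (c p) (c q) := fun p q => h.rep_dist (hc p) (hc q)
  have m2 : a2 ∈ Icc a2 b2 := ⟨le_rfl, h2.1⟩
  have m2' : b2 ∈ Icc a2 b2 := ⟨h2.1, le_rfl⟩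
  have m3 : a3 ∈ Icc a3 b3 := ⟨le_rfl, h3.1⟩
  have m3' : b3 ∈ Icc a3 b3 := ⟨h3.1, le_rfl⟩
  have m1 : a1 ∈ Icc a1 b1 := ⟨le_rfl, h1.1⟩
  have m1' : b1 ∈ Icc a1 b1 := ⟨h1.1, le_rfl⟩
  have hadd : thD A (c (g1 a1)) (c (g1 s)) + thD A (c (g1 s)) (c (g1 b1)) =
      thD A (c (g1 a1)) (c (g1 b1)) := by
    rw [← hD, ← hD, ← hD, h1.2 _ m1 _ hs, h1.2 _ hs _ m1', h1.2 _ m1 _ m1']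
    rw [abs_of_nonpos, abs_of_nonpos, abs_of_nonpos] <;> linarith [hs.1, hs.2]
  rcases thD_key A _ _ _ (hv _) (hv _) (hv _) h.h01 h.h12 h.zero hadd N hN with hk | hk | hk
  · right
    refine ⟨b3, m3', ?_⟩
    have := h.mg_tri (g1 s) (g1 a1) (g3 b3)
    rw [mg_comm (g1 a1), e3, hD _ (g1 a1)] at this
    linarith
  · left
    refine ⟨a2, m2, ?_⟩
    have := h.mg_tri (g1 s) (g1 b1) (g2 a2)
    rw [e1, hD _ (g1 b1)] at this
    linarith
  obtain ⟨hne, hu, hw⟩ := hk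
  have fin : ∀ q : MGPoint G, (thD A (c q) (0, 0) ≤ ε ∨ thD A (c q) (0, A 0) ≤ ε) →
      mgDist G (g1 s) q ≤ N + ε := by
    intro q hq
    rw [hD]
    rcases hq with hq | hq
    · have := thD_triangle A (c (g1 s)) (0, 0) (c q) (hv _) ⟨le_rfl, h.zero⟩ (hv _) h.zero h.hA
      rw [thD_comm A (0, 0)] at this
      linarith
    · have := thD_triangle A (c (g1 s)) (0, A 0) (c q) (hv _) ⟨h.zero, le_rfl⟩ (hv _) h.zero h.hA
      rw [thD_comm A (0, A 0)] at this
      linarith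
  have glue : ∀ p q, mgDist G p q = 0 → (c p).1 ≠ (c q).1 →
      (thD A (c p) (0, 0) ≤ ε ∨ thD A (c p) (0, A 0) ≤ ε) := by
    intro p q hpq hn
    rw [hD] at hpq
    rcases thD_near A _ _ (hv p) (hv q) h.hA h.zero hn with h1 | h1
    · left; linarith
    · right; linarith
  by_cases c1 : (c (g2 a2)).1 = (c (g1 b1)).1
  swap
  · left
    exact ⟨a2, m2, fin _ (glue _ _ (by rw [mg_comm]; exact e1) c1)⟩
  by_cases c2 : (c (g2 a2)).1 = (c (g2 b2)).1
  swap
  · left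
    obtain ⟨t, ht, ht'⟩ := h.geo_near c hc a2 b2 g2 h2 c2 ε hε
    exact ⟨t, ht, fin _ ht'⟩
  by_cases c3 : (c (g2 b2)).1 = (c (g3 a3)).1
  swap
  · left
    exact ⟨b2, m2', fin _ (glue _ _ e2 c3)⟩
  by_cases c4 : (c (g3 a3)).1 = (c (g3 b3)).1
  swap
  · right
    obtain ⟨t, ht, ht'⟩ := h.geo_near c hc a3 b3 g3 h3 c4 ε hε
    exact ⟨t, ht, fin _ ht'⟩
  right
  refine ⟨b3, m3', fin _ (glue _ _ e3 ?_)⟩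
  rw [← c4, ← c3, ← c2, c1]
  exact hne.symm

lemma mem_set (h : ThetaData G u w P A) (T : MGTriangle G) (N : ℝ)
    (hN : N = (A 2 + min (A 1) (3 * A 0)) / 4) (ε : ℝ) (hε : 0 < ε) :
    N + ε ∈ {d : ℝ | 0 ≤ d ∧
    (∀ s ∈ Set.Icc T.a1 T.b1,
      (∃ t ∈ Set.Icc T.a2 T.b2, mgDist G (T.g1 s) (T.g2 t) ≤ d) ∨
      (∃ t ∈ Set.Icc T.a3 T.b3, mgDist G (T.g1 s) (T.g3 t) ≤ d)) ∧
    (∀ s ∈ Set.Icc T.a2 T.b2,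
      (∃ t ∈ Set.Icc T.a1 T.b1, mgDist G (T.g2 s) (T.g1 t) ≤ d) ∨
      (∃ t ∈ Set.Icc T.a3 T.b3, mgDist G (T.g2 s) (T.g3 t) ≤ d)) ∧
    (∀ s ∈ Set.Icc T.a3 T.b3,
      (∃ t ∈ Set.Icc T.a1 T.b1, mgDist G (T.g3 s) (T.g1 t) ≤ d) ∨
      (∃ t ∈ Set.Icc T.a2 T.b2, mgDist G (T.g3 s) (T.g2 t) ≤ d))} := by
  have hpos : 0 ≤ N := by
    have h1 := h.pos' 0
    have h2 := h.pos' 1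
    have h3 := h.pos' 2
    have : 0 ≤ min (A 1) (3 * A 0) := le_min (by linarith) (by linarith)
    linarith
  refine ⟨by linarith, ?_, ?_, ?_⟩
  · intro s hs
    exact h.side _ _ _ _ _ _ _ _ _ T.h1 T.h2 T.h3 T.glue1 T.glue2 T.glue3 N hN ε hε s hs
  · intro s hs
    exact (h.side _ _ _ _ _ _ _ _ _ T.h2 T.h3 T.h1 T.glue2 T.glue3 T.glue1 N hN ε hε s hs).symm
  · intro s hs
    exact h.side _ _ _ _ _ _ _ _ _ T.h3 T.h1 T.h2 T.glue3 T.glue1 T.glue2 N hN ε hε s hs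

lemma upper (h : ThetaData G u w P A) (T : MGTriangle G) (N : ℝ)
    (hN : N = (A 2 + min (A 1) (3 * A 0)) / 4) : triangleDelta T ≤ N := by
  apply le_of_forall_pos_le_add
  intro ε hε
  exact csInf_le ⟨0, fun d hd => hd.1⟩ (h.mem_set T N hN ε hε)

lemma lower (h : ThetaData G u w P A) (N : ℝ)
    (hN : N = (A 2 + min (A 1) (3 * A 0)) / 4) : ∃ T : MGTriangle G, N ≤ triangleDelta T := by
  have : ∀ x : Fin 3 × ℝ, ∃ p : MGPoint G, thValid A x → Rep P p x := by
    intro x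
    by_cases hx : thValid A x
    · obtain ⟨p, hp⟩ := h.rep_surj x hx
      exact ⟨p, fun _ => hp⟩
    · obtain ⟨p, hp⟩ := h.rep_surj (0, 0) ⟨le_rfl, h.zero⟩
      exact ⟨p, fun hh => absurd hh hx⟩
  choose emb hemb using this
  have hD : ∀ x y, thValid A x → thValid A y → mgDist G (emb x) (emb y) = thD A x y :=
    fun x y hx hy => h.rep_dist (hemb x hx) (hemb y hy)
  have h01 := h.h01
  have h12 := h.h12
  have h0 := h.zero
  obtain ⟨m, hm⟩ : ∃ m, m = min (A 1) (3 * A 0) := ⟨_, rfl⟩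
  have hm1 : m ≤ A 1 := hm ▸ min_le_left _ _
  have hm2 : m ≤ 3 * A 0 := hm ▸ min_le_right _ _
  have hm3 : A 0 ≤ m := hm ▸ le_min h01 (by linarith)
  rw [← hm] at hN
  clear hm
  obtain ⟨s, hs⟩ : ∃ s, s = (m - A 0) / 2 := ⟨_, rfl⟩
  obtain ⟨t, ht⟩ : ∃ t, t = (A 0 + A 2) / 2 := ⟨_, rfl⟩
  obtain ⟨q, hq⟩ : ∃ q, q = (A 0 + A 1) / 2 := ⟨_, rfl⟩
  obtain ⟨r, hr⟩ : ∃ r, r = t - N := ⟨_, rfl⟩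
  -- coordinates of the three sides
  obtain ⟨c1, hc1⟩ : ∃ c1 : ℝ → Fin 3 × ℝ, c1 = fun τ => if τ ≤ 0 then (1, -τ) else (2, τ) :=
    ⟨_, rfl⟩
  obtain ⟨c2, hc2⟩ : ∃ c2 : ℝ → Fin 3 × ℝ,
    c2 = fun τ => if τ ≤ A 2 then (2, τ) else (1, A 1 + A 2 - τ) := ⟨_, rfl⟩
  obtain ⟨c3, hc3⟩ : ∃ c3 : ℝ → Fin 3 × ℝ, c3 = fun τ => (1, -τ) := ⟨_, rfl⟩
  have v1 : ∀ τ ∈ Icc (-s) t, thValid A (c1 τ) := by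
    rintro τ ⟨l1, l2⟩
    rw [hc1]
    simp only
    split_ifs <;> constructor <;> simp only <;> linarith
  have v2 : ∀ τ ∈ Icc t (A 1 + A 2 - q), thValid A (c2 τ) := by
    rintro τ ⟨l1, l2⟩
    rw [hc2]
    simp only
    split_ifs <;> constructor <;> simp only <;> linarith
  have v3 : ∀ τ ∈ Icc (-q) (-s), thValid A (c3 τ) := by
    rintro τ ⟨l1, l2⟩
    rw [hc3]
    constructor <;> simp only <;> linarith
  have geo : ∀ (a b : ℝ) (c : ℝ → Fin 3 × ℝ), a ≤ b → (∀ τ ∈ Icc a b, thValid A (c τ)) →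
      (∀ τ ∈ Icc a b, ∀ τ' ∈ Icc a b, τ ≤ τ' → thD A (c τ) (c τ') = τ' - τ) →
      IsMGGeodesic G a b (fun τ => emb (c τ)) := by
    intro a b c hab hv hd
    refine ⟨hab, fun x hx y hy => ?_⟩
    rw [hD _ _ (hv x hx) (hv y hy)]
    rcases le_total x y with hxy | hxy
    · rw [hd x hx y hy hxy, abs_of_nonpos] <;> linarith
    · rw [thD_comm, hd y hy x hx hxy, abs_of_nonneg]; linarith
  have g1 : IsMGGeodesic G (-s) t (fun τ => emb (c1 τ)) := by
    refine geo _ _ _ (by linarith) v1 ?_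
    rintro x ⟨x1, x2⟩ y ⟨y1, y2⟩ hxy
    rw [hc1]
    simp only [thD]
    split_ifs <;> simp_all only [] <;> grind
  have g2 : IsMGGeodesic G t (A 1 + A 2 - q) (fun τ => emb (c2 τ)) := by
    refine geo _ _ _ (by linarith) v2 ?_
    rintro x ⟨x1, x2⟩ y ⟨y1, y2⟩ hxy
    rw [hc2]
    simp only [thD]
    split_ifs <;> simp_all only [] <;> grind
  have g3 : IsMGGeodesic G (-q) (-s) (fun τ => emb (c3 τ)) := by
    refine geo _ _ _ (by linarith) v3 ?_
    rintro x ⟨x1, x2⟩ y ⟨y1, y2⟩ hxy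
    rw [hc3]
    simp only [thD]
    split_ifs <;> simp_all only [] <;> grind
  have hA0 := h.pos' 0
  have m1 : -s ∈ Icc (-s) t := ⟨le_rfl, g1.1⟩
  have m1' : t ∈ Icc (-s) t := ⟨g1.1, le_rfl⟩
  have m2 : t ∈ Icc t (A 1 + A 2 - q) := ⟨le_rfl, g2.1⟩
  have m2' : A 1 + A 2 - q ∈ Icc t (A 1 + A 2 - q) := ⟨g2.1, le_rfl⟩
  have m3 : -q ∈ Icc (-q) (-s) := ⟨le_rfl, g3.1⟩
  have m3' : -s ∈ Icc (-q) (-s) := ⟨g3.1, le_rfl⟩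
  have e1 : mgDist G (emb (c1 t)) (emb (c2 t)) = 0 := by
    rw [hD _ _ (v1 _ m1') (v2 _ m2)]
    have : c1 t = c2 t := by
      rw [hc1, hc2]
      simp only
      rw [if_neg (by linarith), if_pos (by linarith)]
    rw [this]
    exact thD_self A _ (v2 _ m2) h0
  have e2 : mgDist G (emb (c2 (A 1 + A 2 - q))) (emb (c3 (-q))) = 0 := by
    rw [hD _ _ (v2 _ m2') (v3 _ m3)]
    rw [hc2, hc3]
    simp only [thD]
    split_ifs <;> simp_all only [] <;> grind
  have e3 : mgDist G (emb (c3 (-s))) (emb (c1 (-s))) = 0 := by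
    rw [hD _ _ (v3 _ m3') (v1 _ m1)]
    have : c1 (-s) = c3 (-s) := by
      rw [hc1, hc3]
      simp only
      rw [if_pos (by linarith)]
    rw [this]
    exact thD_self A _ (v3 _ m3') h0
  refine ⟨⟨_, _, _, _, _, _, _, _, _, g1, g2, g3, e1, e2, e3⟩, ?_⟩
  refine le_csInf ⟨_, h.mem_set _ _ rfl 1 one_pos⟩ ?_
  rintro d ⟨-, hd, -, -⟩
  have mr : r ∈ Icc (-s) t := ⟨by linarith, by linarith⟩
  have hvr := v1 _ mr
  rcases hd r mr with ⟨τ, hτ, hle⟩ | ⟨τ, hτ, hle⟩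
  · refine le_trans ?_ hle
    simp only
    rw [hD _ _ (v1 _ mr) (v2 _ hτ)]
    have l1 : t ≤ τ := hτ.1
    have l2 : τ ≤ A 1 + A 2 - q := hτ.2
    clear hle hτ hd
    clear v1 v2 v3 geo hD e1 e2 e3 g1 g2 g3 hvr
    rw [hc1, hc2]
    simp only [thD]
    split_ifs <;> simp_all only [] <;> grind
  · refine le_trans ?_ hle
    simp only
    rw [hD _ _ (v1 _ mr) (v3 _ hτ)]
    have l1 : -q ≤ τ := hτ.1
    have l2 : τ ≤ -s := hτ.2
    clear hle hτ hd
    clear v1 v2 v3 geo hD e1 e2 e3 g1 g2 g3 hvr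
    rw [hc1, hc3]
    simp only [thD]
    split_ifs <;> simp_all only [] <;> grind

end ThetaData

/-- Corollary (c:2RSSV): `δ(C_{a₁,a₂,a₃}) = (a₃ + min{a₂, 3a₁})/4`, where
`C_{a₁,a₂,a₃}` is the graph consisting of three internally disjoint paths of
lengths `a₁ ≤ a₂ ≤ a₃` joining two fixed vertices. -/
theorem hypDelta_theta {V : Type} [Fintype V] [DecidableEq V] (G : SimpleGraph V)
    (hG : G.Connected) (a1 a2 a3 : ℕ) (ha1 : 1 ≤ a1) (h12 : a1 ≤ a2) (h23 : a2 ≤ a3)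
    (ha2 : 2 ≤ a2) (u w : V) (p1 p2 p3 : G.Walk u w)
    (hp1 : p1.IsPath) (hp2 : p2.IsPath) (hp3 : p3.IsPath)
    (hl1 : p1.length = a1) (hl2 : p2.length = a2) (hl3 : p3.length = a3)
    (hd12 : ∀ v : V, v ∈ p1.support → v ∈ p2.support → v = u ∨ v = w)
    (hd13 : ∀ v : V, v ∈ p1.support → v ∈ p3.support → v = u ∨ v = w)
    (hd23 : ∀ v : V, v ∈ p2.support → v ∈ p3.support → v = u ∨ v = w)
    (hVc : ∀ v : V, v ∈ p1.support ∨ v ∈ p2.support ∨ v ∈ p3.support)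
    (hE : ∀ e ∈ G.edgeSet, e ∈ p1.edges ∨ e ∈ p2.edges ∨ e ∈ p3.edges) :
    hypDelta G = ((a3 : ℝ) + min (a2 : ℝ) (3 * (a1 : ℝ))) / 4 := by
  have hD : ThetaData G u w ![p1, p2, p3] ![(a1 : ℝ), a2, a3] := by
    refine ⟨hG, ?_, ?_, ?_, ?_, ?_, ?_, ?_, ?_⟩
    · intro i; fin_cases i <;> assumption
    · intro i; fin_cases i <;> simp [hl1, hl2, hl3]
    · intro i j hij v
      fin_cases i <;> fin_cases j <;> simp at hij ⊢ <;> intro h1 h2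
      · exact hd12 v h1 h2
      · exact hd13 v h1 h2
      · exact hd12 v h2 h1
      · exact hd23 v h1 h2
      · exact hd13 v h2 h1
      · exact hd23 v h2 h1
    · intro e he
      rcases hE e he with h | h | h
      · exact ⟨0, h⟩
      · exact ⟨1, h⟩
      · exact ⟨2, h⟩
    · intro i j hij
      fin_cases i <;> fin_cases j <;> simp at hij ⊢ <;> omega
    · intro i; fin_cases i <;> simp <;> omega
    · simpa using h12
    · simpa using h23
  have hN : ((a3 : ℝ) + min (a2 : ℝ) (3 * (a1 : ℝ))) / 4 =
      (![(a1 : ℝ), a2, a3] 2 + min (![(a1 : ℝ), a2, a3] 1) (3 * ![(a1 : ℝ), a2, a3] 0)) / 4 := by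
    simp
  obtain ⟨T, hT⟩ := hD.lower _ hN
  unfold hypDelta
  apply le_antisymm
  · refine csSup_le ⟨triangleDelta T, T, rfl⟩ ?_
    rintro d ⟨T', rfl⟩
    exact hD.upper T' _ hN
  · refine hT.trans (le_csSup ⟨((a3 : ℝ) + min (a2 : ℝ) (3 * (a1 : ℝ))) / 4, ?_⟩ ⟨T, rfl⟩)
    rintro d ⟨T', rfl⟩
    exact hD.upper T' _ hN
end

section
/- For every graph G_{A,B,B'} of the chain-of-cycles family, δ(G_{A,B,B'}) ≤ max{ max_{0 ≤ j ≤ k} (β_j + β'_j + max{3α_j + α_{j+1}, α_j + 3α_{j+1}})/4 , max_{0 < j < k} (α_j + α_{j+1} + max{β_j, β'_j})/2 }. -/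
open SimpleGraph Set

namespace ChainHyp

set_option linter.unusedSectionVars false

/-- `u` is an end of the edge carrying `x`, at distance `s` along that edge. -/
def IsEnd {V : Type} {G : SimpleGraph V} (x : MGPoint G) (u : V) (s : ℝ) : Prop :=
  (u = x.1.1 ∧ s = x.1.2.2) ∨ (u = x.1.2.1 ∧ s = 1 - x.1.2.2)

/-- The points `x`, `y` lie on the same edge, at distance `r` along that edge. -/
def Loc {V : Type} {G : SimpleGraph V} (x y : MGPoint G) (r : ℝ) : Prop :=
  (x.1.1 = y.1.1 ∧ x.1.2.1 = y.1.2.1 ∧ r = |x.1.2.2 - y.1.2.2|) ∨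
  (x.1.1 = y.1.2.1 ∧ x.1.2.1 = y.1.1 ∧ r = |x.1.2.2 - (1 - y.1.2.2)|)

/-- The edge carrying a point. -/
def edge {V : Type} {G : SimpleGraph V} (x : MGPoint G) : Sym2 V := s(x.1.1, x.1.2.1)

section metric

variable {V : Type} [Fintype V] [DecidableEq V] {G : SimpleGraph V}

lemma edge_mem (x : MGPoint G) : edge x ∈ G.edgeSet := x.2.1

lemma Loc.edge_eq {x y : MGPoint G} {r : ℝ} (h : Loc x y r) : edge x = edge y := by
  unfold edge
  rcases h with ⟨h1, h2, -⟩ | ⟨h1, h2, -⟩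
  · rw [h1, h2]
  · rw [h1, h2, Sym2.eq_swap]

lemma IsEnd.nonneg {x : MGPoint G} {u : V} {s : ℝ} (h : IsEnd x u s) : 0 ≤ s := by
  have h0 := x.2.2.1
  have h1 := x.2.2.2
  rcases h with ⟨-, h⟩ | ⟨-, h⟩ <;> linarith

lemma Loc.symm {x y : MGPoint G} {r : ℝ} (h : Loc x y r) : Loc y x r := by
  rcases h with ⟨h1, h2, h⟩ | ⟨h1, h2, h⟩
  · exact Or.inl ⟨h1.symm, h2.symm, by rw [h, abs_sub_comm]⟩
  · refine Or.inr ⟨h2.symm, h1.symm, ?_⟩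
    rw [h]
    congr 1
    ring

lemma mgDist_le_end {x y : MGPoint G} {u v : V} {s t : ℝ} (hx : IsEnd x u s) (hy : IsEnd y v t) :
    mgDist G x y ≤ s + G.dist u v + t := by
  unfold mgDist mgDistAux
  rcases hx with ⟨rfl, rfl⟩ | ⟨rfl, rfl⟩ <;> rcases hy with ⟨rfl, rfl⟩ | ⟨rfl, rfl⟩ <;> simp

lemma mgDist_le_loc {x y : MGPoint G} {r : ℝ} (h : Loc x y r) : mgDist G x y ≤ r := by
  unfold mgDist mgDistAux
  rcases h with ⟨h1, h2, rfl⟩ | ⟨h1, h2, rfl⟩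
  · rw [if_pos ⟨h1, h2⟩]
    exact (min_le_left _ _).trans (min_le_left _ _)
  · rw [if_pos (c := x.1.1 = y.1.2.1 ∧ x.1.2.1 = y.1.1) ⟨h1, h2⟩]
    exact (min_le_left _ _).trans (min_le_right _ _)

lemma dist_lt_card (hG : G.Connected) (u v : V) : G.dist u v < Fintype.card V := by
  obtain ⟨w, hw, hl⟩ := hG.exists_path_of_dist u v
  rw [← hl]
  exact hw.length_lt

lemma mgDist_cases (hG : G.Connected) (x y : MGPoint G) :
    Loc x y (mgDist G x y) ∨
      ∃ u v s t, IsEnd x u s ∧ IsEnd y v t ∧ mgDist G x y = s + G.dist u v + t := by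
  have hle : mgDist G x y < Fintype.card V + 1 := by
    have h1 := mgDist_le_end (x := x) (y := y) (Or.inl ⟨rfl, rfl⟩) (Or.inl ⟨rfl, rfl⟩)
    have h2 := mgDist_le_end (x := x) (y := y) (Or.inr ⟨rfl, rfl⟩) (Or.inr ⟨rfl, rfl⟩)
    have h3 : (G.dist x.1.1 y.1.1 : ℝ) < Fintype.card V := by exact_mod_cast dist_lt_card hG _ _
    have h4 : (G.dist x.1.2.1 y.1.2.1 : ℝ) < Fintype.card V := by
      exact_mod_cast dist_lt_card hG _ _
    linarith
  have key : mgDist G x y =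
    (if x.1.1 = y.1.1 ∧ x.1.2.1 = y.1.2.1 then |x.1.2.2 - y.1.2.2|
      else (Fintype.card V : ℝ) + 1) ∨
    mgDist G x y =
    (if x.1.1 = y.1.2.1 ∧ x.1.2.1 = y.1.1 then |x.1.2.2 - (1 - y.1.2.2)|
      else (Fintype.card V : ℝ) + 1) ∨
    mgDist G x y = x.1.2.2 + G.dist x.1.1 y.1.1 + y.1.2.2 ∨
    mgDist G x y = x.1.2.2 + G.dist x.1.1 y.1.2.1 + (1 - y.1.2.2) ∨
    mgDist G x y = (1 - x.1.2.2) + G.dist x.1.2.1 y.1.1 + y.1.2.2 ∨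
    mgDist G x y = (1 - x.1.2.2) + G.dist x.1.2.1 y.1.2.1 + (1 - y.1.2.2) := by
    unfold mgDist mgDistAux
    generalize (if x.1.1 = y.1.1 ∧ x.1.2.1 = y.1.2.1 then |x.1.2.2 - y.1.2.2|
      else (Fintype.card V : ℝ) + 1) = e1
    generalize (if x.1.1 = y.1.2.1 ∧ x.1.2.1 = y.1.1 then |x.1.2.2 - (1 - y.1.2.2)|
      else (Fintype.card V : ℝ) + 1) = e2
    rcases min_choice (min e1 e2) (min (min (x.1.2.2 + (G.dist x.1.1 y.1.1 : ℝ) + y.1.2.2)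
              (x.1.2.2 + (G.dist x.1.1 y.1.2.1 : ℝ) + (1 - y.1.2.2)))
         (min ((1 - x.1.2.2) + (G.dist x.1.2.1 y.1.1 : ℝ) + y.1.2.2)
              ((1 - x.1.2.2) + (G.dist x.1.2.1 y.1.2.1 : ℝ) + (1 - y.1.2.2)))) with h | h
    · rw [h]
      rcases min_choice e1 e2 with h | h <;> simp [h]
    · rw [h]
      rcases min_choice (min (x.1.2.2 + (G.dist x.1.1 y.1.1 : ℝ) + y.1.2.2)
              (x.1.2.2 + (G.dist x.1.1 y.1.2.1 : ℝ) + (1 - y.1.2.2)))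
         (min ((1 - x.1.2.2) + (G.dist x.1.2.1 y.1.1 : ℝ) + y.1.2.2)
              ((1 - x.1.2.2) + (G.dist x.1.2.1 y.1.2.1 : ℝ) + (1 - y.1.2.2))) with h | h
      · rw [h]
        rcases min_choice (x.1.2.2 + (G.dist x.1.1 y.1.1 : ℝ) + y.1.2.2)
              (x.1.2.2 + (G.dist x.1.1 y.1.2.1 : ℝ) + (1 - y.1.2.2)) with h | h <;> rw [h] <;> simp
      · rw [h]
        rcases min_choice ((1 - x.1.2.2) + (G.dist x.1.2.1 y.1.1 : ℝ) + y.1.2.2)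
              ((1 - x.1.2.2) + (G.dist x.1.2.1 y.1.2.1 : ℝ) + (1 - y.1.2.2)) with h | h <;>
          rw [h] <;> simp
  rcases key with h | h | h | h | h | h
  · split_ifs at h with hc
    · exact Or.inl (Or.inl ⟨hc.1, hc.2, h⟩)
    · exact absurd h hle.ne
  · split_ifs at h with hc
    · exact Or.inl (Or.inr ⟨hc.1, hc.2, h⟩)
    · exact absurd h hle.ne
  · exact Or.inr ⟨_, _, _, _, Or.inl ⟨rfl, rfl⟩, Or.inl ⟨rfl, rfl⟩, h⟩
  · exact Or.inr ⟨_, _, _, _, Or.inl ⟨rfl, rfl⟩, Or.inr ⟨rfl, rfl⟩, h⟩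
  · exact Or.inr ⟨_, _, _, _, Or.inr ⟨rfl, rfl⟩, Or.inl ⟨rfl, rfl⟩, h⟩
  · exact Or.inr ⟨_, _, _, _, Or.inr ⟨rfl, rfl⟩, Or.inr ⟨rfl, rfl⟩, h⟩

lemma mgVDist_le_end {x : MGPoint G} {u : V} {s : ℝ} (v : V) (hx : IsEnd x u s) :
    mgVDist G v x ≤ G.dist v u + s := by
  unfold mgVDist
  rcases hx with ⟨rfl, rfl⟩ | ⟨rfl, rfl⟩
  · exact min_le_left _ _
  · exact min_le_right _ _

lemma mgVDist_cases (v : V) (x : MGPoint G) :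
    ∃ u s, IsEnd x u s ∧ mgVDist G v x = G.dist v u + s := by
  unfold mgVDist
  rcases min_choice ((G.dist v x.1.1 : ℝ) + x.1.2.2) ((G.dist v x.1.2.1 : ℝ) + (1 - x.1.2.2))
    with h | h
  · exact ⟨_, _, Or.inl ⟨rfl, rfl⟩, h⟩
  · exact ⟨_, _, Or.inr ⟨rfl, rfl⟩, h⟩

lemma dist_tri (hG : G.Connected) (u v w : V) :
    (G.dist u w : ℝ) ≤ G.dist u v + G.dist v w := by
  exact_mod_cast hG.dist_triangle

lemma mgVDist_nonneg (v : V) (x : MGPoint G) : 0 ≤ mgVDist G v x := by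
  obtain ⟨u, s, hs, h⟩ := mgVDist_cases v x
  have := hs.nonneg
  rw [h]
  positivity

lemma mgVDist_tri (hG : G.Connected) (v w : V) (x : MGPoint G) :
    mgVDist G v x ≤ G.dist v w + mgVDist G w x := by
  obtain ⟨u, s, hs, h⟩ := mgVDist_cases w x
  have h1 := mgVDist_le_end v hs
  have h2 := dist_tri hG v w u
  linarith

lemma mgDist_le_V (hG : G.Connected) (v : V) (x y : MGPoint G) :
    mgDist G x y ≤ mgVDist G v x + mgVDist G v y := by
  obtain ⟨u, s, hs, h⟩ := mgVDist_cases v x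
  obtain ⟨u', s', hs', h'⟩ := mgVDist_cases v y
  have h1 := mgDist_le_end hs hs'
  have h2 := dist_tri hG u v u'
  rw [G.dist_comm (u := u) (v := v)] at h2
  linarith

lemma Loc.transfer {x y : MGPoint G} {r : ℝ} (h : Loc x y r) {u : V} {s : ℝ} (hx : IsEnd x u s) :
    ∃ t, IsEnd y u t ∧ |s - t| = r := by
  rcases h with ⟨h1, h2, h⟩ | ⟨h1, h2, h⟩ <;> rcases hx with ⟨hu, hs⟩ | ⟨hu, hs⟩
  · exact ⟨_, Or.inl ⟨hu.trans h1, rfl⟩, by rw [h, hs]⟩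
  · refine ⟨_, Or.inr ⟨hu.trans h2, rfl⟩, ?_⟩
    rw [h, hs, ← abs_neg]
    congr 1
    ring
  · exact ⟨_, Or.inr ⟨hu.trans h1, rfl⟩, by rw [h, hs]⟩
  · refine ⟨_, Or.inl ⟨hu.trans h2, rfl⟩, ?_⟩
    rw [h, hs, ← abs_neg]
    congr 1
    ring

lemma mgVDist_le_add (hG : G.Connected) (v : V) (x y : MGPoint G) :
    mgVDist G v y ≤ mgVDist G v x + mgDist G x y := by
  rcases mgDist_cases hG x y with h | ⟨u, w, s, t, hu, hw, h⟩
  · obtain ⟨u, s, hs, h'⟩ := mgVDist_cases v x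
    obtain ⟨t, ht, hr⟩ := h.transfer hs
    have h1 := mgVDist_le_end v ht
    have h2 := neg_abs_le (s - t)
    linarith
  · have h1 := mgVDist_le_end v hw
    obtain ⟨u', s', hs', h'⟩ := mgVDist_cases v x
    rw [h, h']
    have h2 := dist_tri hG v u w
    have h4 := dist_tri hG v u' u
    have h3 : (G.dist u' u : ℝ) ≤ s' + s := by
      have hnn := hs'.nonneg
      have hnn' := hu.nonneg
      have ha : (G.dist x.1.1 x.1.2.1 : ℝ) = 1 := by
        exact_mod_cast SimpleGraph.dist_eq_one_iff_adj.2 x.2.1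
      have hb : (G.dist x.1.2.1 x.1.1 : ℝ) = 1 := by rw [SimpleGraph.dist_comm]; exact ha
      rcases hu with ⟨rfl, rfl⟩ | ⟨rfl, rfl⟩ <;> rcases hs' with ⟨rfl, rfl⟩ | ⟨rfl, rfl⟩
      · simp; linarith
      · rw [hb]; linarith
      · rw [ha]; linarith
      · rw [SimpleGraph.dist_self]; push_cast; linarith
    linarith

lemma mgDist_symm_le (hG : G.Connected) (x y : MGPoint G) : mgDist G x y ≤ mgDist G y x := by
  rcases mgDist_cases hG y x with h | ⟨u, v, s, t, hu, hv, h⟩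
  · exact mgDist_le_loc h.symm
  · have := mgDist_le_end hv hu
    rw [h, G.dist_comm (u := u) (v := v)]
    linarith

lemma mgDist_symm (hG : G.Connected) (x y : MGPoint G) : mgDist G x y = mgDist G y x :=
  le_antisymm (mgDist_symm_le hG x y) (mgDist_symm_le hG y x)

lemma mgVDist_end {x : MGPoint G} {u : V} {s : ℝ} (hx : IsEnd x u s) : mgVDist G u x ≤ s := by
  have := mgVDist_le_end u hx
  simpa using this

lemma mgDist_tri (hG : G.Connected) (x y z : MGPoint G) :
    mgDist G x z ≤ mgDist G x y + mgDist G y z := by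
  rcases mgDist_cases hG x y with h | ⟨u, v, s, t, hu, hv, h⟩
  · rcases mgDist_cases hG y z with h' | ⟨u, v, s, t, hu, hv, h'⟩
    · have hl : ∃ r, Loc x z r ∧ r ≤ mgDist G x y + mgDist G y z := by
        generalize mgDist G x y = a at h
        generalize mgDist G y z = b at h'
        rcases h with ⟨h1, h2, rfl⟩ | ⟨h1, h2, rfl⟩ <;>
          rcases h' with ⟨h3, h4, rfl⟩ | ⟨h3, h4, rfl⟩
        · exact ⟨_, Or.inl ⟨h1.trans h3, h2.trans h4, rfl⟩, abs_sub_le _ _ _⟩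
        · exact ⟨_, Or.inr ⟨h1.trans h3, h2.trans h4, rfl⟩, abs_sub_le _ _ _⟩
        · refine ⟨_, Or.inr ⟨h1.trans h4, h2.trans h3, rfl⟩, ?_⟩
          have := abs_sub_le x.1.2.2 (1 - y.1.2.2) (1 - z.1.2.2)
          have e : |(1 - y.1.2.2) - (1 - z.1.2.2)| = |y.1.2.2 - z.1.2.2| := by
            rw [← abs_neg]; congr 1; ring
          rwa [e] at this
        · refine ⟨_, Or.inl ⟨h1.trans h4, h2.trans h3, rfl⟩, ?_⟩
          have := abs_sub_le x.1.2.2 (1 - y.1.2.2) z.1.2.2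
          have e : |(1 - y.1.2.2) - z.1.2.2| = |y.1.2.2 - (1 - z.1.2.2)| := by
            rw [← abs_neg]; congr 1; ring
          rwa [e] at this
      obtain ⟨r, hr, hle⟩ := hl
      exact (mgDist_le_loc hr).trans hle
    · have h1 := mgDist_le_V hG u x z
      have h2 := mgVDist_le_add hG u y x
      have h3 := mgVDist_end hu
      have h4 := mgVDist_le_end u hv
      rw [mgDist_symm hG y x] at h2
      linarith
  · have h1 := mgDist_le_V hG v x z
    have h2 := mgVDist_le_add hG v y z
    have h3 := mgVDist_end hv
    have h4 := mgVDist_le_end v hu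
    rw [G.dist_comm (u := v) (v := u)] at h4
    linarith

end metric

section walks

variable {V : Type} [Fintype V] [DecidableEq V] {G : SimpleGraph V}

lemma dist_getVert_add (hG : G.Connected) {a b : V} (w : G.Walk a b) (m n : ℕ)
    (h : m + n ≤ w.length) : G.dist (w.getVert m) (w.getVert (m + n)) ≤ n := by
  induction n with
  | zero => simp
  | succ n ih =>
    have h1 := ih (by omega)
    have h2 : G.dist (w.getVert (m + n)) (w.getVert (m + n + 1)) = 1 :=
      SimpleGraph.dist_eq_one_iff_adj.2 (w.adj_getVert_succ (by omega))
    have h3 := hG.dist_triangle (u := w.getVert m) (v := w.getVert (m + n))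
      (w := w.getVert (m + n + 1))
    rw [← add_assoc]
    omega

lemma dist_getVert_le (hG : G.Connected) {a b : V} (w : G.Walk a b) {m n : ℕ}
    (h : m ≤ n) (hn : n ≤ w.length) :
    (G.dist (w.getVert m) (w.getVert n) : ℝ) ≤ (n : ℝ) - m := by
  obtain ⟨e, rfl⟩ := Nat.exists_eq_add_of_le h
  have := dist_getVert_add hG w m e hn
  push_cast
  have h2 : (G.dist (w.getVert m) (w.getVert (m + e)) : ℝ) ≤ e := by exact_mod_cast this
  linarith

/-- A point on an edge of a walk has a position along this walk. -/
lemma walk_pos {a b : V} (w : G.Walk a b) (x : MGPoint G) (hx : edge x ∈ w.edges) :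
    ∃ i : ℕ, i < w.length ∧ ∃ r : ℝ, i ≤ r ∧ r ≤ i + 1 ∧ IsEnd x (w.getVert i) (r - i) ∧
      IsEnd x (w.getVert (i + 1)) (i + 1 - r) := by
  obtain ⟨i, hi, he⟩ := (w.mk_mem_edges_iff_exists).1 hx
  have h0 := x.2.2.1
  have h1 := x.2.2.2
  refine ⟨i, hi, ?_⟩
  rcases Sym2.eq_iff.1 he with ⟨h2, h3⟩ | ⟨h2, h3⟩
  · refine ⟨i + x.1.2.2, by linarith, by linarith, Or.inl ⟨h2, by ring⟩, Or.inr ⟨h3, by ring⟩⟩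
  · refine ⟨i + (1 - x.1.2.2), by linarith, by linarith, Or.inr ⟨h2, by ring⟩,
      Or.inl ⟨h3, by ring⟩⟩

lemma pos_V (hG : G.Connected) {a b : V} (w : G.Walk a b) (x : MGPoint G) {i : ℕ}
    (hi : i < w.length) {r : ℝ} (hr : i ≤ r) (hr' : r ≤ i + 1)
    (h1 : IsEnd x (w.getVert i) (r - i)) (h2 : IsEnd x (w.getVert (i + 1)) (i + 1 - r))
    {m : ℕ} (hm : m ≤ w.length) : mgVDist G (w.getVert m) x ≤ |(m : ℝ) - r| := by
  rcases Nat.lt_or_ge i m with h | h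
  · have h3 := mgVDist_le_end (w.getVert m) h2
    have h4 := dist_getVert_le hG w (m := i + 1) (n := m) h hm
    rw [SimpleGraph.dist_comm] at h4
    push_cast at h4
    have := le_abs_self ((m : ℝ) - r)
    linarith
  · have h3 := mgVDist_le_end (w.getVert m) h1
    have h4 := dist_getVert_le hG w (m := m) (n := i) h hi.le
    have := neg_le_abs ((m : ℝ) - r)
    linarith

lemma walk_V (hG : G.Connected) {a b : V} (w : G.Walk a b) (x : MGPoint G)
    (hx : edge x ∈ w.edges) :
    ∃ r : ℝ, 0 ≤ r ∧ r ≤ w.length ∧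
      ∀ m : ℕ, m ≤ w.length → mgVDist G (w.getVert m) x ≤ |(m : ℝ) - r| := by
  obtain ⟨i, hi, r, hr, hr', h1, h2⟩ := walk_pos w x hx
  have h3 : (0 : ℝ) ≤ i := Nat.cast_nonneg i
  have h4 : (i : ℝ) + 1 ≤ w.length := by exact_mod_cast hi
  exact ⟨r, by linarith, by linarith, fun m hm => pos_V hG w x hi hr hr' h1 h2 hm⟩

lemma walk_ends (hG : G.Connected) {a b : V} (w : G.Walk a b) (x : MGPoint G)
    (hx : edge x ∈ w.edges) : mgVDist G a x + mgVDist G b x ≤ w.length := by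
  obtain ⟨r, h0, h1, h⟩ := walk_V hG w x hx
  have h2 := h 0 (Nat.zero_le _)
  have h3 := h w.length le_rfl
  rw [SimpleGraph.Walk.getVert_zero, Nat.cast_zero, zero_sub, abs_neg, abs_of_nonneg h0] at h2
  rw [SimpleGraph.Walk.getVert_length, abs_of_nonneg (by linarith)] at h3
  linarith

lemma walk_vertex (hG : G.Connected) {a b : V} (w : G.Walk a b) (x : MGPoint G)
    (hx : edge x ∈ w.edges) {v : V} (hv : v ∈ w.support) : mgVDist G v x ≤ w.length := by
  obtain ⟨r, h0, h1, h⟩ := walk_V hG w x hx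
  obtain ⟨m, rfl, hm⟩ := SimpleGraph.Walk.mem_support_iff_exists_getVert.1 hv
  have h2 := h m hm
  have h3 : (m : ℝ) ≤ w.length := by exact_mod_cast hm
  have h4 : (0 : ℝ) ≤ m := Nat.cast_nonneg m
  refine h2.trans (abs_le.2 ⟨by linarith, by linarith⟩)

lemma walk_support_dist (hG : G.Connected) {a b : V} (w : G.Walk a b) {u v : V}
    (hu : u ∈ w.support) (hv : v ∈ w.support) : (G.dist u v : ℝ) ≤ w.length := by
  obtain ⟨m, rfl, hm⟩ := SimpleGraph.Walk.mem_support_iff_exists_getVert.1 hu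
  obtain ⟨n, rfl, hn⟩ := SimpleGraph.Walk.mem_support_iff_exists_getVert.1 hv
  have h3 : (m : ℝ) ≤ w.length := by exact_mod_cast hm
  have h3' : (n : ℝ) ≤ w.length := by exact_mod_cast hn
  have h4 : (0 : ℝ) ≤ m := Nat.cast_nonneg m
  have h4' : (0 : ℝ) ≤ n := Nat.cast_nonneg n
  rcases le_total m n with h | h
  · have := dist_getVert_le hG w h hn
    linarith
  · have := dist_getVert_le hG w h hm
    rw [SimpleGraph.dist_comm] at this
    linarith

/-- On a closed walk, vertices and points are at distance at most half the length. -/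
lemma closed_V (hG : G.Connected) {a : V} (w : G.Walk a a) (x : MGPoint G)
    (hx : edge x ∈ w.edges) {v : V} (hv : v ∈ w.support) :
    2 * mgVDist G v x ≤ w.length := by
  obtain ⟨r, h0, h1, h⟩ := walk_V hG w x hx
  obtain ⟨m, rfl, hm⟩ := SimpleGraph.Walk.mem_support_iff_exists_getVert.1 hv
  have h2 := h m hm
  have ha := h 0 (Nat.zero_le _)
  have hb := h w.length le_rfl
  rw [SimpleGraph.Walk.getVert_zero, Nat.cast_zero, zero_sub, abs_neg, abs_of_nonneg h0] at ha
  rw [SimpleGraph.Walk.getVert_length, abs_of_nonneg (by linarith)] at hb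
  have h5 := dist_getVert_le hG w (Nat.zero_le m) hm
  have h6 := dist_getVert_le hG w hm le_rfl
  rw [SimpleGraph.Walk.getVert_zero, SimpleGraph.dist_comm, Nat.cast_zero] at h5
  rw [SimpleGraph.Walk.getVert_length] at h6
  have h7 := mgVDist_tri hG (w.getVert m) a x
  rcases abs_cases ((m : ℝ) - r) with ⟨h8, -⟩ | ⟨h8, -⟩ <;> rw [h8] at h2 <;> linarith

lemma closed_pts (hG : G.Connected) {a : V} (w : G.Walk a a) (x y : MGPoint G)
    (hx : edge x ∈ w.edges) (hy : edge y ∈ w.edges) : 2 * mgDist G x y ≤ w.length := by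
  obtain ⟨i, hi, r, hr, hr', h1, h2⟩ := walk_pos w x hx
  obtain ⟨j, hj, s, hs, hs', h3, h4⟩ := walk_pos w y hy
  have hxV := fun m hm => pos_V hG w x hi hr hr' h1 h2 (m := m) hm
  have hyV := fun m hm => pos_V hG w y hj hs hs' h3 h4 (m := m) hm
  have hi0 : (0 : ℝ) ≤ i := Nat.cast_nonneg i
  have hj0 : (0 : ℝ) ≤ j := Nat.cast_nonneg j
  have hi1 : (i : ℝ) + 1 ≤ w.length := by exact_mod_cast hi
  have hj1 : (j : ℝ) + 1 ≤ w.length := by exact_mod_cast hj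
  have ha := hxV 0 (Nat.zero_le _)
  have hb := hxV w.length le_rfl
  rw [SimpleGraph.Walk.getVert_zero, Nat.cast_zero, zero_sub, abs_neg,
    abs_of_nonneg (by linarith)] at ha
  rw [SimpleGraph.Walk.getVert_length, abs_of_nonneg (by linarith)] at hb
  have hc := hyV 0 (Nat.zero_le _)
  have hd := hyV w.length le_rfl
  rw [SimpleGraph.Walk.getVert_zero, Nat.cast_zero, zero_sub, abs_neg,
    abs_of_nonneg (by linarith)] at hc
  rw [SimpleGraph.Walk.getVert_length, abs_of_nonneg (by linarith)] at hd
  have hV := mgDist_le_V hG a x y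
  rcases lt_trichotomy i j with h | h | h
  · have e1 := hxV (i + 1) hi
    have e2 := hyV (i + 1) hi
    have e3 := mgDist_le_V hG (w.getVert (i + 1)) x y
    have e4 : (i : ℝ) + 1 ≤ j := by exact_mod_cast h
    push_cast at e1 e2
    rw [abs_of_nonneg (by linarith)] at e1
    rw [abs_of_nonpos (by linarith)] at e2
    linarith
  · subst h
    have hne : w.getVert i ≠ w.getVert (i + 1) := (w.adj_getVert_succ hi).ne
    have hloc : mgDist G x y ≤ |r - s| := by
      rcases h1 with ⟨u1, t1⟩ | ⟨u1, t1⟩ <;> rcases h2 with ⟨u2, t2⟩ | ⟨u2, t2⟩ <;>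
      rcases h3 with ⟨u3, t3⟩ | ⟨u3, t3⟩ <;> rcases h4 with ⟨u4, t4⟩ | ⟨u4, t4⟩ <;>
      first
        | exact absurd (u1.trans u2.symm) hne
        | exact absurd (u3.trans u4.symm) hne
        | skip
      · refine mgDist_le_loc (Or.inl ⟨u1.symm.trans u3, u2.symm.trans u4, ?_⟩)
        rw [← t1, ← t3]; congr 1; ring
      · refine mgDist_le_loc (Or.inr ⟨u1.symm.trans u3, u2.symm.trans u4, ?_⟩)
        rw [← t1, ← t3]; congr 1; ring
      · refine mgDist_le_loc (Or.inr ⟨u2.symm.trans u4, u1.symm.trans u3, ?_⟩)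
        rw [← t2, ← t3, ← abs_neg]; congr 1; ring
      · refine mgDist_le_loc (Or.inl ⟨u2.symm.trans u4, u1.symm.trans u3, ?_⟩)
        rw [← t2, ← t4, ← abs_neg]; congr 1; ring
    rcases abs_cases (r - s) with ⟨h8, -⟩ | ⟨h8, -⟩ <;> rw [h8] at hloc <;> linarith
  · have e1 := hxV (j + 1) hj
    have e2 := hyV (j + 1) hj
    have e3 := mgDist_le_V hG (w.getVert (j + 1)) x y
    have e4 : (j : ℝ) + 1 ≤ i := by exact_mod_cast h
    push_cast at e1 e2
    rw [abs_of_nonpos (by linarith)] at e1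
    rw [abs_of_nonneg (by linarith)] at e2
    linarith

end walks

section crossing

variable {V : Type} [Fintype V] [DecidableEq V] {G : SimpleGraph V}

/-- Signed distance to a separating set of vertices. -/
lemma exists_signed (hG : G.Connected) (S : Set V) (hS : S.Nonempty) (L : MGPoint G → Prop)
    (hsep : ∀ x y, L x → ¬ L y → ∃ v ∈ S, mgVDist G v x + mgVDist G v y ≤ mgDist G x y) :
    ∃ f : MGPoint G → ℝ, (∀ x y, |f x - f y| ≤ mgDist G x y) ∧ (∀ x, L x → f x ≤ 0) ∧
      (∀ x, ¬ L x → 0 ≤ f x) ∧ (∀ x, f x = 0 → ∃ v ∈ S, mgVDist G v x = 0) := by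
  classical
  have hmin : ∀ x : MGPoint G, ∃ v ∈ S, ∀ w ∈ S, mgVDist G v x ≤ mgVDist G w x := fun x =>
    Set.exists_min_image S (fun v => mgVDist G v x) S.toFinite hS
  choose m hmS hm using hmin
  have hD : ∀ x y, mgVDist G (m x) x ≤ mgVDist G (m y) y + mgDist G x y := fun x y => by
    have h1 := hm x (m y) (hmS y)
    have h2 := mgVDist_le_add hG (m y) y x
    rw [mgDist_symm hG y x] at h2
    linarith
  have hnn := fun x => mgVDist_nonneg (m x) x
  refine ⟨fun x => if L x then - mgVDist G (m x) x else mgVDist G (m x) x, ?_, ?_, ?_, ?_⟩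
  · intro x y
    have h1 := hD x y
    have h2 := hD y x
    rw [mgDist_symm hG y x] at h2
    have h3 := hnn x
    have h4 := hnn y
    by_cases hx : L x <;> by_cases hy : L y <;> simp only [hx, hy, if_true, if_false]
    · rw [abs_le]; constructor <;> linarith
    · obtain ⟨v, hv, hle⟩ := hsep x y hx hy
      have h5 := hm x v hv
      have h6 := hm y v hv
      rw [abs_le]; constructor <;> linarith
    · obtain ⟨v, hv, hle⟩ := hsep y x hy hx
      rw [mgDist_symm hG y x] at hle
      have h5 := hm x v hv
      have h6 := hm y v hv
      rw [abs_le]; constructor <;> linarith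
    · rw [abs_le]; constructor <;> linarith
  · intro x hx
    have := hnn x
    simp only [hx, if_true]
    linarith
  · intro x hx
    have := hnn x
    simp only [hx, if_false]
    linarith
  · intro x hx
    refine ⟨m x, hmS x, ?_⟩
    by_cases hL : L x
    · simpa [hL] using hx
    · simpa [hL] using hx

lemma geod_ivt {f : MGPoint G → ℝ} (hf : ∀ x y, |f x - f y| ≤ mgDist G x y) {a b : ℝ}
    {g : ℝ → MGPoint G} (hg : IsMGGeodesic G a b g)
    (h : (f (g a) ≤ 0 ∧ 0 ≤ f (g b)) ∨ (f (g b) ≤ 0 ∧ 0 ≤ f (g a))) :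
    ∃ s ∈ Set.Icc a b, f (g s) = 0 := by
  have hc : ContinuousOn (fun s => f (g s)) (Set.Icc a b) := by
    have : LipschitzOnWith 1 (fun s => f (g s)) (Set.Icc a b) := by
      refine LipschitzOnWith.of_dist_le_mul fun s hs t ht => ?_
      rw [Real.dist_eq, Real.dist_eq, NNReal.coe_one, one_mul, ← hg.2 s hs t ht]
      exact hf _ _
    exact this.continuousOn
  rcases h with h | h
  · obtain ⟨s, hs, h0⟩ := intermediate_value_Icc hg.1 hc ⟨h.1, h.2⟩
    exact ⟨s, hs, h0⟩
  · obtain ⟨s, hs, h0⟩ := intermediate_value_Icc' hg.1 hc ⟨h.1, h.2⟩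
    exact ⟨s, hs, h0⟩

/-- Two consecutive geodesics joining the two sides of a separating set meet this set. -/
lemma two_geod_cross (hG : G.Connected) (S : Set V) (hS : S.Nonempty) (L : MGPoint G → Prop)
    (hsep : ∀ x y, L x → ¬ L y → ∃ v ∈ S, mgVDist G v x + mgVDist G v y ≤ mgDist G x y)
    {a2 b2 a3 b3 : ℝ} {g2 g3 : ℝ → MGPoint G} (h2 : IsMGGeodesic G a2 b2 g2)
    (h3 : IsMGGeodesic G a3 b3 g3) {x y : MGPoint G} (hy : mgDist G y (g2 a2) = 0)
    (hz : mgDist G (g2 b2) (g3 a3) = 0) (hx : mgDist G (g3 b3) x = 0)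
    (hL : (L x ∧ ¬ L y) ∨ (L y ∧ ¬ L x)) :
    ∃ w, ((∃ t ∈ Set.Icc a2 b2, w = g2 t) ∨ (∃ t ∈ Set.Icc a3 b3, w = g3 t)) ∧
      ∃ v ∈ S, mgVDist G v w = 0 := by
  obtain ⟨f, hf, hf1, hf2, hf3⟩ := exists_signed hG S hS L hsep
  have heq : ∀ u v, mgDist G u v = 0 → f u = f v := fun u v h => by
    have := hf u v
    rw [h] at this
    exact sub_eq_zero.1 (abs_eq_zero.1 (le_antisymm this (abs_nonneg _)))
  have e1 := heq _ _ hy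
  have e2 := heq _ _ hz
  have e3 := heq _ _ hx
  have hxy : (f x ≤ 0 ∧ 0 ≤ f y) ∨ (f y ≤ 0 ∧ 0 ≤ f x) := by
    rcases hL with ⟨h, h'⟩ | ⟨h, h'⟩
    · exact Or.inl ⟨hf1 _ h, hf2 _ h'⟩
    · exact Or.inr ⟨hf1 _ h, hf2 _ h'⟩
  have key : ((f (g2 a2) ≤ 0 ∧ 0 ≤ f (g2 b2)) ∨ (f (g2 b2) ≤ 0 ∧ 0 ≤ f (g2 a2))) ∨
      ((f (g3 a3) ≤ 0 ∧ 0 ≤ f (g3 b3)) ∨ (f (g3 b3) ≤ 0 ∧ 0 ≤ f (g3 a3))) := by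
    rw [← e1, e3, e2]
    rcases le_total (f (g3 a3)) 0 with h | h <;> tauto
  rcases key with h | h
  · obtain ⟨s, hs, h0⟩ := geod_ivt hf h2 h
    exact ⟨_, Or.inl ⟨s, hs, rfl⟩, hf3 _ h0⟩
  · obtain ⟨s, hs, h0⟩ := geod_ivt hf h3 h
    exact ⟨_, Or.inr ⟨s, hs, rfl⟩, hf3 _ h0⟩

end crossing

section core

variable {V : Type} [Fintype V] [DecidableEq V] {G : SimpleGraph V}

/-- A walk between the two sides of a vertex separator meets the separator. -/
lemma walk_meets (S L R : Set V) (hLR : ∀ v, v ∈ L → v ∈ R → v ∈ S)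
    (hadj : ∀ u v, G.Adj u v → (u ∈ L ∧ v ∈ L) ∨ (u ∈ R ∧ v ∈ R))
    {a b : V} (w : G.Walk a b) (ha : a ∈ L) (hb : b ∈ R) : ∃ v ∈ S, v ∈ w.support := by
  induction w with
  | nil => exact ⟨_, hLR _ ha hb, by simp⟩
  | @cons u v x h w ih =>
    rcases hadj u v h with ⟨-, h2⟩ | ⟨h1, -⟩
    · obtain ⟨z, hz, hzw⟩ := ih h2 hb
      exact ⟨z, hz, by simp [hzw]⟩
    · exact ⟨u, hLR _ ha h1, by simp⟩

lemma dist_split (hG : G.Connected) (S L R : Set V) (hLR : ∀ v, v ∈ L → v ∈ R → v ∈ S)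
    (hadj : ∀ u v, G.Adj u v → (u ∈ L ∧ v ∈ L) ∨ (u ∈ R ∧ v ∈ R))
    {a b : V} (ha : a ∈ L) (hb : b ∈ R) :
    ∃ v ∈ S, (G.dist v a : ℝ) + G.dist v b ≤ G.dist a b := by
  obtain ⟨w, hw⟩ := hG.exists_walk_length_eq_dist a b
  obtain ⟨v, hv, hvw⟩ := walk_meets S L R hLR hadj w ha hb
  refine ⟨v, hv, ?_⟩
  have h1 := SimpleGraph.dist_le (w.takeUntil v hvw)
  have h2 := SimpleGraph.dist_le (w.dropUntil v hvw)
  have h3 := congrArg SimpleGraph.Walk.length (w.take_spec hvw)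
  rw [SimpleGraph.Walk.length_append] at h3
  rw [SimpleGraph.dist_comm] at h1
  have : G.dist v a + G.dist v b ≤ G.dist a b := by omega
  exact_mod_cast this

/-- The combinatorial data of the chain used in the proof. -/
structure ChainData (G : SimpleGraph V) (k : ℕ) (d : ℝ) where
  base : ℕ → V
  c : ∀ j, G.Walk (base j) (base j)
  S : ℕ → Set V
  al : ℕ → ℝ
  idx : Sym2 V → ℕ
  idx_le : ∀ e ∈ G.edgeSet, idx e ≤ k
  idx_mem : ∀ e ∈ G.edgeSet, e ∈ (c (idx e)).edges
  sep : ∀ i j i' v, i < j → j ≤ i' → i' ≤ k → v ∈ (c i).support → v ∈ (c i').support → v ∈ S j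
  S_ne : ∀ j, (S j).Nonempty
  S_right : ∀ j v, 1 ≤ j → j ≤ k → v ∈ S j → v ∈ (c j).support
  S_left : ∀ j v, j < k → v ∈ S (j + 1) → v ∈ (c j).support
  S_diam : ∀ j u v, 1 ≤ j → j ≤ k → u ∈ S j → v ∈ S j → (G.dist u v : ℝ) ≤ al j
  mid : ∀ j (x : MGPoint G), 0 < j → j < k → edge x ∈ (c j).edges →
    ∀ u v, u ∈ S j → v ∈ S (j + 1) → mgVDist G u x ≤ d ∨ mgVDist G v x ≤ d
  al_nonneg : ∀ j, 0 ≤ al j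
  bd1 : ∀ j, j ≤ k → ((c j).length + 2 * al j) / 4 ≤ d
  bd2 : ∀ j, j ≤ k → ((c j).length + 2 * al (j + 1)) / 4 ≤ d

variable {k : ℕ} {d : ℝ}

lemma ChainData.hsep (D : ChainData G k d) (hG : G.Connected) (j : ℕ) (x y : MGPoint G)
    (hx : D.idx (edge x) < j) (hy : j ≤ D.idx (edge y)) :
    ∃ v ∈ D.S j, mgVDist G v x + mgVDist G v y ≤ mgDist G x y := by
  have hend : ∀ (z : MGPoint G) (u : V) (s : ℝ), IsEnd z u s →
      u ∈ (D.c (D.idx (edge z))).support := by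
    intro z u s h
    have hm := D.idx_mem _ (edge_mem z)
    rcases h with ⟨rfl, -⟩ | ⟨rfl, -⟩
    · exact SimpleGraph.Walk.fst_mem_support_of_mem_edges _ hm
    · exact SimpleGraph.Walk.snd_mem_support_of_mem_edges _ hm
  rcases mgDist_cases hG x y with h | ⟨u, v, s, t, hu, hv, h⟩
  · have := h.edge_eq
    rw [this] at hx
    omega
  · obtain ⟨z, hz, hle⟩ := dist_split hG (D.S j) {v | ∃ i, i < j ∧ v ∈ (D.c i).support}
      {v | ∃ i, j ≤ i ∧ i ≤ k ∧ v ∈ (D.c i).support}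
      (fun v h1 h2 => by
        obtain ⟨i, hi, hv⟩ := h1
        obtain ⟨i', hi', hk, hv'⟩ := h2
        exact D.sep i j i' v hi hi' hk hv hv')
      (fun a b hab => by
        have h1 := D.idx_mem s(a, b) hab
        have h2 := D.idx_le s(a, b) hab
        have h3 := SimpleGraph.Walk.fst_mem_support_of_mem_edges _ h1
        have h4 := SimpleGraph.Walk.snd_mem_support_of_mem_edges _ h1
        rcases Nat.lt_or_ge (D.idx s(a, b)) j with h5 | h5
        · exact Or.inl ⟨⟨_, h5, h3⟩, ⟨_, h5, h4⟩⟩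
        · exact Or.inr ⟨⟨_, h5, h2, h3⟩, ⟨_, h5, h2, h4⟩⟩)
      (a := u) (b := v) ⟨_, hx, hend x u s hu⟩
      ⟨_, hy, D.idx_le _ (edge_mem y), hend y v t hv⟩
    refine ⟨z, hz, ?_⟩
    have h1 := mgVDist_le_end z hu
    have h2 := mgVDist_le_end z hv
    linarith

/-- Core argument: `P` is between `x` and `y`, `W` is a connected set joining `x` to `y`. -/
lemma ChainData.core (D : ChainData G k d) (hG : G.Connected) (x y P : MGPoint G)
    (hP : mgDist G x P + mgDist G P y = mgDist G x y) (W : MGPoint G → Prop)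
    (hx : ∃ w, W w ∧ mgDist G x w = 0) (hy : ∃ w, W w ∧ mgDist G y w = 0)
    (hW : ∀ j, D.idx (edge x) < j → j ≤ D.idx (edge y) →
      ∃ w, W w ∧ ∃ v ∈ D.S j, mgVDist G v w = 0)
    (hle : D.idx (edge x) ≤ D.idx (edge y)) :
    ∃ w, W w ∧ mgDist G P w ≤ d := by
  have hxk := D.idx_le _ (edge_mem x)
  have hyk := D.idx_le _ (edge_mem y)
  have hxm := D.idx_mem _ (edge_mem x)
  have hym := D.idx_mem _ (edge_mem y)
  have hPm := D.idx_mem _ (edge_mem P)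
  have hxd : mgDist G P x ≤ d → ∃ w, W w ∧ mgDist G P w ≤ d := fun h => by
    obtain ⟨w, hw, h0⟩ := hx
    refine ⟨w, hw, ?_⟩
    have := mgDist_tri hG P x w
    linarith
  have hyd : mgDist G P y ≤ d → ∃ w, W w ∧ mgDist G P w ≤ d := fun h => by
    obtain ⟨w, hw, h0⟩ := hy
    refine ⟨w, hw, ?_⟩
    have := mgDist_tri hG P y w
    linarith
  have hvd : ∀ v w, W w → mgVDist G v w = 0 → mgVDist G v P ≤ d →
      ∃ w, W w ∧ mgDist G P w ≤ d := fun v w hw h0 h => by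
    refine ⟨w, hw, ?_⟩
    have := mgDist_le_V hG v P w
    linarith
  have hsx := mgDist_symm hG x P
  rcases hle.eq_or_lt with hab | hab
  · rw [← hab] at hym
    have h1 := closed_pts hG _ x y hxm hym
    have h2 := D.bd1 _ hxk
    have h3 := D.al_nonneg (D.idx (edge x))
    rcases le_total (mgDist G x P) (mgDist G P y) with h | h
    · exact hxd (by linarith)
    · exact hyd (by linarith)
  rcases Nat.lt_or_ge (D.idx (edge P)) (D.idx (edge y)) with hPy | hPy
  · rcases Nat.lt_or_ge (D.idx (edge x)) (D.idx (edge P)) with hPx | hPx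
    · obtain ⟨w, hw, v, hv, h0⟩ := hW _ hPx hPy.le
      obtain ⟨w2, hw2, v2, hv2, h02⟩ := hW (D.idx (edge P) + 1) (by omega) hPy
      rcases D.mid _ P (by omega) (by omega) hPm v v2 hv hv2 with h | h
      · exact hvd v w hw h0 h
      · exact hvd v2 w2 hw2 h02 h
    · obtain ⟨w, hw, v, hv, h0⟩ := hW (D.idx (edge x) + 1) (by omega) hab
      obtain ⟨u, hu, hs⟩ := D.hsep hG (D.idx (edge x) + 1) P y (by omega) hab
      have h1 := mgDist_le_V hG u x y
      have h2 := closed_V hG _ x hxm (D.S_left _ u (by omega) hu)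
      have h3 := D.S_diam _ v u (by omega) (by omega) hv hu
      have h4 := mgVDist_tri hG v u P
      have h5 := D.bd2 _ hxk
      rcases le_total (mgDist G P x) d with h | h
      · exact hxd h
      · exact hvd v w hw h0 (by linarith)
  · obtain ⟨w, hw, v, hv, h0⟩ := hW _ hab le_rfl
    obtain ⟨u, hu, hs⟩ := D.hsep hG _ x P hab hPy
    have h1 := mgDist_le_V hG u x y
    have h2 := closed_V hG _ y hym (D.S_right _ u (by omega) hyk hu)
    have h3 := D.S_diam _ v u (by omega) hyk hv hu
    have h4 := mgVDist_tri hG v u P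
    have h5 := D.bd1 _ hyk
    rcases le_total (mgDist G P y) d with h | h
    · exact hyd h
    · exact hvd v w hw h0 (by linarith)

lemma ChainData.side (D : ChainData G k d) (hG : G.Connected)
    {a1 b1 a2 b2 a3 b3 : ℝ} {g1 g2 g3 : ℝ → MGPoint G} (h1 : IsMGGeodesic G a1 b1 g1)
    (h2 : IsMGGeodesic G a2 b2 g2) (h3 : IsMGGeodesic G a3 b3 g3)
    (hy : mgDist G (g1 b1) (g2 a2) = 0) (hz : mgDist G (g2 b2) (g3 a3) = 0)
    (hx : mgDist G (g3 b3) (g1 a1) = 0) (s : ℝ) (hs : s ∈ Set.Icc a1 b1) :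
    (∃ t ∈ Set.Icc a2 b2, mgDist G (g1 s) (g2 t) ≤ d) ∨
      (∃ t ∈ Set.Icc a3 b3, mgDist G (g1 s) (g3 t) ≤ d) := by
  set W : MGPoint G → Prop := fun w =>
    (∃ t ∈ Set.Icc a2 b2, w = g2 t) ∨ (∃ t ∈ Set.Icc a3 b3, w = g3 t) with hWdef
  have ha : a1 ∈ Set.Icc a1 b1 := ⟨le_rfl, h1.1⟩
  have hb : b1 ∈ Set.Icc a1 b1 := ⟨h1.1, le_rfl⟩
  have hP : mgDist G (g1 a1) (g1 s) + mgDist G (g1 s) (g1 b1) = mgDist G (g1 a1) (g1 b1) := by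
    rw [h1.2 _ ha _ hs, h1.2 _ hs _ hb, h1.2 _ ha _ hb, abs_of_nonpos (by linarith [hs.1]),
      abs_of_nonpos (by linarith [hs.2]), abs_of_nonpos (by linarith [h1.1])]
    ring
  have hxW : ∃ w, W w ∧ mgDist G (g1 a1) w = 0 :=
    ⟨g3 b3, Or.inr ⟨b3, ⟨h3.1, le_rfl⟩, rfl⟩, by rw [mgDist_symm hG]; exact hx⟩
  have hyW : ∃ w, W w ∧ mgDist G (g1 b1) w = 0 :=
    ⟨g2 a2, Or.inl ⟨a2, ⟨le_rfl, h2.1⟩, rfl⟩, hy⟩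
  have hcross : ∀ j, ((D.idx (edge (g1 a1)) < j ∧ ¬ D.idx (edge (g1 b1)) < j) ∨
      (D.idx (edge (g1 b1)) < j ∧ ¬ D.idx (edge (g1 a1)) < j)) →
      ∃ w, W w ∧ ∃ v ∈ D.S j, mgVDist G v w = 0 := fun j hj =>
    two_geod_cross hG (D.S j) (D.S_ne j) (fun z => D.idx (edge z) < j)
      (fun x y hx hy => D.hsep hG j x y hx (not_lt.1 hy)) h2 h3 hy hz hx hj
  have main : ∃ w, W w ∧ mgDist G (g1 s) w ≤ d := by
    rcases le_total (D.idx (edge (g1 a1))) (D.idx (edge (g1 b1))) with hle | hle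
    · exact D.core hG _ _ _ hP W hxW hyW
        (fun j hj hj' => hcross j (Or.inl ⟨hj, not_lt.2 hj'⟩)) hle
    · refine D.core hG (g1 b1) (g1 a1) (g1 s) ?_ W hyW hxW
        (fun j hj hj' => hcross j (Or.inr ⟨hj, not_lt.2 hj'⟩)) hle
      rw [mgDist_symm hG (g1 b1) (g1 s), mgDist_symm hG (g1 s) (g1 a1),
        mgDist_symm hG (g1 b1) (g1 a1)]
      linarith
  obtain ⟨w, ⟨t, ht, rfl⟩ | ⟨t, ht, rfl⟩, hle⟩ := main
  · exact Or.inl ⟨t, ht, hle⟩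
  · exact Or.inr ⟨t, ht, hle⟩

lemma ChainData.hyp_le (D : ChainData G k d) (hG : G.Connected) (hd : 0 ≤ d) :
    hypDelta G ≤ d := by
  refine Real.sSup_le ?_ hd
  rintro _ ⟨T, rfl⟩
  refine csInf_le ⟨0, fun x hx => hx.1⟩ ⟨hd, ?_, ?_, ?_⟩
  · exact fun s hs => D.side hG T.h1 T.h2 T.h3 T.glue1 T.glue2 T.glue3 s hs
  · exact fun s hs => (D.side hG T.h2 T.h3 T.h1 T.glue2 T.glue3 T.glue1 s hs).symm
  · exact fun s hs => D.side hG T.h3 T.h1 T.h2 T.glue3 T.glue1 T.glue2 s hs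

end core

end ChainHyp

/-- Proposition (general): upper bound for the hyperbolicity constant of a
chain-of-cycles graph `G_{A,B,B'}`. The graph is described abstractly: paths
`A j` (of length `α j`, `1 ≤ j ≤ k`) joining `p j` and `q j`, paths `B0`, `Bk`,
`Bmid j` (lengths `β 0`, `β k`, `β j`) and `B'mid j` (length `β' j`), forming
cycles `C₀,…,C_k` with supports `Cs j`, consecutive cycles meeting exactly in
`A (j+1)` and non-consecutive cycles disjoint. The conclusion
`δ(G) ≤ max{…}` is stated as: `δ(G) ≤ d` for every upper bound `d` of the
displayed quantities. -/
theorem hypDelta_chain_le {V : Type} [Fintype V] [DecidableEq V] (G : SimpleGraph V)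
    (hG : G.Connected) (k : ℕ) (hk : 1 ≤ k) (al be be' : ℕ → ℕ)
    (hbe'0 : be' 0 = 0) (hbe'k : be' k = 0) (hal0 : al 0 = 0) (halk : al (k + 1) = 0)
    (hineq1 : ∀ j, 1 ≤ j → j ≤ k → al j < be j + al (j + 1) + be' j)
    (hineq2 : ∀ j, 1 ≤ j → j ≤ k → al j < be (j - 1) + al (j - 1) + be' (j - 1))
    (p q : ℕ → V)
    (A : ∀ j, G.Walk (p j) (q j))
    (B0 : G.Walk (q 1) (p 1)) (Bk : G.Walk (p k) (q k))
    (Bmid : ∀ j, G.Walk (p j) (p (j + 1)))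
    (B'mid : ∀ j, G.Walk (q j) (q (j + 1)))
    (hA : ∀ j, 1 ≤ j → j ≤ k → (A j).IsPath ∧ (A j).length = al j)
    (hB0 : B0.IsPath ∧ B0.length = be 0)
    (hBk : Bk.IsPath ∧ Bk.length = be k)
    (hBmid : ∀ j, 1 ≤ j → j + 1 ≤ k → (Bmid j).IsPath ∧ (Bmid j).length = be j)
    (hB'mid : ∀ j, 1 ≤ j → j + 1 ≤ k → (B'mid j).IsPath ∧ (B'mid j).length = be' j)
    (Cs : ℕ → Set V)
    (hCs0 : Cs 0 = {v | v ∈ B0.support ∨ v ∈ (A 1).support})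
    (hCsk : Cs k = {v | v ∈ Bk.support ∨ v ∈ (A k).support})
    (hCsmid : ∀ j, 0 < j → j < k → Cs j =
      {v | v ∈ (Bmid j).support ∨ v ∈ (B'mid j).support ∨
        v ∈ (A j).support ∨ v ∈ (A (j + 1)).support})
    (hconsec : ∀ j, j < k → Cs j ∩ Cs (j + 1) = {v | v ∈ (A (j + 1)).support})
    (hfar : ∀ i j, i + 1 < j → j ≤ k → Cs i ∩ Cs j = ∅)
    (hVc : ∀ v : V, ∃ j, j ≤ k ∧ v ∈ Cs j)
    (hE : ∀ e ∈ G.edgeSet, e ∈ B0.edges ∨ e ∈ Bk.edges ∨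
      (∃ j, 1 ≤ j ∧ j ≤ k ∧ e ∈ (A j).edges) ∨
      (∃ j, 1 ≤ j ∧ j + 1 ≤ k ∧ e ∈ (Bmid j).edges) ∨
      (∃ j, 1 ≤ j ∧ j + 1 ≤ k ∧ e ∈ (B'mid j).edges)) :
    ∀ d : ℝ,
      (∀ j, j ≤ k →
        ((be j : ℝ) + (be' j : ℝ) +
          max (3 * (al j : ℝ) + (al (j + 1) : ℝ)) ((al j : ℝ) + 3 * (al (j + 1) : ℝ))) / 4 ≤ d) →
      (∀ j, 0 < j → j < k →
        ((al j : ℝ) + (al (j + 1) : ℝ) + max (be j : ℝ) (be' j : ℝ)) / 2 ≤ d) →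
      hypDelta G ≤ d := by
  intro d hd1 hd2
  have hcyc : ∀ j, ∃ (b : V) (c : G.Walk b b), j ≤ k →
      (c.length = be j + be' j + al j + al (j + 1) ∧
      (∀ v, v ∈ c.support ↔ v ∈ Cs j) ∧
      (j = 0 → ∀ e ∈ B0.edges, e ∈ c.edges) ∧
      (j = k → ∀ e ∈ Bk.edges, e ∈ c.edges) ∧
      (1 ≤ j → ∀ e ∈ (A j).edges, e ∈ c.edges) ∧
      (0 < j → j < k → ∀ e, e ∈ c.edges ↔ (e ∈ (Bmid j).edges ∨ e ∈ (B'mid j).edges ∨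
        e ∈ (A j).edges ∨ e ∈ (A (j + 1)).edges))) := by
    intro j
    rcases Nat.lt_or_ge k j with hj | hj
    · exact ⟨p 0, SimpleGraph.Walk.nil, fun h => absurd hj (not_lt.2 h)⟩
    rcases Nat.eq_zero_or_pos j with rfl | hj0
    · refine ⟨q 1, B0.append (A 1), fun _ => ⟨?_, ?_, ?_, ?_, ?_, ?_⟩⟩
      · rw [SimpleGraph.Walk.length_append, hB0.2, (hA 1 le_rfl hk).2]
        simp only [zero_add]
        omega
      · intro v
        rw [SimpleGraph.Walk.mem_support_append_iff, hCs0]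
        rfl
      · intro _ e he
        simp [SimpleGraph.Walk.edges_append, he]
      · intro h
        omega
      · intro h
        omega
      · intro h
        omega
    rcases hj.eq_or_lt with rfl | hjk
    · refine ⟨p j, Bk.append (A j).reverse, fun _ => ⟨?_, ?_, ?_, ?_, ?_, ?_⟩⟩
      · rw [SimpleGraph.Walk.length_append, SimpleGraph.Walk.length_reverse, hBk.2,
          (hA j hj0 le_rfl).2]
        omega
      · intro v
        rw [SimpleGraph.Walk.mem_support_append_iff, hCsk, SimpleGraph.Walk.support_reverse,
          List.mem_reverse]
        rfl
      · intro h
        omega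
      · intro _ e he
        simp [SimpleGraph.Walk.edges_append, he]
      · intro _ e he
        simp [SimpleGraph.Walk.edges_append, he]
      · intro _ h
        omega
    · refine ⟨p j, ((Bmid j).append (A (j + 1))).append ((B'mid j).reverse.append (A j).reverse),
        fun _ => ⟨?_, ?_, ?_, ?_, ?_, ?_⟩⟩
      · simp only [SimpleGraph.Walk.length_append, SimpleGraph.Walk.length_reverse]
        rw [(hA j hj0 hj).2, (hA (j + 1) (by omega) hjk).2, (hBmid j hj0 hjk).2,
          (hB'mid j hj0 hjk).2]
        omega
      · intro v
        rw [hCsmid j hj0 hjk]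
        simp only [SimpleGraph.Walk.mem_support_append_iff, SimpleGraph.Walk.support_reverse,
          List.mem_reverse, Set.mem_ofPred_eq]
        tauto
      · intro h
        omega
      · intro h
        omega
      · intro _ e he
        simp [SimpleGraph.Walk.edges_append, he]
      · intro _ _ e
        simp only [SimpleGraph.Walk.edges_append, SimpleGraph.Walk.edges_reverse,
          List.mem_append, List.mem_reverse]
        tauto
  choose base c hc using hcyc
  have hidx : ∀ e ∈ G.edgeSet, ∃ j, j ≤ k ∧ e ∈ (c j).edges := by
    intro e he
    rcases hE e he with h | h | ⟨j, h1, h2, h⟩ | ⟨j, h1, h2, h⟩ | ⟨j, h1, h2, h⟩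
    · exact ⟨0, Nat.zero_le _, (hc 0 (Nat.zero_le _)).2.2.1 rfl e h⟩
    · exact ⟨k, le_rfl, (hc k le_rfl).2.2.2.1 rfl e h⟩
    · exact ⟨j, h2, (hc j h2).2.2.2.2.1 h1 e h⟩
    · exact ⟨j, by omega, ((hc j (by omega)).2.2.2.2.2 h1 h2 e).2 (Or.inl h)⟩
    · exact ⟨j, by omega, ((hc j (by omega)).2.2.2.2.2 h1 h2 e).2 (Or.inr (Or.inl h))⟩
  choose! idx hidx1 hidx2 using hidx
  have hAle : ∀ j, 1 ≤ j → j ≤ k → (al j : ℝ) ≤ d := by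
    intro j h1 h2
    have h3 := hd1 j h2
    have h4 : (al j : ℝ) ≤ be j + al (j + 1) + be' j := by exact_mod_cast (hineq1 j h1 h2).le
    have h5 := le_max_left (3 * (al j : ℝ) + (al (j + 1) : ℝ)) ((al j : ℝ) + 3 * (al (j + 1) : ℝ))
    linarith
  have hAd : ∀ j, 1 ≤ j → j ≤ k → ∀ u v, u ∈ (A j).support → v ∈ (A j).support →
      (G.dist u v : ℝ) ≤ al j := by
    intro j h1 h2 u v hu hv
    rw [← (hA j h1 h2).2]
    exact ChainHyp.walk_support_dist hG (A j) hu hv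
  have hAV : ∀ j, 1 ≤ j → j ≤ k → ∀ x : MGPoint G, ChainHyp.edge x ∈ (A j).edges →
      ∀ u ∈ (A j).support, mgVDist G u x ≤ d := by
    intro j h1 h2 x hx u hu
    have h3 := ChainHyp.walk_vertex hG (A j) x hx hu
    rw [(hA j h1 h2).2] at h3
    exact h3.trans (hAle j h1 h2)
  have hlen : ∀ j, j ≤ k → ((c j).length : ℝ) = be j + be' j + al j + al (j + 1) := by
    intro j hj
    exact_mod_cast (hc j hj).1
  have hd0 : 0 ≤ d := le_trans (Nat.cast_nonneg _) (hAle 1 le_rfl hk)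
  let D : ChainHyp.ChainData G k d :=
    { base := base
      c := c
      S := fun j => {v | v ∈ (A j).support}
      al := fun j => al j
      idx := idx
      idx_le := hidx1
      idx_mem := hidx2
      sep := by
        intro i j i' v hij hji hi'k hv hv'
        rw [(hc i (by omega)).2.1] at hv
        rw [(hc i' hi'k).2.1] at hv'
        rcases Nat.lt_or_ge (i + 1) i' with h | h
        · have h1 : v ∈ Cs i ∩ Cs i' := ⟨hv, hv'⟩
          rw [hfar i i' h hi'k] at h1
          exact absurd h1 (Set.notMem_empty v)
        · obtain rfl : i' = i + 1 := by omega
          obtain rfl : j = i + 1 := by omega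
          rw [← hconsec i hi'k]
          exact ⟨hv, hv'⟩
      S_ne := fun j => ⟨p j, (A j).start_mem_support⟩
      S_right := by
        intro j v h1 h2 hv
        rw [(hc j h2).2.1]
        obtain ⟨i, rfl⟩ : ∃ i, j = i + 1 := ⟨j - 1, by omega⟩
        rw [← hconsec i h2] at hv
        exact hv.2
      S_left := by
        intro j v h hv
        rw [(hc j h.le).2.1]
        rw [← hconsec j h] at hv
        exact hv.1
      S_diam := fun j u v h1 h2 hu hv => hAd j h1 h2 u v hu hv
      mid := by
        intro j x h0 hjk hx u v hu hv
        have hd2j := hd2 j h0 hjk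
        have hm1 := le_max_left (be j : ℝ) (be' j : ℝ)
        have hm2 := le_max_right (be j : ℝ) (be' j : ℝ)
        rcases ((hc j hjk.le).2.2.2.2.2 h0 hjk _).1 hx with h | h | h | h
        · have h1 := ChainHyp.walk_ends hG _ x h
          rw [(hBmid j h0 hjk).2] at h1
          have h2 := hAd j h0 hjk.le u (p j) hu (A j).start_mem_support
          have h3 := hAd (j + 1) (by omega) hjk v (p (j + 1)) hv (A (j + 1)).start_mem_support
          have h4 := ChainHyp.mgVDist_tri hG u (p j) x
          have h5 := ChainHyp.mgVDist_tri hG v (p (j + 1)) x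
          rcases le_total (mgVDist G u x) d with h6 | h6
          · exact Or.inl h6
          · exact Or.inr (by linarith)
        · have h1 := ChainHyp.walk_ends hG _ x h
          rw [(hB'mid j h0 hjk).2] at h1
          have h2 := hAd j h0 hjk.le u (q j) hu (A j).end_mem_support
          have h3 := hAd (j + 1) (by omega) hjk v (q (j + 1)) hv (A (j + 1)).end_mem_support
          have h4 := ChainHyp.mgVDist_tri hG u (q j) x
          have h5 := ChainHyp.mgVDist_tri hG v (q (j + 1)) x
          rcases le_total (mgVDist G u x) d with h6 | h6
          · exact Or.inl h6
          · exact Or.inr (by linarith)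
        · exact Or.inl (hAV j h0 hjk.le x h u hu)
        · exact Or.inr (hAV (j + 1) (by omega) hjk x h v hv)
      al_nonneg := fun j => Nat.cast_nonneg _
      bd1 := by
        intro j hj
        have h1 := hd1 j hj
        have h2 := le_max_left (3 * (al j : ℝ) + (al (j + 1) : ℝ))
          ((al j : ℝ) + 3 * (al (j + 1) : ℝ))
        rw [hlen j hj]
        linarith
      bd2 := by
        intro j hj
        have h1 := hd1 j hj
        have h2 := le_max_right (3 * (al j : ℝ) + (al (j + 1) : ℝ))
          ((al j : ℝ) + 3 * (al (j + 1) : ℝ))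
        rw [hlen j hj]
        linarith }
  exact D.hyp_le hG hd0
end

section
/- For a graph G_{A,B,B'} of the chain-of-cycles family with α_j = 1 for every 1 ≤ j ≤ k, one has δ(G_{A,B,B'}) ≤ max{ 1/2 + L(C_0)/4 , 1/2 + L(C_k)/4 , max_{0 < j < k} (2 + max{β_j, β'_j})/2 }, where L(C_j) = β_j + β'_j + α_j + α_{j+1} is the length of the cycle C_j. -/
open SimpleGraph Set

lemma real_dist_triangle {V : Type} {G : SimpleGraph V} (hG : G.Connected) (u v w : V) :
    (G.dist u w : ℝ) ≤ G.dist u v + G.dist v w := by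
  exact_mod_cast hG.dist_triangle

/-- `w` is an endpoint of the edge carrying `x`, at distance `a` along the edge. -/
def IsEnd {V : Type} {G : SimpleGraph V} (x : MGPoint G) (w : V) (a : ℝ) : Prop :=
  (w = x.1.1 ∧ a = x.1.2.2) ∨ (w = x.1.2.1 ∧ a = 1 - x.1.2.2)

lemma IsEnd.bounds {V : Type} {G : SimpleGraph V} {x : MGPoint G} {w : V} {a : ℝ}
    (h : IsEnd x w a) : 0 ≤ a ∧ a ≤ 1 := by
  obtain ⟨h0, h1⟩ := x.2.2
  rcases h with ⟨_, rfl⟩ | ⟨_, rfl⟩ <;> constructor <;> linarith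

section metric
variable {V : Type} [Fintype V] [DecidableEq V] {G : SimpleGraph V}

lemma vd_le {x : MGPoint G} {w : V} {a : ℝ} (h : IsEnd x w a) (c : V) :
    mgVDist G c x ≤ G.dist c w + a := by
  unfold mgVDist
  rcases h with ⟨rfl, rfl⟩ | ⟨rfl, rfl⟩
  · exact min_le_left _ _
  · exact min_le_right _ _

lemma vd_exists (x : MGPoint G) (c : V) :
    ∃ w a, IsEnd x w a ∧ mgVDist G c x = G.dist c w + a := by
  unfold mgVDist
  rcases min_choice ((G.dist c x.1.1 : ℝ) + x.1.2.2)
    ((G.dist c x.1.2.1 : ℝ) + (1 - x.1.2.2)) with h | h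
  · exact ⟨_, _, Or.inl ⟨rfl, rfl⟩, h⟩
  · exact ⟨_, _, Or.inr ⟨rfl, rfl⟩, h⟩

lemma vd_nonneg (x : MGPoint G) (c : V) : 0 ≤ mgVDist G c x := by
  obtain ⟨w, a, h, e⟩ := vd_exists x c
  rw [e]
  have := h.bounds.1
  positivity

lemma mg_le {x y : MGPoint G} {w w' : V} {a a' : ℝ} (h : IsEnd x w a) (h' : IsEnd y w' a') :
    mgDist G x y ≤ a + G.dist w w' + a' := by
  unfold mgDist mgDistAux
  refine (min_le_right _ _).trans ?_
  rcases h with ⟨rfl, rfl⟩ | ⟨rfl, rfl⟩ <;> rcases h' with ⟨rfl, rfl⟩ | ⟨rfl, rfl⟩ <;> simp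

lemma mg_le_same {x y : MGPoint G} (h1 : x.1.1 = y.1.1) (h2 : x.1.2.1 = y.1.2.1) :
    mgDist G x y ≤ |x.1.2.2 - y.1.2.2| := by
  unfold mgDist mgDistAux
  refine (min_le_left _ _).trans ((min_le_left _ _).trans ?_)
  rw [if_pos ⟨h1, h2⟩]

lemma mg_le_flip {x y : MGPoint G} (h1 : x.1.1 = y.1.2.1) (h2 : x.1.2.1 = y.1.1) :
    mgDist G x y ≤ |x.1.2.2 - (1 - y.1.2.2)| := by
  unfold mgDist mgDistAux
  refine (min_le_left _ _).trans ((min_le_right _ _).trans ?_)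
  rw [if_pos ⟨h1, h2⟩]

lemma mg_cases (hG : G.Connected) (x y : MGPoint G) :
    (∃ w a w' a', IsEnd x w a ∧ IsEnd y w' a' ∧ a + G.dist w w' + a' ≤ mgDist G x y) ∨
    (x.1.1 = y.1.1 ∧ x.1.2.1 = y.1.2.1 ∧ mgDist G x y = |x.1.2.2 - y.1.2.2|) ∨
    (x.1.1 = y.1.2.1 ∧ x.1.2.1 = y.1.1 ∧ mgDist G x y = |x.1.2.2 - (1 - y.1.2.2)|) := by
  have hx1 : IsEnd x x.1.1 x.1.2.2 := Or.inl ⟨rfl, rfl⟩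
  have hx2 : IsEnd x x.1.2.1 (1 - x.1.2.2) := Or.inr ⟨rfl, rfl⟩
  have hy1 : IsEnd y y.1.1 y.1.2.2 := Or.inl ⟨rfl, rfl⟩
  have hy2 : IsEnd y y.1.2.1 (1 - y.1.2.2) := Or.inr ⟨rfl, rfl⟩
  have hcard : x.1.2.2 + G.dist x.1.1 y.1.1 + y.1.2.2 ≤ (Fintype.card V : ℝ) + 1 := by
    have h1 := hx1.bounds.2
    have h2 := hy1.bounds.2
    have h3 : (G.dist x.1.1 y.1.1 : ℝ) + 1 ≤ Fintype.card V := by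
      obtain ⟨P, hP, hl⟩ := hG.exists_path_of_dist x.1.1 y.1.1
      rw [← hl]
      exact_mod_cast hP.length_lt
    linarith
  have key : ∀ a b : ℝ, min a b = a ∨ min a b = b := fun a b => min_choice a b
  by_cases hT : ∃ w a w' a', IsEnd x w a ∧ IsEnd y w' a' ∧ a + G.dist w w' + a' ≤ mgDist G x y
  · exact Or.inl hT
  right
  have hT1 : ∀ w a w' a', IsEnd x w a → IsEnd y w' a' → mgDist G x y < a + G.dist w w' + a' := by
    intro w a w' a' h h'
    by_contra hc
    exact hT ⟨w, a, w', a', h, h', not_lt.mp hc⟩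
  have e1 := hT1 _ _ _ _ hx1 hy1
  have e2 := hT1 _ _ _ _ hx1 hy2
  have e3 := hT1 _ _ _ _ hx2 hy1
  have e4 := hT1 _ _ _ _ hx2 hy2
  have hm : mgDist G x y = mgDistAux G x.1 y.1 := rfl
  unfold mgDistAux at hm
  rcases min_choice (min (if x.1.1 = y.1.1 ∧ x.1.2.1 = y.1.2.1 then |x.1.2.2 - y.1.2.2|
      else (Fintype.card V : ℝ) + 1)
         (if x.1.1 = y.1.2.1 ∧ x.1.2.1 = y.1.1 then |x.1.2.2 - (1 - y.1.2.2)|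
          else (Fintype.card V : ℝ) + 1)) (min (min (x.1.2.2 + (G.dist x.1.1 y.1.1 : ℝ) + y.1.2.2)
              (x.1.2.2 + (G.dist x.1.1 y.1.2.1 : ℝ) + (1 - y.1.2.2)))
         (min ((1 - x.1.2.2) + (G.dist x.1.2.1 y.1.1 : ℝ) + y.1.2.2)
              ((1 - x.1.2.2) + (G.dist x.1.2.1 y.1.2.1 : ℝ) + (1 - y.1.2.2)))) with h | h
  · rw [h] at hm
    rcases key (if x.1.1 = y.1.1 ∧ x.1.2.1 = y.1.2.1 then |x.1.2.2 - y.1.2.2|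
      else (Fintype.card V : ℝ) + 1)
         (if x.1.1 = y.1.2.1 ∧ x.1.2.1 = y.1.1 then |x.1.2.2 - (1 - y.1.2.2)|
          else (Fintype.card V : ℝ) + 1) with h' | h'
    · rw [h'] at hm
      split_ifs at hm with hc
      · exact Or.inl ⟨hc.1, hc.2, hm⟩
      · linarith
    · rw [h'] at hm
      split_ifs at hm with hc
      · exact Or.inr ⟨hc.1, hc.2, hm⟩
      · linarith
  · rw [h] at hm
    exfalso
    have : mgDist G x y < mgDist G x y := by
      conv_rhs => rw [hm]
      exact lt_min (lt_min e1 e2) (lt_min e3 e4)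
    exact lt_irrefl _ this

lemma mg_symm (x y : MGPoint G) : mgDist G x y = mgDist G y x := by
  have h1 : ∀ a b : ℝ, |a - (1 - b)| = |b - (1 - a)| := by
    intro a b; congr 1; ring
  unfold mgDist mgDistAux
  rw [abs_sub_comm x.1.2.2 y.1.2.2, h1 x.1.2.2 y.1.2.2]
  simp only [G.dist_comm (u := x.1.1), G.dist_comm (u := x.1.2.1)]
  congr 1
  · congr 1
    · simp only [eq_comm]
    · congr 1
      simp only [eq_comm, eq_iff_iff]
      tauto
  · rw [min_min_min_comm]
    congr 1 <;> congr 1 <;> ring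

/-- Distance is bounded through a vertex. -/
lemma mg_le_vd (hG : G.Connected) (x y : MGPoint G) (c : V) :
    mgDist G x y ≤ mgVDist G c x + mgVDist G c y := by
  obtain ⟨w, a, h, e⟩ := vd_exists x c
  obtain ⟨w', a', h', e'⟩ := vd_exists y c
  have := mg_le h h'
  have t := real_dist_triangle hG w c w'
  rw [G.dist_comm (u := w) (v := c)] at t
  linarith

lemma dist_le_vd (hG : G.Connected) (x : MGPoint G) (c c' : V) :
    (G.dist c c' : ℝ) ≤ mgVDist G c x + mgVDist G c' x := by
  obtain ⟨w, a, h, e⟩ := vd_exists x c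
  obtain ⟨w', a', h', e'⟩ := vd_exists x c'
  have t := real_dist_triangle hG c w c'
  have t2 := real_dist_triangle hG w w' c'
  rw [G.dist_comm (u := w') (v := c')] at t2
  have hadj : (G.dist x.1.1 x.1.2.1 : ℝ) = 1 := by
    exact_mod_cast SimpleGraph.dist_eq_one_iff_adj.mpr x.2.1
  have b := h.bounds
  have b' := h'.bounds
  have : (G.dist w w' : ℝ) ≤ a + a' := by
    rcases h with ⟨rfl, rfl⟩ | ⟨rfl, rfl⟩ <;> rcases h' with ⟨rfl, rfl⟩ | ⟨rfl, rfl⟩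
    · simp; linarith
    · linarith
    · rw [G.dist_comm]; linarith
    · simp; linarith
  linarith

lemma vd_le_dist (hG : G.Connected) (x : MGPoint G) (c c' : V) :
    mgVDist G c x ≤ G.dist c c' + mgVDist G c' x := by
  obtain ⟨w', a', h', e'⟩ := vd_exists x c'
  have := vd_le h' c
  have t := real_dist_triangle hG c c' w'
  linarith

lemma vd_of_end {x : MGPoint G} {w : V} {a : ℝ} (h : IsEnd x w a) : mgVDist G w x ≤ a := by
  have := vd_le h w
  simpa using this

/-- Dichotomy: distances are through a vertex or along a common edge. -/
lemma mg_cases' (hG : G.Connected) (x y : MGPoint G) :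
    (∃ c, mgVDist G c x + mgVDist G c y ≤ mgDist G x y) ∨
    (x.1.1 = y.1.1 ∧ x.1.2.1 = y.1.2.1 ∧ mgDist G x y = |x.1.2.2 - y.1.2.2|) ∨
    (x.1.1 = y.1.2.1 ∧ x.1.2.1 = y.1.1 ∧ mgDist G x y = |x.1.2.2 - (1 - y.1.2.2)|) := by
  rcases mg_cases hG x y with ⟨w, a, w', a', h, h', e⟩ | h
  · left
    refine ⟨w, ?_⟩
    have h1 := vd_of_end h
    have h2 := vd_le h' w
    linarith
  · exact Or.inr h

lemma mg_nonneg (hG : G.Connected) (x y : MGPoint G) : 0 ≤ mgDist G x y := by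
  rcases mg_cases' hG x y with ⟨c, h⟩ | ⟨_, _, h⟩ | ⟨_, _, h⟩
  · linarith [vd_nonneg x c, vd_nonneg y c]
  · rw [h]; exact abs_nonneg _
  · rw [h]; exact abs_nonneg _

lemma vd_lip (hG : G.Connected) (x y : MGPoint G) (c : V) :
    mgVDist G c x ≤ mgVDist G c y + mgDist G x y := by
  rcases mg_cases' hG x y with ⟨w, h⟩ | ⟨h1, h2, h⟩ | ⟨h1, h2, h⟩
  · have := vd_le_dist hG x c w
    have := dist_le_vd hG y c w
    linarith
  · rw [h]
    have l1 := le_abs_self (x.1.2.2 - y.1.2.2)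
    have l2 := neg_abs_le (x.1.2.2 - y.1.2.2)
    have e1 := vd_le (x := x) (Or.inl ⟨rfl, rfl⟩) c
    have e2 := vd_le (x := x) (Or.inr ⟨rfl, rfl⟩) c
    rw [h1] at e1
    rw [h2] at e2
    obtain ⟨w, a, hw, e⟩ := vd_exists y c
    rcases hw with ⟨rfl, rfl⟩ | ⟨rfl, rfl⟩ <;> linarith
  · rw [h]
    have l1 := le_abs_self (x.1.2.2 - (1 - y.1.2.2))
    have l2 := neg_abs_le (x.1.2.2 - (1 - y.1.2.2))
    have e1 := vd_le (x := x) (Or.inl ⟨rfl, rfl⟩) c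
    have e2 := vd_le (x := x) (Or.inr ⟨rfl, rfl⟩) c
    rw [h1] at e1
    rw [h2] at e2
    obtain ⟨w, a, hw, e⟩ := vd_exists y c
    rcases hw with ⟨rfl, rfl⟩ | ⟨rfl, rfl⟩ <;> linarith

lemma mg_triangle (hG : G.Connected) (x y z : MGPoint G) :
    mgDist G x z ≤ mgDist G x y + mgDist G y z := by
  rcases mg_cases' hG x y with ⟨c, h⟩ | h
  · have := mg_le_vd hG x z c
    have := vd_lip hG z y c
    rw [mg_symm z y] at this
    linarith
  rcases mg_cases' hG y z with ⟨c, h'⟩ | h'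
  · have := mg_le_vd hG x z c
    have := vd_lip hG x y c
    linarith
  rcases h with ⟨h1, h2, h⟩ | ⟨h1, h2, h⟩ <;> rcases h' with ⟨h1', h2', h'⟩ | ⟨h1', h2', h'⟩ <;>
    rw [h, h']
  · refine (mg_le_same (h1.trans h1') (h2.trans h2')).trans (abs_sub_le _ _ _)
  · refine (mg_le_flip (h1.trans h1') (h2.trans h2')).trans (abs_sub_le _ _ _)
  · refine (mg_le_flip (h1.trans h2') (h2.trans h1')).trans ((abs_sub_le _ (1 - y.1.2.2) _).trans ?_)
    gcongr 1
    rw [abs_sub_comm]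
    apply le_of_eq
    congr 1
    ring
  · refine (mg_le_same (h1.trans h2') (h2.trans h1')).trans
      ((abs_sub_le _ (1 - y.1.2.2) _).trans ?_)
    gcongr 1
    rw [abs_sub_comm]
    apply le_of_eq
    congr 1
    ring

end metric

/-- `p q` is an edge separating the vertex sets `L` and `R`. -/
structure SepEdge {V : Type} (G : SimpleGraph V) (L R : Set V) (p q : V) : Prop where
  edge : ∀ u v, G.Adj u v → (u ∈ L ∧ v ∈ L) ∨ (u ∈ R ∧ v ∈ R)
  inter : ∀ v, v ∈ L → v ∈ R → v = p ∨ v = q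
  adj : G.Adj p q

lemma SepEdge.symm {V : Type} {G : SimpleGraph V} {L R : Set V} {p q : V}
    (h : SepEdge G L R p q) : SepEdge G R L p q :=
  ⟨fun u v huv => (h.edge u v huv).symm, fun v h1 h2 => h.inter v h2 h1, h.adj⟩

/-- Both endpoints of the edge carrying `x` are in `R`. -/
def BothIn {V : Type} {G : SimpleGraph V} (R : Set V) (x : MGPoint G) : Prop :=
  x.1.1 ∈ R ∧ x.1.2.1 ∈ R

/-- The edge carrying `x`. -/
def ptEdge {V : Type} {G : SimpleGraph V} (x : MGPoint G) : Sym2 V := s(x.1.1, x.1.2.1)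

section sep
variable {V : Type} [Fintype V] [DecidableEq V] {G : SimpleGraph V}

lemma SepEdge.walk_cross (hG : G.Connected) {L R : Set V} {p q : V} (h : SepEdge G L R p q)
    {u v : V} (w : G.Walk u v) (hv : v ∈ R) (hu : u ∈ L) :
    ∃ c, (c = p ∨ c = q) ∧ G.dist u c + G.dist c v ≤ w.length := by
  induction w with
  | nil => exact ⟨_, h.inter _ hu hv, by simp⟩
  | @cons u u' v huu w ih =>
    by_cases hR : u ∈ R
    · refine ⟨u, h.inter _ hu hR, ?_⟩
      have := G.dist_le (Walk.cons huu w)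
      simpa using this
    · have hu' : u' ∈ L := by
        rcases h.edge u u' huu with h1 | h1
        · exact h1.2
        · exact absurd h1.1 hR
      obtain ⟨c, hc, hd⟩ := ih hv hu'
      refine ⟨c, hc, ?_⟩
      have h1 : G.dist u c ≤ G.dist u u' + G.dist u' c := hG.dist_triangle
      rw [SimpleGraph.dist_eq_one_iff_adj.mpr huu] at h1
      simp only [Walk.length_cons]
      omega

lemma SepEdge.dist_cross (hG : G.Connected) {L R : Set V} {p q : V} (h : SepEdge G L R p q)
    {u v : V} (hu : u ∈ L) (hv : v ∈ R) :
    ∃ c, (c = p ∨ c = q) ∧ (G.dist u c : ℝ) + G.dist c v ≤ G.dist u v := by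
  obtain ⟨w, hw⟩ := hG.exists_walk_length_eq_dist u v
  obtain ⟨c, hc, hd⟩ := h.walk_cross hG w hv hu
  refine ⟨c, hc, ?_⟩
  rw [hw] at hd
  exact_mod_cast hd

lemma SepEdge.bothIn_left {L R : Set V} {p q : V} (h : SepEdge G L R p q) {x : MGPoint G}
    (hx : ¬ BothIn R x) : BothIn L x := by
  rcases h.edge _ _ x.2.1 with h1 | h1
  · exact h1
  · exact absurd h1 hx

lemma SepEdge.pt_cross (hG : G.Connected) {L R : Set V} {p q : V} (h : SepEdge G L R p q)
    {x y : MGPoint G} (hx : ¬ BothIn R x) (hy : BothIn R y) :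
    ∃ c, (c = p ∨ c = q) ∧ mgVDist G c x + mgVDist G c y ≤ mgDist G x y := by
  have hL := h.bothIn_left hx
  rcases mg_cases hG x y with ⟨w, a, w', a', hw, hw', e⟩ | ⟨h1, h2, _⟩ | ⟨h1, h2, _⟩
  · have hwL : w ∈ L := by
      rcases hw with ⟨rfl, _⟩ | ⟨rfl, _⟩
      · exact hL.1
      · exact hL.2
    have hwR : w' ∈ R := by
      rcases hw' with ⟨rfl, _⟩ | ⟨rfl, _⟩
      · exact hy.1
      · exact hy.2
    obtain ⟨c, hc, hd⟩ := h.dist_cross hG hwL hwR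
    refine ⟨c, hc, ?_⟩
    have e1 := vd_le hw c
    have e2 := vd_le hw' c
    rw [G.dist_comm (u := w) (v := c)] at hd
    linarith
  · refine absurd ?_ hx
    exact ⟨h1 ▸ hy.1, h2 ▸ hy.2⟩
  · refine absurd ?_ hx
    exact ⟨h1 ▸ hy.2, h2 ▸ hy.1⟩

lemma SepEdge.pt_cross' (hG : G.Connected) {L R : Set V} {p q : V} (h : SepEdge G L R p q)
    {x y : MGPoint G} (hxy : ¬ (BothIn R x ↔ BothIn R y)) :
    ∃ c, (c = p ∨ c = q) ∧ mgVDist G c x + mgVDist G c y ≤ mgDist G x y := by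
  by_cases hx : BothIn R x
  · have hy : ¬ BothIn R y := fun hy => hxy ⟨fun _ => hy, fun _ => hx⟩
    obtain ⟨c, hc, hd⟩ := h.pt_cross hG hy hx
    refine ⟨c, hc, ?_⟩
    rw [mg_symm] at hd
    linarith
  · have hy : BothIn R y := by
      by_contra hy
      exact hxy ⟨fun h => absurd h hx, fun h => absurd h hy⟩
    exact h.pt_cross hG hx hy

/-- A geodesic whose endpoints are on different sides of a separating edge meets one of
the two endpoints of the edge. -/
lemma SepEdge.geod_cross (hG : G.Connected) {L R : Set V} {p q : V} (h : SepEdge G L R p q)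
    {a b : ℝ} {γ : ℝ → MGPoint G} (hγ : IsMGGeodesic G a b γ) {y0 y1 : MGPoint G}
    (h0 : mgDist G y0 (γ a) = 0) (h1 : mgDist G y1 (γ b) = 0)
    (hne : ¬ (BothIn R y0 ↔ BothIn R y1)) :
    ∃ m ∈ Set.Icc a b, ∃ c, (c = p ∨ c = q) ∧ mgVDist G c (γ m) = 0 := by
  obtain ⟨hab, hd⟩ := hγ
  set f : ℝ → ℝ := fun m => min (mgVDist G p (γ m)) (mgVDist G q (γ m)) with hf
  by_contra hcon
  have hpos : ∀ m ∈ Set.Icc a b, 0 < f m := by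
    intro m hm
    have hp := vd_nonneg (γ m) p
    have hq := vd_nonneg (γ m) q
    refine lt_min (lt_of_le_of_ne hp fun he => ?_) (lt_of_le_of_ne hq fun he => ?_)
    · exact hcon ⟨m, hm, p, Or.inl rfl, he.symm⟩
    · exact hcon ⟨m, hm, q, Or.inr rfl, he.symm⟩
  have hle : ∀ m c, (c = p ∨ c = q) → f m ≤ mgVDist G c (γ m) := by
    rintro m c (rfl | rfl)
    · exact min_le_left _ _
    · exact min_le_right _ _
  have hlip : ∀ s ∈ Set.Icc a b, ∀ t ∈ Set.Icc a b, f s ≤ f t + |s - t| := by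
    intro s hs t ht
    have e := hd s hs t ht
    have l1 := vd_lip hG (γ s) (γ t) p
    have l2 := vd_lip hG (γ s) (γ t) q
    rw [e] at l1 l2
    have k1 := hle s p (Or.inl rfl)
    have k2 := hle s q (Or.inr rfl)
    have : f t = mgVDist G p (γ t) ∨ f t = mgVDist G q (γ t) := min_choice _ _
    rcases this with h | h <;> rw [h] <;> linarith
  have hcont : ContinuousOn f (Set.Icc a b) := by
    have : LipschitzOnWith 1 f (Set.Icc a b) := by
      refine LipschitzOnWith.of_dist_le_mul fun s hs t ht => ?_
      rw [Real.dist_eq, Real.dist_eq]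
      have l1 := hlip s hs t ht
      have l2 := hlip t ht s hs
      rw [abs_sub_comm t s] at l2
      simp only [NNReal.coe_one, one_mul]
      exact abs_sub_le_iff.mpr ⟨by linarith, by linarith⟩
    exact this.continuousOn
  obtain ⟨m0, hm0, hmin⟩ := isCompact_Icc.exists_isMinOn
    (⟨a, le_refl a, hab⟩ : (Set.Icc a b).Nonempty) hcont
  have hε := hpos m0 hm0
  set ε := f m0 with hεdef
  have hεle : ∀ m ∈ Set.Icc a b, ε ≤ f m := fun m hm => hmin hm
  have hloc : ∀ s ∈ Set.Icc a b, ∀ t ∈ Set.Icc a b, |s - t| < ε →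
      (BothIn R (γ s) ↔ BothIn R (γ t)) := by
    intro s hs t ht hst
    by_contra hc
    obtain ⟨c, hc, hcd⟩ := h.pt_cross' hG hc
    rw [hd s hs t ht] at hcd
    have := hle s c hc
    have := hεle s hs
    have := vd_nonneg (γ t) c
    linarith
  have ha : a ∈ Set.Icc a b := ⟨le_refl _, hab⟩
  have hb : b ∈ Set.Icc a b := ⟨hab, le_refl _⟩
  have hend0 : BothIn R y0 ↔ BothIn R (γ a) := by
    by_contra hc
    obtain ⟨c, hc, hcd⟩ := h.pt_cross' hG hc
    have := hle a c hc
    have := hpos a ha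
    have := vd_nonneg y0 c
    linarith
  have hend1 : BothIn R y1 ↔ BothIn R (γ b) := by
    by_contra hc
    obtain ⟨c, hc, hcd⟩ := h.pt_cross' hG hc
    have := hle b c hc
    have := hpos b hb
    have := vd_nonneg y1 c
    linarith
  obtain ⟨n, hn⟩ := exists_nat_gt ((b - a) / ε)
  have hn0 : (0 : ℝ) < n := lt_of_le_of_lt (div_nonneg (by linarith) hε.le) hn
  have hstep : (b - a) / n < ε := by
    rw [div_lt_iff₀ hn0]
    rw [div_lt_iff₀ hε] at hn
    linarith
  have hst0 : 0 ≤ (b - a) / n := div_nonneg (by linarith) hn0.le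
  have hind : ∀ i : ℕ, i ≤ n → (BothIn R (γ a) ↔ BothIn R (γ (a + i * ((b - a) / n)))) := by
    have hmem : ∀ i : ℕ, i ≤ n → a + i * ((b - a) / n) ∈ Set.Icc a b := by
      intro i hi
      have hi' : (i : ℝ) ≤ n := by exact_mod_cast hi
      have e : (n : ℝ) * ((b - a) / n) = b - a := by field_simp
      have : (i : ℝ) * ((b - a) / n) ≤ n * ((b - a) / n) := by gcongr
      have : 0 ≤ (i : ℝ) * ((b - a) / n) := by positivity
      constructor <;> linarith
    intro i
    induction i with
    | zero => intro _; simp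
    | succ i ih =>
      intro hi
      refine (ih (by omega)).trans (hloc _ (hmem i (by omega)) _ (hmem (i + 1) hi) ?_)
      have : (a + (i : ℝ) * ((b - a) / n)) - (a + ((i + 1 : ℕ) : ℝ) * ((b - a) / n))
          = - ((b - a) / n) := by push_cast; ring
      rw [this, abs_neg, abs_of_nonneg hst0]
      exact hstep
  have hfin := hind n le_rfl
  have e : a + (n : ℝ) * ((b - a) / n) = b := by field_simp; ring
  rw [e] at hfin
  exact hne (hend0.trans (hfin.trans hend1.symm))

/-- The set `S` behaves like a curve joining `y0` to `y1`. -/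
structure PathLike (G : SimpleGraph V) (S : Set (MGPoint G)) (y0 y1 : MGPoint G) : Prop where
  left : ∃ e ∈ S, mgDist G y0 e = 0
  right : ∃ e ∈ S, mgDist G y1 e = 0
  cross : ∀ (L R : Set V) (p q : V), SepEdge G L R p q → ¬ (BothIn R y0 ↔ BothIn R y1) →
    ∃ e ∈ S, ∃ c, (c = p ∨ c = q) ∧ mgVDist G c e = 0

lemma PathLike.symm {S : Set (MGPoint G)} {y0 y1 : MGPoint G} (h : PathLike G S y0 y1) :
    PathLike G S y1 y0 :=
  ⟨h.right, h.left, fun L R p q hs hn => h.cross L R p q hs fun h => hn h.symm⟩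

lemma mg_self (hG : G.Connected) (x : MGPoint G) : mgDist G x x = 0 := by
  refine le_antisymm ?_ (mg_nonneg hG _ _)
  have := mg_le_same (x := x) (y := x) rfl rfl
  simpa using this

lemma pathLike_two (hG : G.Connected) {a b a' b' : ℝ} {g g' : ℝ → MGPoint G}
    (hg : IsMGGeodesic G a b g) (hg' : IsMGGeodesic G a' b' g') {y0 y1 : MGPoint G}
    (h1 : mgDist G y0 (g a) = 0) (h2 : mgDist G (g b) (g' a') = 0)
    (h3 : mgDist G y1 (g' b') = 0) :
    PathLike G (g '' Set.Icc a b ∪ g' '' Set.Icc a' b') y0 y1 := by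
  refine ⟨⟨_, Or.inl ⟨a, ⟨le_rfl, hg.1⟩, rfl⟩, h1⟩, ⟨_, Or.inr ⟨b', ⟨hg'.1, le_rfl⟩, rfl⟩, h3⟩, ?_⟩
  intro L R p q hs hne
  by_cases hz : BothIn R y0 ↔ BothIn R (g b)
  · have hz' : ¬ (BothIn R (g b) ↔ BothIn R y1) := fun h => hne (hz.trans h)
    obtain ⟨m, hm, c, hc⟩ := hs.geod_cross hG hg' h2 h3 hz'
    exact ⟨_, Or.inr ⟨m, hm, rfl⟩, c, hc⟩
  · obtain ⟨m, hm, c, hc⟩ := hs.geod_cross hG hg h1 (mg_self hG _) hz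
    exact ⟨_, Or.inl ⟨m, hm, rfl⟩, c, hc⟩

lemma IsMGGeodesic.reverse {a b : ℝ} {γ : ℝ → MGPoint G} (h : IsMGGeodesic G a b γ) :
    IsMGGeodesic G a b (fun t => γ (a + b - t)) := by
  refine ⟨h.1, fun s hs t ht => ?_⟩
  rw [h.2 (a + b - s) ⟨by linarith [hs.2], by linarith [hs.1]⟩ (a + b - t)
    ⟨by linarith [ht.2], by linarith [ht.1]⟩]
  rw [abs_sub_comm]
  congr 1
  ring

lemma IsMGGeodesic.sub {a b a' b' : ℝ} {γ : ℝ → MGPoint G} (h : IsMGGeodesic G a b γ)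
    (h1 : a ≤ a') (h2 : b' ≤ b) (h3 : a' ≤ b') : IsMGGeodesic G a' b' γ :=
  ⟨h3, fun s hs t ht => h.2 s ⟨h1.trans hs.1, hs.2.trans h2⟩ t ⟨h1.trans ht.1, ht.2.trans h2⟩⟩

lemma dist_le_one_of {p q c c' : V} (h : G.Adj p q) (hc : c = p ∨ c = q)
    (hc' : c' = p ∨ c' = q) : (G.dist c c' : ℝ) ≤ 1 := by
  have e : (G.dist p q : ℝ) = 1 := by
    exact_mod_cast SimpleGraph.dist_eq_one_iff_adj.mpr h
  rcases hc with rfl | rfl <;> rcases hc' with rfl | rfl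
  · simp
  · exact e.le
  · rw [G.dist_comm]; exact e.le
  · simp

/-- One endpoint of the side is behind a separating edge. -/
lemma near_one_out (hG : G.Connected) {L R : Set V} {p q : V} (h : SepEdge G L R p q)
    {a b s d : ℝ} {γ : ℝ → MGPoint G} (hγ : IsMGGeodesic G a b γ) (hs : s ∈ Set.Icc a b)
    {x : MGPoint G} (hx : mgDist G x (γ s) = 0) (ha : ¬ BothIn R (γ a)) (hxR : BothIn R x)
    (hb : BothIn R (γ b)) (hp : mgVDist G p (γ b) + 1 ≤ 2 * d)
    (hq : mgVDist G q (γ b) + 1 ≤ 2 * d) {S : Set (MGPoint G)}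
    (hS : PathLike G S (γ a) (γ b)) : ∃ e ∈ S, mgDist G (γ s) e ≤ d := by
  obtain ⟨m, hm, c, hc, hcm⟩ := h.geod_cross hG (hγ.sub le_rfl hs.2 hs.1) (mg_self hG (γ a)) hx
    (fun h => ha (h.mpr hxR))
  obtain ⟨e, he, c', hc', hce⟩ := hS.cross L R p q h (fun h => ha (h.mpr hb))
  obtain ⟨eb, heb, hbe⟩ := hS.right
  have hmab : m ∈ Set.Icc a b := ⟨hm.1, hm.2.trans hs.2⟩
  have hbab : b ∈ Set.Icc a b := ⟨hγ.1, le_rfl⟩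
  have hcb : mgVDist G c (γ b) + 1 ≤ 2 * d := by
    rcases hc with rfl | rfl
    · exact hp
    · exact hq
  have e1 := hγ.2 m hmab b hbab
  rw [abs_sub_comm, abs_of_nonneg (by linarith [hmab.2])] at e1
  have e2 := mg_le_vd hG (γ m) (γ b) c
  have e3 := hγ.2 s hs m hmab
  rw [abs_of_nonneg (by linarith [hm.2])] at e3
  have e4 := vd_lip hG (γ s) (γ m) c
  have e5 := vd_le_dist hG e c c'
  have e6 := dist_le_one_of h.adj hc hc'
  have e7 := mg_le_vd hG (γ s) e c
  have e8 := hγ.2 s hs b hbab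
  rw [abs_sub_comm, abs_of_nonneg (by linarith [hs.2])] at e8
  have e9 := mg_triangle hG (γ s) (γ b) eb
  by_cases hcase : mgDist G (γ s) e ≤ d
  · exact ⟨e, he, hcase⟩
  · refine ⟨eb, heb, ?_⟩
    linarith

lemma on_edge (hG : G.Connected) {p q : V} (h : G.Adj p q) {x : MGPoint G}
    (hx : mgVDist G p x + mgVDist G q x ≤ 1) :
    ∃ x' : MGPoint G, mgDist G x' x = 0 ∧ ptEdge x' = s(p, q) := by
  obtain ⟨w, a, hw, e⟩ := vd_exists x p
  obtain ⟨w', a', hw', e'⟩ := vd_exists x q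
  have hpq : (G.dist p q : ℝ) = 1 := by
    exact_mod_cast SimpleGraph.dist_eq_one_iff_adj.mpr h
  let P : MGPoint G := ⟨(p, q, 0), h, by simp⟩
  let Q : MGPoint G := ⟨(q, p, 0), h.symm, by simp⟩
  have b := hw.bounds
  have b' := hw'.bounds
  have hvert : w = w' → a = a' → ∃ x' : MGPoint G, mgDist G x' x = 0 ∧ ptEdge x' = s(p, q) := by
    rintro rfl rfl
    have t := real_dist_triangle hG p w q
    rw [G.dist_comm (u := w) (v := q)] at t
    have ha : a = 0 := by linarith
    have hs : (G.dist p w : ℝ) + G.dist q w = 1 := by linarith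
    have hs' : G.dist p w + G.dist q w = 1 := by exact_mod_cast hs
    have hcases : G.dist p w = 0 ∨ G.dist q w = 0 := by omega
    rcases hcases with h0 | h0
    · have hpw : p = w := (hG.dist_eq_zero_iff).mp h0
      refine ⟨P, le_antisymm ?_ (mg_nonneg hG _ _), rfl⟩
      have := mg_le (x := P) (y := x) (Or.inl ⟨rfl, rfl⟩) hw
      have e0 : (G.dist P.1.1 w : ℝ) = 0 := by exact_mod_cast h0
      have e1 : P.1.2.2 = 0 := rfl
      linarith
    · refine ⟨Q, le_antisymm ?_ (mg_nonneg hG _ _), Sym2.eq_swap⟩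
      have := mg_le (x := Q) (y := x) (Or.inl ⟨rfl, rfl⟩) hw
      have e0 : (G.dist Q.1.1 w : ℝ) = 0 := by exact_mod_cast h0
      have e1 : Q.1.2.2 = 0 := rfl
      linarith
  have hedge : a + a' = 1 → p = w ∧ q = w' := by
    intro haa
    have h1 : (G.dist p w : ℝ) + G.dist q w' ≤ 0 := by linarith
    have h2 : G.dist p w + G.dist q w' = 0 := by
      have : G.dist p w + G.dist q w' ≤ 0 := by exact_mod_cast h1
      omega
    exact ⟨(hG.dist_eq_zero_iff).mp (by omega), (hG.dist_eq_zero_iff).mp (by omega)⟩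
  rcases hw with ⟨r1, r2⟩ | ⟨r1, r2⟩ <;> rcases hw' with ⟨r1', r2'⟩ | ⟨r1', r2'⟩
  · exact hvert (r1.trans r1'.symm) (r2.trans r2'.symm)
  · obtain ⟨h1, h2⟩ := hedge (by rw [r2, r2']; ring)
    exact ⟨x, mg_self hG x, by rw [ptEdge, h1, h2, r1, r1']⟩
  · obtain ⟨h1, h2⟩ := hedge (by rw [r2, r2']; ring)
    exact ⟨x, mg_self hG x, by rw [ptEdge, h1, h2, r1, r1']; exact Sym2.eq_swap⟩
  · exact hvert (r1.trans r1'.symm) (r2.trans r2'.symm)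

lemma both_out (hG : G.Connected) {L R : Set V} {p q : V} (h : SepEdge G L R p q)
    {a b s : ℝ} {γ : ℝ → MGPoint G} (hγ : IsMGGeodesic G a b γ) (hs : s ∈ Set.Icc a b)
    {x : MGPoint G} (hx : mgDist G x (γ s) = 0) (ha : ¬ BothIn R (γ a)) (hxR : BothIn R x)
    (hb : ¬ BothIn R (γ b)) :
    ∃ x' : MGPoint G, mgDist G x' (γ s) = 0 ∧ ptEdge x' = s(p, q) := by
  obtain ⟨m, hm, c, hc, hcm⟩ := h.geod_cross hG (hγ.sub le_rfl hs.2 hs.1) (mg_self hG (γ a)) hx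
    (fun h => ha (h.mpr hxR))
  obtain ⟨m', hm', c', hc', hcm'⟩ := h.geod_cross hG (hγ.sub hs.1 le_rfl hs.2) hx
    (mg_self hG (γ b)) (fun h => hb (h.mp hxR))
  have hmab : m ∈ Set.Icc a b := ⟨hm.1, hm.2.trans hs.2⟩
  have hmab' : m' ∈ Set.Icc a b := ⟨hs.1.trans hm'.1, hm'.2⟩
  have e1 := hγ.2 s hs m hmab
  rw [abs_of_nonneg (by linarith [hm.2])] at e1
  have e2 := hγ.2 s hs m' hmab'
  rw [abs_sub_comm, abs_of_nonneg (by linarith [hm'.1])] at e2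
  have e3 := hγ.2 m' hmab' m hmab
  rw [abs_of_nonneg (by linarith [hm.2, hm'.1])] at e3
  have l1 := vd_lip hG (γ s) (γ m) c
  have l2 := vd_lip hG (γ s) (γ m') c'
  have l3 := mg_le_vd hG (γ m') (γ m) c
  have l4 := vd_le_dist hG (γ m') c c'
  have l5 := dist_le_one_of h.adj hc hc'
  have hpq : (G.dist p q : ℝ) = 1 := by
    exact_mod_cast SimpleGraph.dist_eq_one_iff_adj.mpr h.adj
  apply on_edge hG h.adj
  have n1 := vd_nonneg (γ s) c
  have n2 := vd_nonneg (γ s) c'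
  rcases hc with rfl | rfl <;> rcases hc' with rfl | rfl
  · simp only [SimpleGraph.dist_self, Nat.cast_zero] at l4
    have := vd_le_dist hG (γ s) q c'
    rw [G.dist_comm] at this
    linarith
  · linarith
  · linarith
  · simp only [SimpleGraph.dist_self, Nat.cast_zero] at l4
    have := vd_le_dist hG (γ s) p c'
    linarith

/-- Abstract chain of pieces glued along edges. -/
structure ChainData (G : SimpleGraph V) (k : ℕ) (p q : ℕ → V) (E : ℕ → Set (Sym2 V))
    (VL VR : ℕ → Set V) (d : ℝ) : Prop where
  cover : ∀ x : MGPoint G, ∃ j ≤ k, ptEdge x ∈ E j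
  sep : ∀ j, 1 ≤ j → j ≤ k → SepEdge G (VL j) (VR j) (p j) (q j)
  memL : ∀ i j, i < j → j ≤ k → ∀ x : MGPoint G, ptEdge x ∈ E i → BothIn (VL j) x
  memR : ∀ i j, 1 ≤ j → j ≤ i → i ≤ k → ∀ x : MGPoint G, ptEdge x ∈ E i → BothIn (VR j) x
  A1 : ∀ j, 1 ≤ j → j ≤ k → s(p j, q j) ∈ E j
  A2 : ∀ j, j < k → s(p (j + 1), q (j + 1)) ∈ E j
  diam : ∀ j ≤ k, ∀ x y : MGPoint G, ptEdge x ∈ E j → ptEdge y ∈ E j →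
    mgDist G x y + 1 ≤ 2 * d
  mid : ∀ j, 0 < j → j < k → ∀ x : MGPoint G, ptEdge x ∈ E j →
    ∃ c, ((c = p j ∨ c = q j) ∨ (c = p (j + 1) ∨ c = q (j + 1))) ∧ mgVDist G c x + 1 ≤ d

variable {k : ℕ} {p q : ℕ → V} {E : ℕ → Set (Sym2 V)} {VL VR : ℕ → Set V} {d : ℝ}

lemma SepEdge.edge_eq {L R : Set V} {p q : V} (h : SepEdge G L R p q) {y : MGPoint G}
    (hL : BothIn L y) (hR : BothIn R y) : ptEdge y = s(p, q) := by
  have hne : y.1.1 ≠ y.1.2.1 := y.2.1.ne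
  unfold ptEdge
  rcases h.inter _ hL.1 hR.1 with h1 | h1 <;> rcases h.inter _ hL.2 hR.2 with h2 | h2
  · exact absurd (h1.trans h2.symm) hne
  · rw [h1, h2]
  · rw [h1, h2]; exact Sym2.eq_swap
  · exact absurd (h1.trans h2.symm) hne

lemma ChainData.out_left (C : ChainData G k p q E VL VR d) {i j : ℕ} (hij : i < j) (hj : j ≤ k)
    {y : MGPoint G} (hy : ptEdge y ∈ E i) (hyj : ptEdge y ∉ E j) : ¬ BothIn (VR j) y := by
  intro hR
  apply hyj
  rw [(C.sep j (by omega) hj).edge_eq (C.memL i j hij hj y hy) hR]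
  exact C.A1 j (by omega) hj

lemma ChainData.out_right (C : ChainData G k p q E VL VR d) {i j : ℕ} (hij : j < i) (hi : i ≤ k)
    {y : MGPoint G} (hy : ptEdge y ∈ E i) (hyj : ptEdge y ∉ E j) : ¬ BothIn (VL (j + 1)) y := by
  intro hL
  apply hyj
  rw [(C.sep (j + 1) (by omega) (by omega)).edge_eq hL
    (C.memR i (j + 1) (by omega) (by omega) hi y hy)]
  exact C.A2 j (by omega)

lemma ChainData.out (C : ChainData G k p q E VL VR d) {j : ℕ} (hj : j ≤ k) {y : MGPoint G}
    (hyj : ptEdge y ∉ E j) : ∃ L R c c', SepEdge G L R c c' ∧ ¬ BothIn R y ∧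
      (∀ x : MGPoint G, ptEdge x ∈ E j → BothIn R x) ∧ s(c, c') ∈ E j := by
  obtain ⟨i, hi, hy⟩ := C.cover y
  rcases lt_trichotomy i j with h | h | h
  · exact ⟨_, _, _, _, C.sep j (by omega) hj, C.out_left h hj hy hyj,
      fun x hx => C.memR j j (by omega) le_rfl hj x hx, C.A1 j (by omega) hj⟩
  · exact absurd (h ▸ hy) hyj
  · exact ⟨_, _, _, _, (C.sep (j + 1) (by omega) (by omega)).symm, C.out_right h hi hy hyj,
      fun x hx => C.memL j (j + 1) (by omega) (by omega) x hx, C.A2 j (by omega)⟩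

lemma ChainData.vd_bound (hG : G.Connected) (C : ChainData G k p q E VL VR d) {j : ℕ} (hj : j ≤ k)
    {c c' : V} (hadj : G.Adj c c') (hc : s(c, c') ∈ E j) {y : MGPoint G} (hy : ptEdge y ∈ E j) :
    mgVDist G c y + 1 ≤ 2 * d := by
  let P : MGPoint G := ⟨(c, c', 0), hadj, by simp⟩
  have h1 := C.diam j hj y P hy hc
  have h2 := vd_lip hG y P c
  have h3 := vd_of_end (x := P) (Or.inl ⟨rfl, rfl⟩)
  have h4 : mgVDist G c P ≤ 0 := h3
  linarith

lemma ChainData.one_out (hG : G.Connected) (C : ChainData G k p q E VL VR d) {j : ℕ} (hj : j ≤ k)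
    {a b s : ℝ} {γ : ℝ → MGPoint G} (hγ : IsMGGeodesic G a b γ) (hs : s ∈ Set.Icc a b)
    {x : MGPoint G} (hx : mgDist G x (γ s) = 0) (hxj : ptEdge x ∈ E j)
    (ha : ptEdge (γ a) ∉ E j) (hb : ptEdge (γ b) ∈ E j) {S : Set (MGPoint G)}
    (hS : PathLike G S (γ a) (γ b)) : ∃ e ∈ S, mgDist G (γ s) e ≤ d := by
  obtain ⟨L, R, c, c', hsep, hnot, hin, hc⟩ := C.out hj ha
  refine near_one_out hG hsep hγ hs hx hnot (hin x hxj) (hin _ hb) ?_ ?_ hS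
  · exact C.vd_bound hG hj hsep.adj hc hb
  · exact C.vd_bound hG hj hsep.adj.symm (by rw [Sym2.eq_swap]; exact hc) hb

lemma ChainData.near (hG : G.Connected) (C : ChainData G k p q E VL VR d)
    {a b s : ℝ} {γ : ℝ → MGPoint G} (hγ : IsMGGeodesic G a b γ) (hs : s ∈ Set.Icc a b)
    {S : Set (MGPoint G)} (hS : PathLike G S (γ a) (γ b)) :
    ∃ e ∈ S, mgDist G (γ s) e ≤ d := by
  obtain ⟨ia, hia, hEa⟩ := C.cover (γ a)
  obtain ⟨ib, hib, hEb⟩ := C.cover (γ b)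
  have main : ∀ n j : ℕ, (j - ia) + (ia - j) + (j - ib) + (ib - j) ≤ n → j ≤ k →
      ∀ x : MGPoint G, mgDist G x (γ s) = 0 → ptEdge x ∈ E j →
      ∃ e ∈ S, mgDist G (γ s) e ≤ d := by
    intro n
    induction n with
    | zero =>
      intro j hn hj x hx hxj
      obtain rfl : ia = j := by omega
      obtain rfl : ib = ia := by omega
      have hd := C.diam ib hj _ _ hEa hEb
      have haab : a ∈ Set.Icc a b := ⟨le_rfl, hγ.1⟩
      have hbab : b ∈ Set.Icc a b := ⟨hγ.1, le_rfl⟩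
      obtain ⟨ea, hea, h1⟩ := hS.left
      obtain ⟨eb, heb, h2⟩ := hS.right
      rw [hγ.2 a haab b hbab, abs_sub_comm, abs_of_nonneg (by linarith [hγ.1])] at hd
      have e1 := hγ.2 s hs a haab
      rw [abs_of_nonneg (by linarith [hs.1])] at e1
      have e2 := hγ.2 s hs b hbab
      rw [abs_sub_comm, abs_of_nonneg (by linarith [hs.2])] at e2
      have t1 := mg_triangle hG (γ s) (γ a) ea
      have t2 := mg_triangle hG (γ s) (γ b) eb
      by_cases hc : mgDist G (γ s) ea ≤ d
      · exact ⟨ea, hea, hc⟩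
      · exact ⟨eb, heb, by linarith⟩
    | succ n ih =>
      intro j hn hj x hx hxj
      by_cases haj : ptEdge (γ a) ∈ E j <;> by_cases hbj : ptEdge (γ b) ∈ E j
      · have hd := C.diam j hj _ _ haj hbj
        have haab : a ∈ Set.Icc a b := ⟨le_rfl, hγ.1⟩
        have hbab : b ∈ Set.Icc a b := ⟨hγ.1, le_rfl⟩
        obtain ⟨ea, hea, h1⟩ := hS.left
        obtain ⟨eb, heb, h2⟩ := hS.right
        rw [hγ.2 a haab b hbab, abs_sub_comm, abs_of_nonneg (by linarith [hγ.1])] at hd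
        have e1 := hγ.2 s hs a haab
        rw [abs_of_nonneg (by linarith [hs.1])] at e1
        have e2 := hγ.2 s hs b hbab
        rw [abs_sub_comm, abs_of_nonneg (by linarith [hs.2])] at e2
        have t1 := mg_triangle hG (γ s) (γ a) ea
        have t2 := mg_triangle hG (γ s) (γ b) eb
        by_cases hc : mgDist G (γ s) ea ≤ d
        · exact ⟨ea, hea, hc⟩
        · exact ⟨eb, heb, by linarith⟩
      · have hrev := hγ.reverse
        have ea : a + b - a = b := by ring
        have eb : a + b - b = a := by ring
        have es : a + b - (a + b - s) = s := by ring
        have := C.one_out hG hj hrev (s := a + b - s)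
          ⟨by linarith [hs.2], by linarith [hs.1]⟩ (x := x) (by simpa only [es] using hx) hxj
          (by simpa only [ea] using hbj) (by simpa only [eb] using haj) (S := S)
          (by simpa only [ea, eb] using hS.symm)
        simpa only [es] using this
      · exact C.one_out hG hj hγ hs hx hxj haj hbj hS
      · have hane : ia ≠ j := fun h => haj (h ▸ hEa)
        have hbne : ib ≠ j := fun h => hbj (h ▸ hEb)
        have hmid : 0 < j → j < k →
            ¬ (BothIn (VR j) (γ a) ↔ BothIn (VR j) (γ b)) →
            ¬ (BothIn (VL (j + 1)) (γ a) ↔ BothIn (VL (j + 1)) (γ b)) →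
            ∃ e ∈ S, mgDist G (γ s) e ≤ d := by
          intro h0 h1 hcr1 hcr2
          obtain ⟨c, hc, hcd⟩ := C.mid j h0 h1 x hxj
          have hs1 := C.sep j h0 hj
          have hs2 := C.sep (j + 1) (by omega) (by omega)
          have hl := vd_lip hG (γ s) x c
          rw [mg_symm, hx] at hl
          rcases hc with hc | hc
          · obtain ⟨e, he, c', hc', hz⟩ := hS.cross _ _ _ _ hs1 hcr1
            refine ⟨e, he, ?_⟩
            have l1 := mg_le_vd hG (γ s) e c
            have l2 := vd_le_dist hG e c c'
            have l3 := dist_le_one_of hs1.adj hc hc'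
            linarith
          · obtain ⟨e, he, c', hc', hz⟩ := hS.cross _ _ _ _ hs2.symm hcr2
            refine ⟨e, he, ?_⟩
            have l1 := mg_le_vd hG (γ s) e c
            have l2 := vd_le_dist hG e c c'
            have l3 := dist_le_one_of hs2.adj hc hc'
            linarith
        rcases lt_or_gt_of_ne hane with ha | ha <;> rcases lt_or_gt_of_ne hbne with hb | hb
        · obtain ⟨x', hx', hxe⟩ := both_out hG (C.sep j (by omega) hj) hγ hs hx
            (C.out_left ha hj hEa haj) (C.memR j j (by omega) le_rfl hj x hxj)
            (C.out_left hb hj hEb hbj)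
          obtain ⟨j', rfl⟩ : ∃ j', j = j' + 1 := ⟨j - 1, by omega⟩
          refine ih j' (by omega) (by omega) x' hx' ?_
          rw [hxe]
          exact C.A2 j' (by omega)
        · apply hmid (by omega) (by omega)
          · intro h
            exact C.out_left ha hj hEa haj (h.mpr (C.memR ib j (by omega) hb.le hib _ hEb))
          · intro h
            exact C.out_right hb hib hEb hbj (h.mp (C.memL ia (j + 1) (by omega) (by omega) _ hEa))
        · apply hmid (by omega) (by omega)
          · intro h
            exact C.out_left hb hj hEb hbj (h.mp (C.memR ia j (by omega) ha.le hia _ hEa))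
          · intro h
            exact C.out_right ha hia hEa haj (h.mpr (C.memL ib (j + 1) (by omega) (by omega) _ hEb))
        · obtain ⟨x', hx', hxe⟩ := both_out hG (C.sep (j + 1) (by omega) (by omega)).symm hγ hs hx
            (C.out_right ha hia hEa haj) (C.memL j (j + 1) (by omega) (by omega) x hxj)
            (C.out_right hb hib hEb hbj)
          refine ih (j + 1) (by omega) (by omega) x' hx' ?_
          rw [hxe]
          exact C.A1 (j + 1) (by omega) (by omega)
  obtain ⟨j, hj, hxj⟩ := C.cover (γ s)
  exact main _ j le_rfl hj (γ s) (mg_self hG _) hxj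

lemma ChainData.near_side (hG : G.Connected) (C : ChainData G k p q E VL VR d)
    {a b a' b' a'' b'' : ℝ} {g g' g'' : ℝ → MGPoint G}
    (hg : IsMGGeodesic G a b g) (hg' : IsMGGeodesic G a' b' g') (hg'' : IsMGGeodesic G a'' b'' g'')
    (h1 : mgDist G (g b) (g' a') = 0) (h2 : mgDist G (g' b') (g'' a'') = 0)
    (h3 : mgDist G (g'' b'') (g a) = 0) (s : ℝ) (hs : s ∈ Set.Icc a b) :
    (∃ t ∈ Set.Icc a' b', mgDist G (g s) (g' t) ≤ d) ∨
    (∃ t ∈ Set.Icc a'' b'', mgDist G (g s) (g'' t) ≤ d) := by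
  rw [mg_symm] at h3
  obtain ⟨e, he, hd⟩ := C.near hG hg hs (pathLike_two hG hg' hg'' h1 h2 h3).symm
  rcases he with ⟨t, ht, rfl⟩ | ⟨t, ht, rfl⟩
  · exact Or.inl ⟨t, ht, hd⟩
  · exact Or.inr ⟨t, ht, hd⟩

lemma ChainData.hypDelta_le (hG : G.Connected) (C : ChainData G k p q E VL VR d) (hd : 0 ≤ d) :
    hypDelta G ≤ d := by
  unfold hypDelta
  refine Real.sSup_le ?_ hd
  rintro _ ⟨T, rfl⟩
  unfold triangleDelta
  refine csInf_le ⟨0, fun x hx => hx.1⟩ ⟨hd, ?_, ?_, ?_⟩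
  · exact fun s hs => C.near_side hG T.h1 T.h2 T.h3 T.glue1 T.glue2 T.glue3 s hs
  · exact fun s hs => (C.near_side hG T.h2 T.h3 T.h1 T.glue2 T.glue3 T.glue1 s hs).symm
  · exact fun s hs => C.near_side hG T.h3 T.h1 T.h2 T.glue3 T.glue1 T.glue2 s hs

end sep

section walks
variable {V : Type} [Fintype V] [DecidableEq V] {G : SimpleGraph V}

lemma dist_getVert_le (hG : G.Connected) {u v : V} (W : G.Walk u v) (i n : ℕ) :
    G.dist (W.getVert i) (W.getVert (i + n)) ≤ n := by
  induction n with
  | zero => simp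
  | succ n ih =>
    have h1 : G.dist (W.getVert i) (W.getVert (i + (n + 1))) ≤
      G.dist (W.getVert i) (W.getVert (i + n)) +
        G.dist (W.getVert (i + n)) (W.getVert (i + (n + 1))) := hG.dist_triangle
    have h2 : G.dist (W.getVert (i + n)) (W.getVert (i + (n + 1))) ≤ 1 := by
      by_cases hl : i + n < W.length
      · exact (SimpleGraph.dist_eq_one_iff_adj.mpr (W.adj_getVert_succ hl)).le
      · rw [W.getVert_of_length_le (by omega), W.getVert_of_length_le (by omega)]
        simp
    omega

lemma dist_getVert_le' (hG : G.Connected) {u v : V} (W : G.Walk u v) {i j : ℕ} (hij : i ≤ j) :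
    (G.dist (W.getVert i) (W.getVert j) : ℝ) ≤ (j : ℝ) - i := by
  obtain ⟨n, rfl⟩ := Nat.exists_eq_add_of_le hij
  have : (G.dist (W.getVert i) (W.getVert (i + n)) : ℝ) ≤ n := by
    exact_mod_cast dist_getVert_le hG W i n
  push_cast
  linarith

lemma pos_on_walk {u v : V} (W : G.Walk u v) {x : MGPoint G} (hx : ptEdge x ∈ W.edges) :
    ∃ i < W.length, ∃ τ, IsEnd x (W.getVert i) τ ∧ IsEnd x (W.getVert (i + 1)) (1 - τ) := by
  obtain ⟨i, hi, h⟩ := (W.mk_mem_edges_iff_exists).mp hx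
  refine ⟨i, hi, ?_⟩
  rcases Sym2.eq_iff.mp h with ⟨h1, h2⟩ | ⟨h1, h2⟩
  · exact ⟨x.1.2.2, Or.inl ⟨h1, rfl⟩, Or.inr ⟨h2, rfl⟩⟩
  · exact ⟨1 - x.1.2.2, Or.inr ⟨h1, rfl⟩, Or.inl ⟨h2, by ring⟩⟩

lemma vd_walk_sum (hG : G.Connected) {u v : V} (W : G.Walk u v) {x : MGPoint G}
    (hx : ptEdge x ∈ W.edges) : mgVDist G u x + mgVDist G v x ≤ W.length := by
  obtain ⟨i, hi, τ, h1, h2⟩ := pos_on_walk W hx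
  have e1 := vd_le h1 u
  have e2 := vd_le h2 v
  have d1 := dist_getVert_le' hG W (Nat.zero_le i)
  have d2 := dist_getVert_le' hG W (Nat.succ_le_of_lt hi)
  rw [W.getVert_zero] at d1
  rw [W.getVert_length, G.dist_comm] at d2
  push_cast at d1 d2
  linarith

lemma closed_walk_diam_aux (hG : G.Connected) {c : V} (W : G.Walk c c) {x y : MGPoint G}
    {i j : ℕ} {τ τ' : ℝ} (hij : i < j) (hj : j < W.length)
    (h2 : IsEnd x (W.getVert (i + 1)) (1 - τ)) (h1 : IsEnd x (W.getVert i) τ)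
    (h1' : IsEnd y (W.getVert j) τ') (h2' : IsEnd y (W.getVert (j + 1)) (1 - τ')) :
    mgDist G x y ≤ (W.length : ℝ) / 2 := by
  have e1 := mg_le h2 h1'
  have e2 := mg_le h1 h2'
  have d1 := dist_getVert_le' hG W (Nat.succ_le_of_lt hij)
  have d2 := dist_getVert_le' hG W (Nat.zero_le i)
  have d3 := dist_getVert_le' hG W (Nat.succ_le_of_lt hj)
  rw [W.getVert_zero, G.dist_comm] at d2
  rw [W.getVert_length, G.dist_comm] at d3
  have t := real_dist_triangle hG (W.getVert i) c (W.getVert (j + 1))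
  push_cast at d1 d2 d3
  simp only [Nat.succ_eq_add_one] at d1 d3
  linarith

lemma closed_walk_diam (hG : G.Connected) {c : V} (W : G.Walk c c) (hW : 2 ≤ W.length)
    {x y : MGPoint G} (hx : ptEdge x ∈ W.edges) (hy : ptEdge y ∈ W.edges) :
    mgDist G x y ≤ (W.length : ℝ) / 2 := by
  obtain ⟨i, hi, τ, h1, h2⟩ := pos_on_walk W hx
  obtain ⟨j, hj, τ', h1', h2'⟩ := pos_on_walk W hy
  rcases lt_trichotomy i j with h | h | h
  · exact closed_walk_diam_aux hG W h hj h2 h1 h1' h2'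
  · subst h
    have e1 := mg_le h1 h1'
    have e2 := mg_le h2 h2'
    simp only [SimpleGraph.dist_self, Nat.cast_zero] at e1 e2
    have : (2 : ℝ) ≤ W.length := by exact_mod_cast hW
    linarith
  · rw [mg_symm]
    exact closed_walk_diam_aux hG W h hi h2' h1' h1 h2

lemma walk_length_one {u v : V} (W : G.Walk u v) (h : W.length = 1) :
    W.edges = [s(u, v)] ∧ W.support = [u, v] ∧ G.Adj u v := by
  cases W with
  | nil => simp at h
  | cons h' W' =>
    cases W' with
    | nil => simp [h']
    | cons h'' W'' => simp at h

lemma ends_mem_support {u v : V} (W : G.Walk u v) {x : MGPoint G} (hx : ptEdge x ∈ W.edges) :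
    x.1.1 ∈ W.support ∧ x.1.2.1 ∈ W.support :=
  ⟨W.fst_mem_support_of_mem_edges hx, W.snd_mem_support_of_mem_edges hx⟩

end walks

/-- Corollary (CX): if `α j = 1` for `1 ≤ j ≤ k`, then
`δ(G_{A,B,B'}) ≤ max{1/2 + L(C₀)/4, 1/2 + L(C_k)/4, max_{0<j<k} (2 + max{β j, β' j})/2}`,
stated as: `δ(G) ≤ d` for every upper bound `d` of the displayed quantities,
where `L(C j) = β j + β' j + α j + α (j+1)`. -/
theorem hypDelta_chain_le_one {V : Type} [Fintype V] [DecidableEq V] (G : SimpleGraph V)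
    (hG : G.Connected) (k : ℕ) (hk : 1 ≤ k) (al be be' : ℕ → ℕ)
    (hbe'0 : be' 0 = 0) (hbe'k : be' k = 0) (hal0 : al 0 = 0) (halk : al (k + 1) = 0)
    (hineq1 : ∀ j, 1 ≤ j → j ≤ k → al j < be j + al (j + 1) + be' j)
    (hineq2 : ∀ j, 1 ≤ j → j ≤ k → al j < be (j - 1) + al (j - 1) + be' (j - 1))
    (halone : ∀ j, 1 ≤ j → j ≤ k → al j = 1)
    (p q : ℕ → V)
    (A : ∀ j, G.Walk (p j) (q j))
    (B0 : G.Walk (q 1) (p 1)) (Bk : G.Walk (p k) (q k))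
    (Bmid : ∀ j, G.Walk (p j) (p (j + 1)))
    (B'mid : ∀ j, G.Walk (q j) (q (j + 1)))
    (hA : ∀ j, 1 ≤ j → j ≤ k → (A j).IsPath ∧ (A j).length = al j)
    (hB0 : B0.IsPath ∧ B0.length = be 0)
    (hBk : Bk.IsPath ∧ Bk.length = be k)
    (hBmid : ∀ j, 1 ≤ j → j + 1 ≤ k → (Bmid j).IsPath ∧ (Bmid j).length = be j)
    (hB'mid : ∀ j, 1 ≤ j → j + 1 ≤ k → (B'mid j).IsPath ∧ (B'mid j).length = be' j)
    (Cs : ℕ → Set V)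
    (hCs0 : Cs 0 = {v | v ∈ B0.support ∨ v ∈ (A 1).support})
    (hCsk : Cs k = {v | v ∈ Bk.support ∨ v ∈ (A k).support})
    (hCsmid : ∀ j, 0 < j → j < k → Cs j =
      {v | v ∈ (Bmid j).support ∨ v ∈ (B'mid j).support ∨
        v ∈ (A j).support ∨ v ∈ (A (j + 1)).support})
    (hconsec : ∀ j, j < k → Cs j ∩ Cs (j + 1) = {v | v ∈ (A (j + 1)).support})
    (hfar : ∀ i j, i + 1 < j → j ≤ k → Cs i ∩ Cs j = ∅)
    (hVc : ∀ v : V, ∃ j, j ≤ k ∧ v ∈ Cs j)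
    (hE : ∀ e ∈ G.edgeSet, e ∈ B0.edges ∨ e ∈ Bk.edges ∨
      (∃ j, 1 ≤ j ∧ j ≤ k ∧ e ∈ (A j).edges) ∨
      (∃ j, 1 ≤ j ∧ j + 1 ≤ k ∧ e ∈ (Bmid j).edges) ∨
      (∃ j, 1 ≤ j ∧ j + 1 ≤ k ∧ e ∈ (B'mid j).edges)) :
    ∀ d : ℝ,
      (1 / 2 + ((be 0 : ℝ) + (be' 0 : ℝ) + (al 0 : ℝ) + (al 1 : ℝ)) / 4 ≤ d) →
      (1 / 2 + ((be k : ℝ) + (be' k : ℝ) + (al k : ℝ) + (al (k + 1) : ℝ)) / 4 ≤ d) →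
      (∀ j, 0 < j → j < k → (2 + max (be j : ℝ) (be' j : ℝ)) / 2 ≤ d) →
      hypDelta G ≤ d := by
  intro d hd0 hdk hdm
  have hA1 : ∀ j, 1 ≤ j → j ≤ k →
      (A j).edges = [s(p j, q j)] ∧ (A j).support = [p j, q j] ∧ G.Adj (p j) (q j) :=
    fun j h1 h2 => walk_length_one (A j) ((hA j h1 h2).2.trans (halone j h1 h2))
  have hbe0 : 2 ≤ be 0 := by
    have h1 := hineq2 1 le_rfl hk
    have h2 := halone 1 le_rfl hk
    simp only [Nat.sub_self] at h1
    omega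
  have hbek : 2 ≤ be k := by
    have h1 := hineq1 k hk le_rfl
    have h2 := halone k hk le_rfl
    omega
  have hbm : ∀ j, 0 < j → j < k → 1 ≤ be j + be' j := by
    intro j h1 h2
    have h3 := hineq1 j h1 h2.le
    have h4 := halone j h1 h2.le
    have h5 := halone (j + 1) (by omega) h2
    omega
  have hdpos : 0 ≤ d := by
    refine le_trans ?_ hd0
    positivity
  have hWex : ∀ j, ∃ c, ∃ W : G.Walk c c, j ≤ k →
      ((W.length : ℝ) + 2 ≤ 4 * d ∧ 2 ≤ W.length ∧ (∀ v ∈ W.support, v ∈ Cs j) ∧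
      (1 ≤ j → s(p j, q j) ∈ W.edges) ∧ (j < k → s(p (j + 1), q (j + 1)) ∈ W.edges) ∧
      (j = 0 → ∀ e ∈ B0.edges, e ∈ W.edges) ∧ (j = k → ∀ e ∈ Bk.edges, e ∈ W.edges) ∧
      (0 < j → j < k → ∀ e, e ∈ W.edges ↔
        e ∈ (Bmid j).edges ∨ e ∈ (B'mid j).edges ∨ e = s(p j, q j) ∨
          e = s(p (j + 1), q (j + 1)))) := by
    intro j
    rcases Nat.eq_zero_or_pos j with h0 | h0
    · subst h0
      obtain ⟨a1, a2, a3⟩ := hA1 1 le_rfl hk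
      have e1 := halone 1 le_rfl hk
      refine ⟨_, B0.append (A 1), fun _ => ⟨?_, ?_, ?_, ?_, ?_, ?_, ?_, ?_⟩⟩
      · rw [Walk.length_append, hB0.2, (hA 1 le_rfl hk).2, e1]
        rw [hbe'0, hal0, e1] at hd0
        push_cast at hd0 ⊢
        linarith
      · rw [Walk.length_append, hB0.2]; omega
      · intro v hv
        rw [hCs0]
        exact Walk.mem_support_append_iff _ _ |>.mp hv
      · intro h; omega
      · intro _
        rw [Walk.edges_append, a1]; simp
      · intro _ e he
        rw [Walk.edges_append]; simp [he]
      · intro h; omega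
      · intro h; omega
    · rcases lt_trichotomy j k with hjk | hjk | hjk
      · obtain ⟨a1, a2, a3⟩ := hA1 j h0 hjk.le
        obtain ⟨a1', a2', a3'⟩ := hA1 (j + 1) (by omega) hjk
        have e1 := halone j h0 hjk.le
        have e2 := halone (j + 1) (by omega) hjk
        have lB := (hBmid j h0 hjk).2
        have lB' := (hB'mid j h0 hjk).2
        have lA := (hA j h0 hjk.le).2
        have lA' := (hA (j + 1) (by omega) hjk).2
        have hlen : (((Bmid j).append (A (j + 1))).append
          ((B'mid j).reverse.append (A j).reverse)).length = be j + be' j + 2 := by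
          simp only [Walk.length_append, Walk.length_reverse, lB, lB', lA, lA', e1, e2]
          ring
        have hedges : ∀ e, e ∈ (((Bmid j).append (A (j + 1))).append
          ((B'mid j).reverse.append (A j).reverse)).edges ↔
            e ∈ (Bmid j).edges ∨ e ∈ (B'mid j).edges ∨ e = s(p j, q j) ∨
            e = s(p (j + 1), q (j + 1)) := by
          intro e
          simp only [Walk.edges_append, Walk.edges_reverse, a1, a1', List.mem_append,
            List.mem_reverse, List.mem_singleton]
          tauto
        refine ⟨_, ((Bmid j).append (A (j + 1))).append
          ((B'mid j).reverse.append (A j).reverse), fun _ => ⟨?_, ?_, ?_, ?_, ?_, ?_, ?_, ?_⟩⟩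
        · rw [hlen]
          have := hdm j h0 hjk
          have m1 := le_max_left (be j : ℝ) (be' j : ℝ)
          have m2 := le_max_right (be j : ℝ) (be' j : ℝ)
          push_cast
          linarith
        · rw [hlen]; omega
        · intro v hv
          rw [hCsmid j h0 hjk]
          simp only [Walk.mem_support_append_iff, Walk.support_reverse, List.mem_reverse] at hv
          simp only [Set.mem_setOf_eq]
          tauto
        · intro _
          rw [hedges]; tauto
        · intro _
          rw [hedges]; tauto
        · intro h; omega
        · intro h; omega
        · intro _ _
          exact hedges
      · subst hjk
        obtain ⟨a1, a2, a3⟩ := hA1 j hk le_rfl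
        have e1 := halone j hk le_rfl
        refine ⟨_, Bk.append (A j).reverse, fun _ => ⟨?_, ?_, ?_, ?_, ?_, ?_, ?_, ?_⟩⟩
        · rw [Walk.length_append, Walk.length_reverse, hBk.2, (hA j hk le_rfl).2, e1]
          rw [hbe'k, halk, e1] at hdk
          push_cast at hdk ⊢
          linarith
        · rw [Walk.length_append, hBk.2]; omega
        · intro v hv
          rw [hCsk]
          simp only [Walk.mem_support_append_iff, Walk.support_reverse, List.mem_reverse] at hv
          exact hv
        · intro _
          rw [Walk.edges_append, Walk.edges_reverse, a1]; simp
        · intro h; omega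
        · intro h; omega
        · intro _ e he
          rw [Walk.edges_append]; simp [he]
        · intro _ h; omega
      · exact ⟨p 0, Walk.nil, fun h => by omega⟩
  choose c W hW using hWex
  have hcover : ∀ x : MGPoint G, ∃ j ≤ k, ptEdge x ∈ (W j).edges := by
    intro x
    have hxe : ptEdge x ∈ G.edgeSet := x.2.1
    rcases hE _ hxe with h | h | ⟨j, h1, h2, h⟩ | ⟨j, h1, h2, h⟩ | ⟨j, h1, h2, h⟩
    · exact ⟨0, by omega, (hW 0 (by omega)).2.2.2.2.2.1 rfl _ h⟩
    · exact ⟨k, le_rfl, (hW k le_rfl).2.2.2.2.2.2.1 rfl _ h⟩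
    · refine ⟨j, h2, ?_⟩
      rw [(hA1 j h1 h2).1, List.mem_singleton] at h
      rw [h]
      exact (hW j h2).2.2.2.1 h1
    · exact ⟨j, by omega, ((hW j (by omega)).2.2.2.2.2.2.2 h1 h2 _).mpr (Or.inl h)⟩
    · exact ⟨j, by omega, ((hW j (by omega)).2.2.2.2.2.2.2 h1 h2 _).mpr (Or.inr (Or.inl h))⟩
  have hCsmem : ∀ j ≤ k, ∀ x : MGPoint G, ptEdge x ∈ (W j).edges →
      x.1.1 ∈ Cs j ∧ x.1.2.1 ∈ Cs j := by
    intro j hj x hx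
    obtain ⟨h1, h2⟩ := ends_mem_support (W j) hx
    exact ⟨(hW j hj).2.2.1 _ h1, (hW j hj).2.2.1 _ h2⟩
  have C : ChainData G k p q (fun j => {e | e ∈ (W j).edges})
      (fun j => {v | ∃ i, i < j ∧ v ∈ Cs i}) (fun j => {v | ∃ i, j ≤ i ∧ i ≤ k ∧ v ∈ Cs i}) d := by
    refine ⟨hcover, ?_, ?_, ?_, ?_, ?_, ?_, ?_⟩
    · intro j h1 h2
      refine ⟨?_, ?_, (hA1 j h1 h2).2.2⟩
      · intro u v huv
        let x : MGPoint G := ⟨(u, v, 0), huv, by simp⟩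
        obtain ⟨i, hi, hx⟩ := hcover x
        obtain ⟨m1, m2⟩ := hCsmem i hi x hx
        rcases lt_or_ge i j with h | h
        · exact Or.inl ⟨⟨i, h, m1⟩, ⟨i, h, m2⟩⟩
        · exact Or.inr ⟨⟨i, h, hi, m1⟩, ⟨i, h, hi, m2⟩⟩
      · rintro v ⟨i, hi, hv⟩ ⟨i', hi', hk', hv'⟩
        by_cases hfar' : i + 1 < i'
        · have : v ∈ Cs i ∩ Cs i' := ⟨hv, hv'⟩
          rw [hfar i i' hfar' hk'] at this
          exact absurd this (Set.notMem_empty v)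
        · obtain rfl : i' = i + 1 := by omega
          obtain rfl : j = i + 1 := by omega
          have : v ∈ Cs i ∩ Cs (i + 1) := ⟨hv, hv'⟩
          rw [hconsec i (by omega), Set.mem_setOf_eq, (hA1 (i + 1) h1 h2).2.1] at this
          simpa using this
    · intro i j hij hj x hx
      obtain ⟨m1, m2⟩ := hCsmem i (by omega) x hx
      exact ⟨⟨i, hij, m1⟩, ⟨i, hij, m2⟩⟩
    · intro i j h1 hij hi x hx
      obtain ⟨m1, m2⟩ := hCsmem i hi x hx
      exact ⟨⟨i, hij, hi, m1⟩, ⟨i, hij, hi, m2⟩⟩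
    · intro j h1 h2
      exact (hW j h2).2.2.2.1 h1
    · intro j hj
      exact (hW j hj.le).2.2.2.2.1 hj
    · intro j hj x y hx hy
      have h1 := closed_walk_diam hG (W j) (hW j hj).2.1 hx hy
      have h2 := (hW j hj).1
      linarith
    · intro j h0 hj x hx
      have hd := hdm j h0 hj
      have m1 := le_max_left (be j : ℝ) (be' j : ℝ)
      have m2 := le_max_right (be j : ℝ) (be' j : ℝ)
      have hone : (1 : ℝ) ≤ max (be j : ℝ) (be' j : ℝ) := by
        have h3 := hbm j h0 hj
        rcases Nat.eq_zero_or_pos (be j) with h | h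
        · have : (1 : ℝ) ≤ be' j := by exact_mod_cast (by omega : 1 ≤ be' j)
          linarith
        · have : (1 : ℝ) ≤ be j := by exact_mod_cast h
          linarith
      have pick : ∀ c1 c2 : V, mgVDist G c1 x + mgVDist G c2 x ≤ max (be j : ℝ) (be' j : ℝ) →
          mgVDist G c1 x + 1 ≤ d ∨ mgVDist G c2 x + 1 ≤ d := by
        intro c1 c2 h
        by_cases hc : mgVDist G c1 x + 1 ≤ d
        · exact Or.inl hc
        · right; linarith
      have lone : ∀ i, 1 ≤ i → i ≤ k → ptEdge x = s(p i, q i) →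
          mgVDist G (p i) x + mgVDist G (q i) x ≤ max (be j : ℝ) (be' j : ℝ) := by
        intro i h1 h2 he
        have := vd_walk_sum hG (A i) (x := x) (by rw [(hA1 i h1 h2).1, he]; simp)
        rw [(hA i h1 h2).2, halone i h1 h2] at this
        push_cast at this
        linarith
      rcases ((hW j hj.le).2.2.2.2.2.2.2 h0 hj _).mp hx with h | h | h | h
      · have := vd_walk_sum hG (Bmid j) h
        rw [(hBmid j h0 hj).2] at this
        rcases pick _ _ (this.trans m1) with h | h
        · exact ⟨_, Or.inl (Or.inl rfl), h⟩
        · exact ⟨_, Or.inr (Or.inl rfl), h⟩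
      · have := vd_walk_sum hG (B'mid j) h
        rw [(hB'mid j h0 hj).2] at this
        rcases pick _ _ (this.trans m2) with h | h
        · exact ⟨_, Or.inl (Or.inr rfl), h⟩
        · exact ⟨_, Or.inr (Or.inr rfl), h⟩
      · rcases pick _ _ (lone j h0 hj.le h) with h | h
        · exact ⟨_, Or.inl (Or.inl rfl), h⟩
        · exact ⟨_, Or.inl (Or.inr rfl), h⟩
      · rcases pick _ _ (lone (j + 1) (by omega) hj h) with h | h
        · exact ⟨_, Or.inr (Or.inl rfl), h⟩
        · exact ⟨_, Or.inr (Or.inr rfl), h⟩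
  exact C.hypDelta_le hG hdpos
end
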